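/- arXiv:2107.04348 — 4 statements merged into one kernel-verified Lean document; each statement's English description precedes it below -/
import Mathlib

section
/- (Harman's asymptotic sieve.) Let x ≥ 2, let A and B be finite sets of positive integers, and let λ > 0, 0 < α < 1, 0 < β ≤ 1/2, M > x^α and X ≥ 1 be fixed. Suppose that for all sequences (a_m)_{m∈ℕ} and (b_n)_{n∈ℕ} of complex numbers with |a_m| ≤ τ(m) and |b_n| ≤ τ(n) one has |Σ_{m ≤ M} a_m·#{n : mn ∈ A} − λ·Σ_{m ≤ M} a_m·#{n : mn ∈ B}| ≤ X (weighted by a_m; i.e. |Σ_{mn∈A, m≤M} a_m − λ·Σ_{mn∈B, m≤M} a_m| ≤ X) and |Σ_{mn∈A, x^α < m ≤ x^{α+β}} a_m b_n − λ·Σ_{mn∈B, x^α < m ≤ x^{α+β}} a_m b_n| ≤ X. Then |S(A, x^β) − λ·S(B, x^β)| = O(X·(log x)^3), with an absolute implied constant. -/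
open scoped Classical
open Finset

/-- `S(M, z)`: number of elements of `M` all of whose prime divisors are `≥ z`. -/
noncomputable def sieveCount (M : Finset ℕ) (z : ℝ) : ℕ :=
  (M.filter (fun n => ∀ p : ℕ, p.Prime → p ∣ n → z ≤ (p : ℝ))).card

/-- Sum of `a m` over pairs `(m, n)` of positive integers with `m * n ∈ A` and
`m` satisfying the predicate `P` (expressed via divisors). -/
noncomputable def typeISum (A : Finset ℕ) (P : ℕ → Prop) (a : ℕ → ℂ) : ℂ :=
  ∑ k ∈ A, ∑ m ∈ k.divisors.filter P, a m

/-- Sum of `a m * b n` over pairs `(m, n)` of positive integers with `m * n ∈ A`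
and `m` satisfying the predicate `P`. -/
noncomputable def typeIISum (A : Finset ℕ) (P : ℕ → Prop) (a b : ℕ → ℂ) : ℂ :=
  ∑ k ∈ A, ∑ m ∈ k.divisors.filter P, a m * b (k / m)

section KernelSeparation

private theorem map_diagonal_norm_le (L : (ℕ → ℕ → ℂ) →ₗ[ℂ] ℂ) {X : ℝ}
    (h : ∀ u v : ℕ → ℂ, (∀ i, ‖u i‖ ≤ 1) → (∀ j, ‖v j‖ ≤ 1) → ‖L fun i j => u i * v j‖ ≤ X)
    (N : ℕ) [NeZero N] (f g : ℕ → ℕ) (p q : ℕ → Prop)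
    (hf : ∀ i, p i → f i < N) (hg : ∀ j, q j → g j < N) :
    ‖L fun i j => if p i ∧ q j ∧ f i = g j then 1 else 0‖ ≤ X := by
  let u : ZMod N → ℕ → ℂ := fun c i => if p i then ZMod.stdAddChar (c * (f i : ZMod N)) else 0
  let v : ZMod N → ℕ → ℂ := fun c j => if q j then ZMod.stdAddChar (-(c * (g j : ZMod N))) else 0
  have hN' : (0 : ℝ) < N := Nat.cast_pos.mpr (NeZero.pos N)
  have hu : ∀ c i, ‖u c i‖ ≤ 1 := fun c i => by
    simp only [u]; split_ifs <;> simp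
  have hv : ∀ c j, ‖v c j‖ ≤ 1 := fun c j => by
    simp only [v]; split_ifs <;> simp
  have key : (N : ℂ) • (fun i j => if p i ∧ q j ∧ f i = g j then (1 : ℂ) else 0)
      = ∑ c : ZMod N, fun i j => u c i * v c j := by
    funext i j
    simp only [Pi.smul_apply, smul_eq_mul, Finset.sum_apply, u, v]
    by_cases hp : p i
    · by_cases hq : q j
      · have hs := AddChar.sum_mulShift ((f i : ZMod N) - g j) (ZMod.isPrimitive_stdAddChar N)
        have heq : ((f i : ZMod N) - g j = 0) ↔ f i = g j := by
          rw [sub_eq_zero, ZMod.natCast_eq_natCast_iff', Nat.mod_eq_of_lt (hf i hp),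
            Nat.mod_eq_of_lt (hg j hq)]
        simp only [hp, hq, true_and, if_true, ← AddChar.map_add_eq_mul, ← sub_eq_add_neg, ← mul_sub]
        rw [hs]
        simp only [heq, ZMod.card]
        split_ifs <;> simp
      · simp [hq]
    · simp [hp]
  have hL : (N : ℝ) * ‖L fun i j => if p i ∧ q j ∧ f i = g j then 1 else 0‖ ≤ N * X := by
    have := congrArg (fun k => ‖L k‖) key
    simp only [map_smul, map_sum, norm_smul, Complex.norm_natCast] at this
    rw [this]
    refine (norm_sum_le _ _).trans ?_
    refine (Finset.sum_le_sum fun c _ => h _ _ (hu c) (hv c)).trans ?_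
    simp [ZMod.card]
  exact le_of_mul_le_mul_left hL hN'

private def halveKernel : (ℕ → ℕ → ℂ) →ₗ[ℂ] (ℕ → ℕ → ℂ) where
  toFun k := fun i j => k (i / 2) (j / 2)
  map_add' _ _ := rfl
  map_smul' _ _ := rfl

private noncomputable def triangleKernel (t : ℕ) : ℕ → ℕ → ℂ :=
  fun i j => if i < j ∧ j < 2 ^ t then 1 else 0

/-- A linear functional on kernels which is bounded by `X` on all products of bounded functions
is bounded by `t * X` on the triangular kernel of size `2 ^ t`. -/
private theorem map_triangle_norm_le {X : ℝ} (t : ℕ) : ∀ L : (ℕ → ℕ → ℂ) →ₗ[ℂ] ℂ,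
    (∀ u v : ℕ → ℂ, (∀ i, ‖u i‖ ≤ 1) → (∀ j, ‖v j‖ ≤ 1) → ‖L fun i j => u i * v j‖ ≤ X) →
    ‖L (triangleKernel t)‖ ≤ t * X := by
  induction t with
  | zero =>
    intro L _
    have : triangleKernel 0 = 0 := by
      funext i j
      simp only [triangleKernel, Pi.zero_apply, ite_eq_right_iff]
      intro hij
      omega
    simp [this]
  | succ t ih =>
    intro L h
    have hsplit : triangleKernel (t + 1) = halveKernel (triangleKernel t)
          + fun i j => if (i % 2 = 0 ∧ i / 2 < 2 ^ t) ∧ (j % 2 = 1 ∧ j / 2 < 2 ^ t) ∧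
              i / 2 = j / 2 then 1 else 0 := by
      funext i j
      have h2 : 2 ^ (t + 1) = 2 * 2 ^ t := pow_succ' 2 t
      simp only [Pi.add_apply, triangleKernel, halveKernel, LinearMap.coe_mk, AddHom.coe_mk, h2]
      generalize 2 ^ t = N
      split_ifs <;> first | omega | simp
    rw [hsplit, map_add]
    refine (norm_add_le _ _).trans ?_
    have h1 := ih (L.comp halveKernel) fun u v hu hv =>
      h (fun i => u (i / 2)) (fun j => v (j / 2)) (fun i => hu _) (fun j => hv _)
    have h2 := map_diagonal_norm_le L h (2 ^ t) (fun i => i / 2) (fun j => j / 2)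
      (fun i => i % 2 = 0 ∧ i / 2 < 2 ^ t) (fun j => j % 2 = 1 ∧ j / 2 < 2 ^ t)
      (fun i hi => hi.2) (fun j hj => hj.2)
    calc _ ≤ t * X + X := add_le_add h1 ((le_of_eq (by congr!)).trans h2)
      _ = _ := by push_cast; ring

end KernelSeparation

section PointwiseIdentity

open ArithmeticFunction

private noncomputable def smoothMoebius (z : ℝ) (d : ℕ) : ℂ :=
  if ∀ p : ℕ, p.Prime → p ∣ d → (p : ℝ) < z then (moebius d : ℂ) else 0

private theorem norm_smoothMoebius_le (z : ℝ) (d : ℕ) : ‖smoothMoebius z d‖ ≤ 1 := by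
  unfold smoothMoebius
  split_ifs
  · rw [Complex.norm_intCast]
    exact_mod_cast abs_moebius_le_one
  · simp

private theorem smoothMoebius_prime_mul {z : ℝ} {p d : ℕ} (hp : p.Prime) (hpz : (p : ℝ) < z)
    (hpd : ¬ p ∣ d) : smoothMoebius z (p * d) = -smoothMoebius z d := by
  have hc : Nat.Coprime p d := (Nat.Prime.coprime_iff_not_dvd hp).mpr hpd
  have hiff : (∀ q : ℕ, q.Prime → q ∣ p * d → (q : ℝ) < z) ↔
      ∀ q : ℕ, q.Prime → q ∣ d → (q : ℝ) < z := by
    refine ⟨fun h q hq hqd => h q hq (hqd.mul_left p), fun h q hq hqd => ?_⟩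
    rcases hq.dvd_mul.mp hqd with h1 | h1
    · rwa [(Nat.prime_dvd_prime_iff_eq hq hp).mp h1]
    · exact h q hq h1
  unfold smoothMoebius
  simp only [hiff, isMultiplicative_moebius.map_mul_of_coprime hc, moebius_apply_prime hp]
  split_ifs <;> simp

private noncomputable def sieveWeight (y z : ℝ) (k d : ℕ) : ℂ :=
  smoothMoebius z d *
    if (d : ℝ) ≤ y ∨ (((d / d.minFac : ℕ) : ℝ) ≤ y ∧ d.minFac = k.minFac) then 1 else 0

private theorem sieveWeight_minFac_mul {y z : ℝ} {k d : ℕ} (hk : k ≠ 1) (hkz : (k.minFac : ℝ) < z)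
    (hd : k.minFac * d ∣ k) (hpd : ¬ k.minFac ∣ d) :
    sieveWeight y z k (k.minFac * d) = -sieveWeight y z k d := by
  have hp : k.minFac.Prime := Nat.minFac_prime hk
  have hmin : (k.minFac * d).minFac = k.minFac := by
    apply le_antisymm
    · exact Nat.minFac_le_of_dvd hp.two_le (dvd_mul_right _ _)
    · refine Nat.minFac_le_of_dvd (Nat.minFac_prime ?_).two_le ((Nat.minFac_dvd _).trans hd)
      exact fun h => hp.one_lt.ne' (Nat.eq_one_of_mul_eq_one_right h)
  have hne : d.minFac ≠ k.minFac := fun h => hpd (h ▸ Nat.minFac_dvd d)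
  have hle : ((k.minFac * d : ℕ) : ℝ) ≤ y → (d : ℝ) ≤ y := fun h =>
    le_trans (by exact_mod_cast Nat.le_mul_of_pos_left d hp.pos) h
  unfold sieveWeight
  rw [smoothMoebius_prime_mul hp hkz hpd, hmin, Nat.mul_div_cancel_left _ hp.pos]
  simp only [hne, and_false, or_false, and_true, or_iff_right_of_imp hle, neg_mul]

private theorem sum_sieveWeight {y z : ℝ} (hy : 1 ≤ y) {k : ℕ} (hk : 0 < k) :
    ∑ d ∈ k.divisors, sieveWeight y z k d
      = if ∀ p : ℕ, p.Prime → p ∣ k → z ≤ (p : ℝ) then 1 else 0 := by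
  split_ifs with h
  · rw [Finset.sum_eq_single 1]
    · simp [sieveWeight, smoothMoebius, hy]
      intro hp
      exact absurd hp Nat.not_prime_one
    · intro d hd hd1
      have hdk := Nat.dvd_of_mem_divisors hd
      have : smoothMoebius z d = 0 := by
        unfold smoothMoebius
        rw [if_neg]
        intro h'
        have hq := Nat.minFac_prime hd1
        exact absurd (h' _ hq (Nat.minFac_dvd d))
          (not_lt.mpr (h _ hq ((Nat.minFac_dvd d).trans hdk)))
      simp [sieveWeight, this]
    · simp [hk.ne']
  · push Not at h
    obtain ⟨p, hp, hpk, hpz⟩ := h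
    have hk1 : k ≠ 1 := fun h1 => hp.ne_one (Nat.dvd_one.mp (h1 ▸ hpk))
    have hP : k.minFac.Prime := Nat.minFac_prime hk1
    have hPz : (k.minFac : ℝ) < z :=
      lt_of_le_of_lt (by exact_mod_cast Nat.minFac_le_of_dvd hp.two_le hpk) hpz
    have hsq : ∑ d ∈ k.divisors, sieveWeight y z k d
        = ∑ d ∈ k.divisors with Squarefree d, sieveWeight y z k d := by
      rw [Finset.sum_filter]
      refine Finset.sum_congr rfl fun d _ => ?_
      split_ifs with hd
      · rfl
      · simp [sieveWeight, smoothMoebius, moebius_eq_zero_of_not_squarefree hd]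
    rw [hsq]
    have hmul : ∀ d, d ∣ k → ¬ k.minFac ∣ d → k.minFac * d ∣ k := fun d hd hn =>
      ((Nat.Prime.coprime_iff_not_dvd hP).mpr hn).mul_dvd_of_dvd_of_dvd (Nat.minFac_dvd k) hd
    have hndvd : ∀ e, Squarefree (k.minFac * e) → ¬ k.minFac ∣ e := fun e he hdvd =>
      hP.not_isUnit (he _ (mul_dvd_mul_left _ hdvd))
    refine Finset.sum_involution
      (fun d _ => if k.minFac ∣ d then d / k.minFac else k.minFac * d) ?_ ?_ ?_ ?_
    · intro d hd
      simp only [Finset.mem_filter, Nat.mem_divisors] at hd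
      obtain ⟨⟨hdk, -⟩, hds⟩ := hd
      split_ifs with hdv
      · obtain ⟨e, rfl⟩ := hdv
        rw [Nat.mul_div_cancel_left _ hP.pos,
          sieveWeight_minFac_mul hk1 hPz hdk (hndvd e hds), neg_add_cancel]
      · rw [sieveWeight_minFac_mul hk1 hPz (hmul d hdk hdv) hdv, add_neg_cancel]
    · intro d hd _ heq
      simp only [Finset.mem_filter, Nat.mem_divisors] at hd
      obtain ⟨⟨hdk, -⟩, hds⟩ := hd
      have hd0 : 0 < d := Nat.pos_of_ne_zero hds.ne_zero
      split_ifs at heq with hdv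
      · exact (Nat.div_lt_self hd0 hP.one_lt).ne heq
      · exact hdv ⟨1, by nlinarith [hP.two_le]⟩
    · intro d hd
      simp only [Finset.mem_filter, Nat.mem_divisors] at hd ⊢
      obtain ⟨⟨hdk, -⟩, hds⟩ := hd
      split_ifs with hdv
      · have hdd := Nat.div_dvd_of_dvd hdv
        exact ⟨⟨hdd.trans hdk, hk.ne'⟩, hds.squarefree_of_dvd hdd⟩
      · refine ⟨⟨hmul d hdk hdv, hk.ne'⟩, ?_⟩
        exact (Nat.squarefree_mul ((Nat.Prime.coprime_iff_not_dvd hP).mpr hdv)).mpr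
          ⟨hP.prime.squarefree, hds⟩
    · intro d hd
      simp only [Finset.mem_filter, Nat.mem_divisors] at hd
      obtain ⟨⟨hdk, -⟩, hds⟩ := hd
      by_cases hdv : k.minFac ∣ d
      · obtain ⟨e, rfl⟩ := hdv
        simp [Nat.mul_div_cancel_left _ hP.pos, hndvd e hds]
      · simp [hdv, Nat.mul_div_cancel_left _ hP.pos]

/-- The least prime factor, truncated at `N`, with value `N` at `1`. -/
private def truncMinFac (N n : ℕ) : ℕ := if n = 1 then N else min n.minFac N

private theorem minFac_lt_truncMinFac_add_one_iff {N m n : ℕ} (hm : m ≠ 1) (hmN : m.minFac < N) :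
    m.minFac < truncMinFac N n + 1 ↔ m.minFac = (m * n).minFac := by
  have hmn : m * n ≠ 1 := fun h => hm (Nat.eq_one_of_mul_eq_one_right h)
  have hle : (m * n).minFac ≤ m.minFac :=
    Nat.minFac_le_of_dvd (Nat.minFac_prime hm).two_le ((Nat.minFac_dvd m).mul_right n)
  unfold truncMinFac
  split_ifs with hn
  · simp [hn]; omega
  · constructor
    · intro h
      refine le_antisymm ?_ hle
      have hq := Nat.minFac_prime hmn
      rcases hq.dvd_mul.mp (Nat.minFac_dvd (m * n)) with h1 | h1
      · exact Nat.minFac_le_of_dvd hq.two_le h1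
      · have := Nat.minFac_le_of_dvd hq.two_le h1
        omega
    · intro h
      have : (m * n).minFac ≤ n.minFac :=
        Nat.minFac_le_of_dvd (Nat.minFac_prime hn).two_le ((Nat.minFac_dvd n).mul_left m)
      omega

private noncomputable def leftWeight (y z : ℝ) (m : ℕ) : ℂ :=
  smoothMoebius z m * if ((m / m.minFac : ℕ) : ℝ) ≤ y then 1 else 0

private theorem norm_leftWeight_le (y z : ℝ) (m : ℕ) : ‖leftWeight y z m‖ ≤ 1 := by
  unfold leftWeight
  split_ifs
  · simpa using norm_smoothMoebius_le z m
  · simp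

private theorem sieveWeight_eq {y z : ℝ} (hy : 1 ≤ y) {t k d : ℕ}
    (hzt : z ≤ 2 ^ t) (hdk : d ∣ k) :
    sieveWeight y z k d = (if (d : ℝ) ≤ y then smoothMoebius z d else 0) +
      if y < (d : ℝ) ∧ (d : ℝ) ≤ y * z then leftWeight y z d *
        triangleKernel (t + 2) d.minFac (truncMinFac (2 ^ t) (k / d) + 1) else 0 := by
  have htr : truncMinFac (2 ^ t) (k / d) + 1 < 2 ^ (t + 2) := by
    have h1 : truncMinFac (2 ^ t) (k / d) ≤ 2 ^ t := by
      unfold truncMinFac; split_ifs <;> simp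
    have h2 : 0 < 2 ^ t := by positivity
    rw [pow_add]
    omega
  simp only [triangleKernel, htr, and_true]
  by_cases hdy : (d : ℝ) ≤ y
  · simp [sieveWeight, hdy, not_lt.mpr hdy]
  · have hdy' : y < d := not_le.mp hdy
    have hd1 : d ≠ 1 := by rintro rfl; simp at hdy; linarith
    simp only [sieveWeight, leftWeight, hdy, if_false, zero_add, false_or, hdy', true_and]
    by_cases hs : smoothMoebius z d = 0
    · simp [hs]
    have hlt : (d.minFac : ℝ) < z := by
      by_contra hcon
      refine hs ?_
      unfold smoothMoebius
      exact if_neg fun h => hcon (h _ (Nat.minFac_prime hd1) (Nat.minFac_dvd d))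
    have hltN : d.minFac < 2 ^ t := by exact_mod_cast hlt.trans_le hzt
    simp only [minFac_lt_truncMinFac_add_one_iff hd1 hltN, Nat.mul_div_cancel' hdk]
    by_cases hq : ((d / d.minFac : ℕ) : ℝ) ≤ y
    · have hdz : (d : ℝ) ≤ y * z := by
        have : (d : ℝ) = ((d / d.minFac : ℕ) : ℝ) * d.minFac := by
          exact_mod_cast (Nat.div_mul_cancel (Nat.minFac_dvd d)).symm
        rw [this]
        exact mul_le_mul hq hlt.le (by positivity) (by linarith)
      simp [hq, hdz]
    · simp [hq]

end PointwiseIdentity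

section SieveDecomposition

private noncomputable def bilinearFunctional (A : Finset ℕ) (P : ℕ → Prop) (w : ℕ → ℂ)
    (f g : ℕ → ℕ) : (ℕ → ℕ → ℂ) →ₗ[ℂ] ℂ where
  toFun κ := ∑ k ∈ A, ∑ m ∈ k.divisors.filter P, w m * κ (f m) (g (k / m))
  map_add' κ κ' := by simp [mul_add, Finset.sum_add_distrib]
  map_smul' c κ := by simp [Finset.mul_sum, mul_left_comm]

private theorem bilinearFunctional_mul {A : Finset ℕ} (P : ℕ → Prop) (w : ℕ → ℂ)
    (f g : ℕ → ℕ) (u v : ℕ → ℂ) :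
    bilinearFunctional A P w f g (fun i j => u i * v j)
      = typeIISum A P (fun m => if m = 0 then 0 else w m * u (f m))
          (fun n => if n = 0 then 0 else v (g n)) := by
  unfold typeIISum bilinearFunctional
  simp only [LinearMap.coe_mk, AddHom.coe_mk]
  refine Finset.sum_congr rfl fun k _ => Finset.sum_congr rfl fun m hm => ?_
  have hm' := (Finset.mem_filter.mp hm).1
  have h0 : m ≠ 0 := (Nat.pos_of_mem_divisors hm').ne'
  have h1 : k / m ≠ 0 := (Nat.div_pos (Nat.divisor_le hm') (Nat.pos_of_ne_zero h0)).ne'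
  simp only [h0, h1, if_false, mul_assoc]

private theorem sieveCount_eq {A : Finset ℕ} (hA : ∀ n ∈ A, 0 < n) {y z M : ℝ} (hy : 1 ≤ y)
    (hyM : y ≤ M) {t : ℕ} (hzt : z ≤ 2 ^ t) :
    (sieveCount A z : ℂ)
      = typeISum A (fun m => (m : ℝ) ≤ M) (fun m => if (m : ℝ) ≤ y then smoothMoebius z m else 0)
        + bilinearFunctional A (fun m => y < (m : ℝ) ∧ (m : ℝ) ≤ y * z) (leftWeight y z)
            Nat.minFac (fun n => truncMinFac (2 ^ t) n + 1)
            (triangleKernel (t + 2)) := by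
  unfold sieveCount typeISum bilinearFunctional
  simp only [LinearMap.coe_mk, AddHom.coe_mk]
  rw [Finset.card_filter, Nat.cast_sum, ← Finset.sum_add_distrib]
  refine Finset.sum_congr rfl fun k hk => ?_
  have := sum_sieveWeight (z := z) hy (hA k hk)
  push_cast
  rw [← this, Finset.sum_filter, Finset.sum_filter, ← Finset.sum_add_distrib]
  refine Finset.sum_congr rfl fun d hd => ?_
  rw [sieveWeight_eq hy hzt (Nat.dvd_of_mem_divisors hd)]
  congr 1
  · by_cases hdy : (d : ℝ) ≤ y
    · simp [hdy, hdy.trans hyM]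
    · simp [hdy]
  · congr

end SieveDecomposition

/-- **Harman's asymptotic sieve.** With an absolute implied constant: if for all
divisor-bounded sequences `(a_m)`, `(b_n)` both the type I and the type II
information hold with error `X`, then `|S(A, x^β) - λ S(B, x^β)| = O(X (log x)^3)`. -/
theorem harman_asymptotic_sieve :
    ∃ K : ℝ, 0 < K ∧
      ∀ x : ℝ, 2 ≤ x → ∀ A B : Finset ℕ, (∀ n ∈ A, 0 < n) → (∀ n ∈ B, 0 < n) →
      ∀ lam α β M X : ℝ, 0 < lam → 0 < α → α < 1 → 0 < β → β ≤ 1 / 2 →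
        x ^ α < M → 1 ≤ X →
      (∀ a b : ℕ → ℂ, (∀ m, ‖a m‖ ≤ (m.divisors.card : ℝ)) →
          (∀ n, ‖b n‖ ≤ (n.divisors.card : ℝ)) →
        ‖typeISum A (fun m => (m : ℝ) ≤ M) a
            - lam * typeISum B (fun m => (m : ℝ) ≤ M) a‖ ≤ X ∧
        ‖typeIISum A (fun m => x ^ α < (m : ℝ) ∧ (m : ℝ) ≤ x ^ (α + β)) a b
            - lam * typeIISum B (fun m => x ^ α < (m : ℝ) ∧ (m : ℝ) ≤ x ^ (α + β)) a b‖ ≤ X) →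
      |(sieveCount A (x ^ β) : ℝ) - lam * (sieveCount B (x ^ β) : ℝ)|
        ≤ K * X * Real.log x ^ 3 := by
  refine ⟨5 / Real.log 2 ^ 3, by positivity, ?_⟩
  intro x hx A B hA hB lam α β M X _ hα _ _ hβ hM hX h
  have hx0 : 0 < x := by linarith
  have hy : 1 ≤ x ^ α := Real.one_le_rpow (by linarith) hα.le
  set t := Nat.log 2 ⌊x⌋₊ + 1 with ht
  have hxt : x ≤ 2 ^ t := by
    have h1 : ⌊x⌋₊ < 2 ^ t := Nat.lt_pow_succ_log_self one_lt_two _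
    exact_mod_cast ((Nat.floor_lt hx0.le).mp h1).le
  have hzt : x ^ β ≤ 2 ^ t := by
    refine le_trans ?_ hxt
    simpa using Real.rpow_le_rpow_of_exponent_le (by linarith : 1 ≤ x) (by linarith : β ≤ 1)
  have hlog2 : 0 < Real.log 2 := Real.log_pos one_lt_two
  set l := Real.log x / Real.log 2 with hl
  have hl1 : 1 ≤ l := by
    rw [hl, one_le_div hlog2]
    exact Real.log_le_log two_pos hx
  have htl : (t : ℝ) ≤ l + 1 := by
    have hfl : ⌊x⌋₊ ≠ 0 := (Nat.floor_pos.mpr (by linarith)).ne'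
    have h1 : ((2 ^ Nat.log 2 ⌊x⌋₊ : ℕ) : ℝ) ≤ x :=
      (Nat.cast_le.mpr (Nat.pow_log_le_self 2 hfl)).trans (Nat.floor_le hx0.le)
    have h2 := Real.log_le_log (by positivity) h1
    push_cast at h2
    rw [Real.log_pow] at h2
    have h3 : (Nat.log 2 ⌊x⌋₊ : ℝ) ≤ l := by rwa [hl, le_div_iff₀ hlog2]
    rw [ht]
    push_cast
    linarith
  have hcard : ∀ m : ℕ, m ≠ 0 → (1 : ℝ) ≤ m.divisors.card := fun m hm => by
    exact_mod_cast Finset.card_pos.mpr (Nat.nonempty_divisors.mpr hm)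
  rw [Real.rpow_add hx0] at h
  let L : Finset ℕ → (ℕ → ℕ → ℂ) →ₗ[ℂ] ℂ := fun C =>
    bilinearFunctional C (fun m => x ^ α < (m : ℝ) ∧ (m : ℝ) ≤ x ^ α * x ^ β)
      (leftWeight (x ^ α) (x ^ β)) Nat.minFac (fun n => truncMinFac (2 ^ t) n + 1)
  have hII := map_triangle_norm_le (X := X) (t + 2) (L A - (lam : ℂ) • L B) fun u v hu hv => by
    simp only [LinearMap.sub_apply, LinearMap.smul_apply, smul_eq_mul, L, bilinearFunctional_mul]
    refine (h _ _ (fun m => ?_) (fun n => ?_)).2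
    · split_ifs with hm
      · simp
      · refine le_trans ?_ (hcard m hm)
        rw [norm_mul]
        exact mul_le_one₀ (norm_leftWeight_le _ _ _) (norm_nonneg _) (hu _)
    · split_ifs with hn
      · simp
      · exact (hv _).trans (hcard n hn)
  have hI := (h (fun m => if (m : ℝ) ≤ x ^ α then smoothMoebius (x ^ β) m else 0) 0
    (fun m => by
      rcases eq_or_ne m 0 with rfl | hm
      · simp [smoothMoebius]
      · split_ifs
        · exact (norm_smoothMoebius_le _ _).trans (hcard m hm)
        · simp) (fun n => by simp)).1
  have hsum : ‖((sieveCount A (x ^ β) : ℂ)) - lam * (sieveCount B (x ^ β) : ℂ)‖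
      ≤ X + (t + 2 : ℕ) * X := by
    rw [sieveCount_eq hA hy hM.le hzt, sieveCount_eq hB hy hM.le hzt]
    refine le_trans (le_of_eq ?_) ((norm_add_le _ _).trans (add_le_add hI hII))
    simp only [LinearMap.sub_apply, LinearMap.smul_apply, smul_eq_mul, L]
    congr 1
    ring
  have hreal : ‖((sieveCount A (x ^ β) : ℂ)) - lam * (sieveCount B (x ^ β) : ℂ)‖
      = |(sieveCount A (x ^ β) : ℝ) - lam * (sieveCount B (x ^ β) : ℝ)| := by
    rw [← Real.norm_eq_abs, ← Complex.norm_real]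
    push_cast
    rfl
  rw [← hreal]
  refine hsum.trans ?_
  have hK : 5 / Real.log 2 ^ 3 * X * Real.log x ^ 3 = 5 * l ^ 3 * X := by
    rw [hl]; field_simp
  have hl3 : l ≤ l ^ 3 := le_self_pow₀ hl1 (by norm_num)
  rw [hK]
  push_cast
  nlinarith
end

section
/- (Large sieve.) Let Q and N be positive integers, M an integer, and (a_n) a sequence of complex numbers. Then Σ_{q ≤ Q} (q/φ(q)) · Σ*_{χ mod q} |Σ_{M < n ≤ M+N} a_n·χ(n)|² ≤ (Q² + N − 1) · Σ_{M < n ≤ M+N} |a_n|², where Σ*_{χ mod q} denotes the sum over primitive Dirichlet characters χ modulo q. -/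
open scoped Classical
open Finset

theorem Real.one_add_two_mul_cos_mul_sq_le {x : ℝ} (h0 : 0 ≤ x) (h1 : x ≤ 2) :
    (1 + 2 * Real.cos x) * x ^ 2 ≤ 3 * Real.sin x ^ 2 := by
  have hs := Real.sin_ge_sub_cube h0
  have hh := Real.sin_ge_sub_cube (x := x / 2) (by linarith)
  have hc : Real.cos x = 1 - 2 * Real.sin (x / 2) ^ 2 := by
    rw [← Real.cos_sq_add_sin_sq (x / 2)]
    have := Real.cos_two_mul' (x / 2)
    rw [mul_div_cancel₀ x two_ne_zero] at this
    linarith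
  have hsq : (x - x ^ 3 / 6) ^ 2 ≤ Real.sin x ^ 2 := by
    apply pow_le_pow_left₀ _ hs
    have : 0 ≤ x * (1 - x ^ 2 / 6) := mul_nonneg h0 (by nlinarith)
    linarith
  have hhq : (x / 2 - (x / 2) ^ 3 / 6) ^ 2 ≤ Real.sin (x / 2) ^ 2 := by
    apply pow_le_pow_left₀ _ hh
    have : 0 ≤ x * (1 / 2 - x ^ 2 / 48) := mul_nonneg h0 (by nlinarith)
    linarith
  have hc' : Real.cos x ≤ 1 - x ^ 2 / 2 + x ^ 4 / 24 := by
    have : 0 ≤ x ^ 6 := by positivity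
    nlinarith
  calc (1 + 2 * Real.cos x) * x ^ 2 ≤ (1 + 2 * (1 - x ^ 2 / 2 + x ^ 4 / 24)) * x ^ 2 := by gcongr
    _ = 3 * (x - x ^ 3 / 6) ^ 2 := by ring
    _ ≤ _ := by linarith

theorem one_add_two_mul_abs_cos_div_sin_sq_le {y : ℝ} (hy0 : y ≠ 0) (hy : |y| ≤ 1 / 2) :
    (1 + 2 * |Real.cos (Real.pi * y)|) / Real.sin (Real.pi * y) ^ 2
      ≤ 3 / Real.pi ^ 2 * (1 / y ^ 2) := by
  have hpi := Real.pi_pos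
  have hpi4 := Real.pi_le_four
  have hpos : 0 < |y| := abs_pos.2 hy0
  have e1 : Real.cos (Real.pi * y) = Real.cos (Real.pi * |y|) := by
    rw [← Real.cos_abs, abs_mul, abs_of_pos hpi]
  have e2 : Real.sin (Real.pi * y) ^ 2 = Real.sin (Real.pi * |y|) ^ 2 := by
    rw [Real.sin_sq, Real.sin_sq, e1]
  have hcos : 0 ≤ Real.cos (Real.pi * |y|) :=
    Real.cos_nonneg_of_neg_pi_div_two_le_of_le (by nlinarith) (by nlinarith)
  have hsin : 0 < Real.sin (Real.pi * |y|) :=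
    Real.sin_pos_of_pos_of_lt_pi (by positivity) (by nlinarith)
  have key := Real.one_add_two_mul_cos_mul_sq_le (x := Real.pi * |y|) (by positivity)
    (by nlinarith)
  rw [e1, e2, abs_of_nonneg hcos, ← sq_abs y, div_le_iff₀ (by positivity)]
  rw [show 3 / Real.pi ^ 2 * (1 / |y| ^ 2) * Real.sin (Real.pi * |y|) ^ 2 =
    3 * Real.sin (Real.pi * |y|) ^ 2 / (Real.pi * |y|) ^ 2 by field_simp,
    le_div_iff₀ (by positivity)]
  exact key

theorem sum_one_div_sq_le_of_pos_of_separated {ι : Type*} (S : Finset ι) (y : ι → ℝ) {δ : ℝ}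
    (hδ : 0 < δ) (hy : ∀ s ∈ S, δ ≤ y s) (hsep : ∀ s ∈ S, ∀ t ∈ S, s ≠ t → δ ≤ |y s - y t|) :
    ∑ s ∈ S, 1 / y s ^ 2 ≤ Real.pi ^ 2 / 6 * (δ⁻¹) ^ 2 := by
  have hinj : Set.InjOn (fun s => ⌊y s / δ⌋₊) S := by
    intro s hs t ht h
    by_contra hne
    have h1 := hsep s hs t ht hne
    have hs0 : 0 ≤ y s / δ := div_nonneg (hδ.le.trans (hy s hs)) hδ.le
    have ht0 : 0 ≤ y t / δ := div_nonneg (hδ.le.trans (hy t ht)) hδ.le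
    have a1 := Nat.floor_le hs0
    have a2 := Nat.floor_le ht0
    have a3 := Nat.lt_floor_add_one (y s / δ)
    have a4 := Nat.lt_floor_add_one (y t / δ)
    simp only at h
    rw [h] at a1 a3
    have : |y s / δ - y t / δ| < 1 := by rw [abs_lt]; constructor <;> linarith
    rw [← sub_div, abs_div, abs_of_pos hδ, div_lt_one hδ] at this
    linarith
  calc ∑ s ∈ S, 1 / y s ^ 2 ≤ ∑ s ∈ S, 1 / ((⌊y s / δ⌋₊ : ℕ) : ℝ) ^ 2 * (δ⁻¹) ^ 2 := by
        apply Finset.sum_le_sum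
        intro s hs
        have hys := hy s hs
        have h1 : 1 ≤ ⌊y s / δ⌋₊ := Nat.le_floor (by rw [Nat.cast_one, le_div_iff₀ hδ]; linarith)
        have h1' : (1 : ℝ) ≤ (⌊y s / δ⌋₊ : ℝ) := by exact_mod_cast h1
        have h2 : (⌊y s / δ⌋₊ : ℝ) ≤ y s / δ := Nat.floor_le (div_nonneg (by linarith) hδ.le)
        rw [le_div_iff₀ hδ] at h2
        rw [inv_eq_one_div, div_pow, one_pow, div_mul_div_comm, one_mul, ← mul_pow]
        gcongr
    _ = (∑ k ∈ S.image (fun s => ⌊y s / δ⌋₊), 1 / (k : ℝ) ^ 2) * (δ⁻¹) ^ 2 := by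
        rw [Finset.sum_image hinj, Finset.sum_mul]
    _ ≤ _ := by
        gcongr
        rw [← hasSum_zeta_two.tsum_eq]
        exact hasSum_zeta_two.summable.sum_le_tsum _ (fun _ _ => by positivity)

theorem sum_one_div_sq_le_of_separated {ι : Type*} (S : Finset ι) (y : ι → ℝ) {δ : ℝ}
    (hδ : 0 < δ) (hy : ∀ s ∈ S, δ ≤ |y s|) (hsep : ∀ s ∈ S, ∀ t ∈ S, s ≠ t → δ ≤ |y s - y t|) :
    ∑ s ∈ S, 1 / y s ^ 2 ≤ Real.pi ^ 2 / 3 * (δ⁻¹) ^ 2 := by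
  rw [← Finset.sum_filter_add_sum_filter_not S (fun s => 0 ≤ y s)]
  have h1 := sum_one_div_sq_le_of_pos_of_separated (S.filter (fun s => 0 ≤ y s)) y hδ
    (by
      intro s hs
      rw [Finset.mem_filter] at hs
      rw [← abs_of_nonneg hs.2]
      exact hy s hs.1)
    (fun s hs t ht => hsep s (Finset.mem_filter.1 hs).1 t (Finset.mem_filter.1 ht).1)
  have h2 := sum_one_div_sq_le_of_pos_of_separated (S.filter (fun s => ¬ 0 ≤ y s))
    (fun s => - y s) hδ
    (by
      intro s hs
      rw [Finset.mem_filter, not_le] at hs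
      rw [← abs_of_neg hs.2]
      exact hy s hs.1)
    (by
      intro s hs t ht hne
      rw [neg_sub_neg, abs_sub_comm]
      exact hsep s (Finset.mem_filter.1 hs).1 t (Finset.mem_filter.1 ht).1 hne)
  simp only [neg_sq] at h2
  linarith

theorem sum_csc_sq_add_two_mul_abs_csc_mul_cot_le {ι : Type*} [Fintype ι] (x : ι → ℝ) {δ : ℝ}
    (hδ : 0 < δ) (hx : ∀ r s, r ≠ s → ∀ m : ℤ, δ ≤ |x r - x s - m|) (r : ι) :
    ∑ s, (1 + 2 * |Real.cos (Real.pi * (x r - x s))|) / Real.sin (Real.pi * (x r - x s)) ^ 2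
      ≤ (δ⁻¹) ^ 2 := by
  rw [← Finset.sum_erase (Finset.univ) (a := r) (by simp)]
  set y : ι → ℝ := fun s => x r - x s - round (x r - x s) with hydef
  have hy : ∀ s ∈ Finset.univ.erase r, δ ≤ |y s| := fun s hs =>
    hx r s (Finset.ne_of_mem_erase hs).symm _
  have hsep : ∀ s ∈ Finset.univ.erase r, ∀ t ∈ Finset.univ.erase r, s ≠ t → δ ≤ |y s - y t| := by
    intro s _ t _ hne
    have := hx t s hne.symm (round (x r - x s) - round (x r - x t))
    convert this using 2
    simp only [hydef]
    push_cast
    ring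
  have h := sum_one_div_sq_le_of_separated _ y hδ hy hsep
  have hterm : ∀ s ∈ Finset.univ.erase r,
      (1 + 2 * |Real.cos (Real.pi * (x r - x s))|) / Real.sin (Real.pi * (x r - x s)) ^ 2
        ≤ 3 / Real.pi ^ 2 * (1 / y s ^ 2) := by
    intro s hs
    have hne : y s ≠ 0 := abs_pos.1 (hδ.trans_le (hy s hs))
    have := one_add_two_mul_abs_cos_div_sin_sq_le hne (abs_sub_round _)
    have hcos : |Real.cos (Real.pi * (x r - x s))| = |Real.cos (Real.pi * y s)| := by
      rw [hydef, mul_sub _ _ (round _ : ℝ), mul_comm Real.pi (round _ : ℝ),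
        Real.cos_sub_int_mul_pi, abs_mul, abs_zpow]
      simp
    have hsin : Real.sin (Real.pi * (x r - x s)) ^ 2 = Real.sin (Real.pi * y s) ^ 2 := by
      rw [Real.sin_sq, Real.sin_sq, ← sq_abs, hcos, sq_abs]
    rw [hcos, hsin]
    exact this
  refine (Finset.sum_le_sum hterm).trans ?_
  rw [← Finset.mul_sum]
  calc _ ≤ 3 / Real.pi ^ 2 * (Real.pi ^ 2 / 3 * (δ⁻¹) ^ 2) := by gcongr
    _ = _ := by field_simp

open ComplexConjugate in
theorem Matrix.IsHermitian.norm_inner_mulVec_le {ι : Type*} [Fintype ι] {A : Matrix ι ι ℂ}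
    (hA : A.IsHermitian) {C : ℝ}
    (h : ∀ (v : ι → ℂ) (μ : ℝ), v ≠ 0 → A.mulVec v = (μ : ℂ) • v → |μ| ≤ C) (u : ι → ℂ) :
    ‖∑ r, conj (u r) * A.mulVec u r‖ ≤ C * ∑ r, ‖u r‖ ^ 2 := by
  set b := hA.eigenvectorBasis
  set U : EuclideanSpace ℂ ι := WithLp.toLp 2 u
  have hb : ∀ i, |hA.eigenvalues i| ≤ C := fun i => by
    refine h (b i).ofLp _ ?_ ?_
    · intro h0
      apply b.toBasis.ne_zero i
      ext j
      simpa using congrFun h0 j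
    · rw [hA.mulVec_eigenvectorBasis i]
      rfl
  have hin : ∀ i, inner ℂ (b i) (WithLp.toLp 2 (A.mulVec u) : EuclideanSpace ℂ ι) =
      hA.eigenvalues i * inner ℂ (b i) U := by
    intro i
    have hm := hA.mulVec_eigenvectorBasis i
    simp only [U, EuclideanSpace.inner_eq_star_dotProduct]
    have hv : Matrix.vecMul (star (b i).ofLp) A = star (A.mulVec (b i).ofLp) := by
      rw [Matrix.star_mulVec, hA.eq]
    rw [dotProduct_comm, Matrix.dotProduct_mulVec, hv, hm, dotProduct_comm u]
    simp only [RCLike.real_smul_eq_coe_smul (K := ℂ), star_smul, smul_dotProduct, smul_eq_mul]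
    simp [b]
  have hsum : ∑ r, conj (u r) * A.mulVec u r =
      ∑ i, inner ℂ U (b i) * inner ℂ (b i) (WithLp.toLp 2 (A.mulVec u) : EuclideanSpace ℂ ι) := by
    rw [b.sum_inner_mul_inner]
    simp [U, PiLp.inner_apply, mul_comm]
  have hnorm : ∑ r, ‖u r‖ ^ 2 = ∑ i, ‖inner ℂ (b i) U‖ ^ 2 := by
    rw [b.sum_sq_norm_inner_right, EuclideanSpace.norm_sq_eq]
  rw [hsum, hnorm, Finset.mul_sum]
  refine (norm_sum_le _ _).trans (Finset.sum_le_sum fun i _ => ?_)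
  rw [hin, norm_mul, norm_mul, norm_inner_symm, Complex.norm_real, Real.norm_eq_abs]
  nlinarith [mul_le_mul_of_nonneg_right (hb i) (sq_nonneg ‖inner ℂ (b i) U‖)]

theorem csc_mul_csc_eq {a b : ℝ} (ha : Real.sin a ≠ 0) (hb : Real.sin b ≠ 0)
    (hab : Real.sin (a - b) ≠ 0) :
    (Real.sin a)⁻¹ * (Real.sin b)⁻¹ =
      (Real.sin (a - b))⁻¹ * (Real.cos b / Real.sin b - Real.cos a / Real.sin a) := by
  field_simp
  rw [Real.sin_sub]
  ring

theorem sum_csc_mul_csc {ι : Type*} [Fintype ι] (x : ι → ℝ)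
    (hx : ∀ r s, r ≠ s → Real.sin (Real.pi * (x r - x s)) ≠ 0) (r t : ι) :
    ∑ s, (Real.sin (Real.pi * (x r - x s)))⁻¹ * (Real.sin (Real.pi * (x t - x s)))⁻¹ =
      (if r = t then ∑ s, (Real.sin (Real.pi * (x r - x s)) ^ 2)⁻¹ else 0) +
      (Real.sin (Real.pi * (x r - x t)))⁻¹ *
        (∑ s, Real.cos (Real.pi * (x t - x s)) / Real.sin (Real.pi * (x t - x s)) -
          ∑ s, Real.cos (Real.pi * (x r - x s)) / Real.sin (Real.pi * (x r - x s))) +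
      2 * (Real.cos (Real.pi * (x r - x t)) / Real.sin (Real.pi * (x r - x t)) ^ 2) := by
  by_cases hrt : r = t
  · subst hrt
    simp [sq]
  · rw [if_neg hrt, zero_add, ← Finset.sum_sub_distrib, Finset.mul_sum, ← sub_eq_iff_eq_add',
      ← Finset.sum_sub_distrib, Finset.sum_eq_add r t hrt]
    · have h1 : Real.pi * (x t - x r) = -(Real.pi * (x r - x t)) := by ring
      simp only [sub_self, mul_zero, Real.sin_zero, inv_zero, zero_mul, div_zero, zero_sub,
        sub_zero, h1, Real.sin_neg, Real.cos_neg]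
      field_simp
      ring
    · rintro s - ⟨hsr, hst⟩
      have := csc_mul_csc_eq (hx r s hsr.symm) (hx t s hst.symm)
        (by rw [← mul_sub, sub_sub_sub_cancel_right]; exact hx r t hrt)
      rw [this, ← mul_sub, sub_sub_sub_cancel_right, sub_self]
    · simp
    · simp

theorem sin_pi_mul_ne_zero_of_le_abs_sub {t δ : ℝ} (hδ : 0 < δ) (ht : ∀ m : ℤ, δ ≤ |t - m|) :
    Real.sin (Real.pi * t) ≠ 0 := by
  intro h0
  obtain ⟨m, hm⟩ := Real.sin_eq_zero_iff.1 h0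
  have htm : t - m = 0 := by
    apply mul_left_cancel₀ Real.pi_pos.ne'
    linarith
  have := ht m
  rw [htm, abs_zero] at this
  linarith

open ComplexConjugate in
theorem sq_eigenvalue_csc_le {ι : Type*} [Fintype ι] (x : ι → ℝ) {δ : ℝ}
    (hδ : 0 < δ) (hx : ∀ r s, r ≠ s → ∀ m : ℤ, δ ≤ |x r - x s - m|)
    (u : ι → ℂ) (hu : u ≠ 0) (μ : ℝ)
    (hμ : ∀ r, ∑ s, (((Real.sin (Real.pi * (x r - x s)))⁻¹ : ℝ) : ℂ) * u s =
      Complex.I * μ * u r) : μ ^ 2 ≤ (δ⁻¹) ^ 2 := by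
  set c : ι → ι → ℝ := fun r s => (Real.sin (Real.pi * (x r - x s)))⁻¹ with hc
  set A : ι → ℝ := fun r => ∑ s, Real.cos (Real.pi * (x r - x s)) / Real.sin (Real.pi * (x r - x s))
    with hA
  set k : ι → ι → ℝ := fun r t =>
    Real.cos (Real.pi * (x r - x t)) / Real.sin (Real.pi * (x r - x t)) ^ 2 with hk
  set d : ι → ℝ := fun r => ∑ s, (Real.sin (Real.pi * (x r - x s)) ^ 2)⁻¹ with hd
  have hsin : ∀ r s, r ≠ s → Real.sin (Real.pi * (x r - x s)) ≠ 0 := fun r s hrs =>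
    sin_pi_mul_ne_zero_of_le_abs_sub hδ (hx r s hrs)
  have hanti : ∀ r s, c r s = - c s r := by
    intro r s
    simp only [hc]
    rw [← neg_sub, mul_neg, Real.sin_neg, inv_neg]
  have hksymm : ∀ r s, k r s = k s r := by
    intro r s
    simp only [hk]
    rw [← neg_sub, mul_neg, Real.sin_neg, Real.cos_neg, neg_sq]
  have hμ' : ∀ r, ∑ s, (c r s : ℂ) * u s = Complex.I * μ * u r := hμ
  have hμconj : ∀ r, ∑ s, (c r s : ℂ) * conj (u s) = - (Complex.I * μ * conj (u r)) := by
    intro r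
    have := congrArg conj (hμ' r)
    simpa [map_sum] using this
  have hcc : ∀ r t, ∑ s, c r s * c t s = (if r = t then d r else 0) + c r t * (A t - A r)
      + 2 * k r t := fun r t => sum_csc_mul_csc x hsin r t
  have hccC : ∀ r t, ∑ s, (c r s : ℂ) * c t s = (if r = t then (d r : ℂ) else 0)
      + c r t * (A t - A r) + 2 * k r t := by
    intro r t
    have := congrArg (fun z : ℝ => (z : ℂ)) (hcc r t)
    push_cast at this
    split_ifs at this ⊢ <;> simpa using this
  have hid : (μ ^ 2 * ∑ s, ‖u s‖ ^ 2 : ℝ) =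
      ((∑ r, d r * ‖u r‖ ^ 2 : ℝ) : ℂ) + 2 * ∑ r, ∑ t, k r t * (u r * conj (u t)) := by
    have e1 : ((μ ^ 2 * ∑ s, ‖u s‖ ^ 2 : ℝ) : ℂ) =
        ∑ s, (∑ r, (c s r : ℂ) * u r) * (∑ t, (c s t : ℂ) * conj (u t)) := by
      push_cast
      rw [Finset.mul_sum]
      refine Finset.sum_congr rfl fun s _ => ?_
      rw [hμ', hμconj, ← Complex.mul_conj']
      linear_combination (μ ^ 2 * (u s * conj (u s))) * Complex.I_sq
    have e2 : ∑ s, (∑ r, (c s r : ℂ) * u r) * (∑ t, (c s t : ℂ) * conj (u t)) =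
        ∑ r, ∑ t, u r * conj (u t) * ∑ s, (c r s : ℂ) * c t s := by
      simp_rw [Finset.sum_mul_sum, Finset.mul_sum]
      rw [Finset.sum_comm]
      refine Finset.sum_congr rfl fun r _ => ?_
      rw [Finset.sum_comm]
      refine Finset.sum_congr rfl fun t _ => Finset.sum_congr rfl fun s _ => ?_
      rw [hanti s r, hanti s t]
      push_cast
      ring
    have e3 : ∑ r, ∑ t, u r * conj (u t) * (c r t * A t : ℂ) =
        ∑ t, - (Complex.I * μ) * A t * (u t * conj (u t)) := by
      rw [Finset.sum_comm]
      refine Finset.sum_congr rfl fun t _ => ?_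
      have : ∑ r, u r * conj (u t) * (c r t * A t : ℂ) =
          - (A t * conj (u t)) * ∑ r, (c t r : ℂ) * u r := by
        rw [Finset.mul_sum]
        refine Finset.sum_congr rfl fun r _ => ?_
        rw [hanti r t]
        push_cast
        ring
      rw [this, hμ']
      ring
    have e4 : ∑ r, ∑ t, u r * conj (u t) * (c r t * A r : ℂ) =
        ∑ r, - (Complex.I * μ) * A r * (u r * conj (u r)) := by
      refine Finset.sum_congr rfl fun r _ => ?_
      have : ∑ t, u r * conj (u t) * (c r t * A r : ℂ) =
          (A r * u r) * ∑ t, (c r t : ℂ) * conj (u t) := by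
        rw [Finset.mul_sum]
        refine Finset.sum_congr rfl fun t _ => ?_
        ring
      rw [this, hμconj]
      ring
    have e5 : ∑ r, ∑ t, u r * conj (u t) * (if r = t then (d r : ℂ) else 0) =
        ((∑ r, d r * ‖u r‖ ^ 2 : ℝ) : ℂ) := by
      push_cast
      refine Finset.sum_congr rfl fun r _ => ?_
      simp only [mul_ite, mul_zero, Finset.sum_ite_eq, Finset.mem_univ, if_true]
      rw [← Complex.mul_conj']
      ring
    rw [e1, e2, ← e5, Finset.mul_sum, ← Finset.sum_add_distrib]
    have : ∑ r, ∑ t, u r * conj (u t) * ((c r t : ℂ) * (A t - A r)) = 0 := by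
      simp_rw [mul_sub, Finset.sum_sub_distrib]
      rw [e3, e4, sub_self]
    refine Eq.trans ?_ ((congrArg (HAdd.hAdd _) this).trans (add_zero _))
    rw [← Finset.sum_add_distrib]
    refine Finset.sum_congr rfl fun r _ => ?_
    rw [Finset.mul_sum, ← Finset.sum_add_distrib, ← Finset.sum_add_distrib]
    refine Finset.sum_congr rfl fun t _ => ?_
    rw [hccC]
    ring
  have hnn : 0 ≤ μ ^ 2 * ∑ s, ‖u s‖ ^ 2 := by positivity
  have hdnn : 0 ≤ ∑ r, d r * ‖u r‖ ^ 2 :=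
    Finset.sum_nonneg fun r _ => mul_nonneg (Finset.sum_nonneg fun s _ => by positivity)
      (by positivity)
  have hcross : ‖∑ r, ∑ t, (k r t : ℂ) * (u r * conj (u t))‖ ≤ ∑ r, (∑ t, |k r t|) * ‖u r‖ ^ 2 := by
    calc _ ≤ ∑ r, ∑ t, |k r t| * ((‖u r‖ ^ 2 + ‖u t‖ ^ 2) / 2) := by
          refine (norm_sum_le _ _).trans (Finset.sum_le_sum fun r _ =>
            (norm_sum_le _ _).trans (Finset.sum_le_sum fun t _ => ?_))
          rw [norm_mul, norm_mul, Complex.norm_real, Real.norm_eq_abs, Complex.norm_conj]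
          gcongr
          nlinarith [sq_nonneg (‖u r‖ - ‖u t‖)]
      _ = (∑ r, ∑ t, |k r t| * ‖u r‖ ^ 2 + ∑ r, ∑ t, |k r t| * ‖u t‖ ^ 2) / 2 := by
          simp_rw [← Finset.sum_add_distrib, Finset.sum_div]
          refine Finset.sum_congr rfl fun r _ => Finset.sum_congr rfl fun t _ => ?_
          ring
      _ = ∑ r, ∑ t, |k r t| * ‖u r‖ ^ 2 := by
          rw [Finset.sum_comm (f := fun r t => |k r t| * ‖u t‖ ^ 2)]
          simp_rw [fun r t => hksymm t r]
          ring
      _ = _ := by simp_rw [Finset.sum_mul]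
  have hle : μ ^ 2 * ∑ s, ‖u s‖ ^ 2 ≤ (δ⁻¹) ^ 2 * ∑ s, ‖u s‖ ^ 2 := by
    have hn := congrArg (fun z : ℂ => ‖z‖) hid
    simp only [Complex.norm_real, Real.norm_eq_abs, abs_of_nonneg hnn] at hn
    rw [hn]
    refine (norm_add_le _ _).trans ?_
    rw [Complex.norm_real, Real.norm_eq_abs, abs_of_nonneg hdnn, norm_mul, Complex.norm_two]
    refine (add_le_add_right (mul_le_mul_of_nonneg_left hcross zero_le_two) _).trans ?_
    rw [Finset.mul_sum, ← Finset.sum_add_distrib, Finset.mul_sum]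
    refine Finset.sum_le_sum fun r _ => ?_
    have := sum_csc_sq_add_two_mul_abs_csc_mul_cot_le x hδ hx r
    rw [← mul_assoc, ← add_mul]
    gcongr
    refine le_of_eq_of_le ?_ this
    simp only [hd, hk]
    rw [Finset.mul_sum, ← Finset.sum_add_distrib]
    refine Finset.sum_congr rfl fun s _ => ?_
    rw [abs_div, abs_of_nonneg (sq_nonneg (Real.sin _))]
    ring
  have hpos : 0 < ∑ s, ‖u s‖ ^ 2 := by
    obtain ⟨i, hi⟩ := Function.ne_iff.1 hu
    exact Finset.sum_pos' (fun _ _ => by positivity)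
      ⟨i, Finset.mem_univ i, by have := norm_pos_iff.2 hi; positivity⟩
  exact le_of_mul_le_mul_right hle hpos

open ComplexConjugate in
/-- The Montgomery–Vaughan form of Hilbert's inequality, for the kernel `1 / sin (π (x r - x s))`. -/
theorem norm_sum_csc_le {ι : Type*} [Fintype ι] (x : ι → ℝ) {δ : ℝ}
    (hδ : 0 < δ) (hx : ∀ r s, r ≠ s → ∀ m : ℤ, δ ≤ |x r - x s - m|) (u : ι → ℂ) :
    ‖∑ r, ∑ s, conj (u r) * u s * (((Real.sin (Real.pi * (x r - x s)))⁻¹ : ℝ) : ℂ)‖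
      ≤ δ⁻¹ * ∑ r, ‖u r‖ ^ 2 := by
  set A : Matrix ι ι ℂ := Matrix.of fun r s =>
    Complex.I * (((Real.sin (Real.pi * (x r - x s)))⁻¹ : ℝ) : ℂ) with hAdef
  have hA : A.IsHermitian := by
    ext r s
    simp only [hAdef, Matrix.conjTranspose_apply, Matrix.of_apply, RCLike.star_def, map_mul,
      Complex.conj_I, Complex.conj_ofReal]
    rw [← neg_sub (x r), mul_neg, Real.sin_neg, inv_neg]
    push_cast
    ring
  have hmul : ∀ v r, A.mulVec v r =
      Complex.I * ∑ s, (((Real.sin (Real.pi * (x r - x s)))⁻¹ : ℝ) : ℂ) * v s := by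
    intro v r
    simp only [hAdef, Matrix.mulVec, dotProduct, Matrix.of_apply, Finset.mul_sum, mul_assoc]
  have key := hA.norm_inner_mulVec_le (fun v μ hv h => by
    refine abs_le_of_sq_le_sq ?_ (inv_nonneg.2 hδ.le)
    rw [← neg_sq]
    refine sq_eigenvalue_csc_le x hδ hx v hv (-μ) fun r => ?_
    have := congrFun h r
    rw [hmul] at this
    simp only [Pi.smul_apply, smul_eq_mul] at this
    rw [Complex.ofReal_neg]
    linear_combination (-Complex.I) * this + (∑ s, (((Real.sin (Real.pi * (x r - x s)))⁻¹ : ℝ) : ℂ)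
      * v s) * Complex.I_sq) u
  refine le_of_eq_of_le ?_ key
  have : ∑ r, conj (u r) * A.mulVec u r = Complex.I *
      ∑ r, ∑ s, conj (u r) * u s * (((Real.sin (Real.pi * (x r - x s)))⁻¹ : ℝ) : ℂ) := by
    rw [Finset.mul_sum]
    refine Finset.sum_congr rfl fun r _ => ?_
    rw [hmul, Finset.mul_sum, Finset.mul_sum, Finset.mul_sum]
    refine Finset.sum_congr rfl fun s _ => ?_
    ring
  rw [this, norm_mul, Complex.norm_I, one_mul]

/-- The function `t ↦ exp (2 π i t)`. -/
noncomputable def expTwoPi (t : ℝ) : ℂ := Complex.exp (2 * Real.pi * Complex.I * t)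

theorem expTwoPi_add (s t : ℝ) : expTwoPi (s + t) = expTwoPi s * expTwoPi t := by
  simp only [expTwoPi]
  rw [← Complex.exp_add]
  push_cast
  ring_nf

theorem expTwoPi_zero : expTwoPi 0 = 1 := by simp [expTwoPi]

theorem norm_expTwoPi (t : ℝ) : ‖expTwoPi t‖ = 1 := by
  rw [expTwoPi, show (2 * Real.pi * Complex.I * t : ℂ) = ((2 * Real.pi * t : ℝ) : ℂ) * Complex.I by
    push_cast; ring, Complex.norm_exp_ofReal_mul_I]

open ComplexConjugate in
theorem conj_expTwoPi (t : ℝ) : conj (expTwoPi t) = expTwoPi (-t) := by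
  simp [expTwoPi, ← Complex.exp_conj, map_ofNat]

theorem two_I_mul_sin_pi_mul (t : ℝ) :
    2 * Complex.I * (Real.sin (Real.pi * t) : ℂ) = expTwoPi (t / 2) - expTwoPi (-t / 2) := by
  rw [Complex.ofReal_sin, Complex.sin, expTwoPi, expTwoPi]
  push_cast
  rw [show (2 * Real.pi * Complex.I * (t / 2) : ℂ) = Real.pi * t * Complex.I by ring,
    show (2 * Real.pi * Complex.I * (-t / 2) : ℂ) = -(Real.pi * t) * Complex.I by ring]
  linear_combination (Complex.exp (-(Real.pi * t) * Complex.I) -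
    Complex.exp (Real.pi * t * Complex.I)) * Complex.I_sq

theorem two_I_mul_sin_mul_sum_expTwoPi (t : ℝ) (M : ℤ) (N : ℕ) :
    2 * Complex.I * (Real.sin (Real.pi * t) : ℂ) * ∑ n ∈ Finset.Ioc M (M + N), expTwoPi (n * t) =
      expTwoPi ((M + N + 1 / 2) * t) - expTwoPi ((M + 1 / 2) * t) := by
  induction N with
  | zero => simp
  | succ N ih =>
    have hI : Finset.Ioc M (M + (N + 1 : ℕ)) = insert (M + N + 1) (Finset.Ioc M (M + N)) := by
      ext n
      simp only [Finset.mem_Ioc, Finset.mem_insert]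
      push_cast
      omega
    rw [hI, Finset.sum_insert (by simp), mul_add, ih, two_I_mul_sin_pi_mul, sub_mul,
      ← expTwoPi_add, ← expTwoPi_add]
    push_cast
    ring_nf

theorem sum_expTwoPi_eq {t : ℝ} (ht : Real.sin (Real.pi * t) ≠ 0) (M : ℤ) (N : ℕ) :
    ∑ n ∈ Finset.Ioc M (M + N), expTwoPi (n * t) =
      (2 * Complex.I)⁻¹ * (expTwoPi ((M + N + 1 / 2) * t) - expTwoPi ((M + 1 / 2) * t)) *
        (((Real.sin (Real.pi * t))⁻¹ : ℝ) : ℂ) := by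
  rw [← two_I_mul_sin_mul_sum_expTwoPi]
  have : (Real.sin (Real.pi * t) : ℂ) ≠ 0 := by exact_mod_cast ht
  have hI := Complex.I_ne_zero
  rw [Complex.ofReal_inv]
  generalize ∑ n ∈ Finset.Ioc M (M + N), expTwoPi (n * t) = S
  field_simp

open ComplexConjugate in
theorem dual_large_sieve_of_separated {ι : Type*} [Fintype ι] (x : ι → ℝ) {δ : ℝ}
    (hδ : 0 < δ) (hx : ∀ r s, r ≠ s → ∀ m : ℤ, δ ≤ |x r - x s - m|) (M : ℤ) (N : ℕ) (c : ι → ℂ) :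
    ∑ n ∈ Finset.Ioc M (M + N), ‖∑ r, c r * expTwoPi (n * x r)‖ ^ 2
      ≤ (N + δ⁻¹) * ∑ r, ‖c r‖ ^ 2 := by
  have hsin : ∀ r s, r ≠ s → Real.sin (Real.pi * (x r - x s)) ≠ 0 := fun r s hrs =>
    sin_pi_mul_ne_zero_of_le_abs_sub hδ (hx r s hrs)
  set H : ℝ → ℂ := fun K => ∑ r, ∑ s, c r * expTwoPi (K * x r) * conj (c s * expTwoPi (K * x s)) *
    (((Real.sin (Real.pi * (x r - x s)))⁻¹ : ℝ) : ℂ) with hH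
  have hHle : ∀ K, ‖H K‖ ≤ δ⁻¹ * ∑ r, ‖c r‖ ^ 2 := by
    intro K
    have := norm_sum_csc_le x hδ hx (fun r => conj (c r * expTwoPi (K * x r)))
    simpa only [Complex.conj_conj, Complex.norm_conj, norm_mul, norm_expTwoPi, mul_one] using this
  have hid : ((∑ n ∈ Finset.Ioc M (M + N), ‖∑ r, c r * expTwoPi (n * x r)‖ ^ 2 : ℝ) : ℂ) =
      ((N * ∑ r, ‖c r‖ ^ 2 : ℝ) : ℂ) +
        (2 * Complex.I)⁻¹ * (H (M + N + 1 / 2) - H (M + 1 / 2)) := by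
    have e1 : ((∑ n ∈ Finset.Ioc M (M + N), ‖∑ r, c r * expTwoPi (n * x r)‖ ^ 2 : ℝ) : ℂ) =
        ∑ r, ∑ s, c r * conj (c s) * ∑ n ∈ Finset.Ioc M (M + N), expTwoPi (n * (x r - x s)) := by
      push_cast
      simp_rw [← Complex.mul_conj', map_sum, Finset.sum_mul_sum, Finset.mul_sum]
      rw [Finset.sum_comm]
      refine Finset.sum_congr rfl fun r _ => ?_
      rw [Finset.sum_comm]
      refine Finset.sum_congr rfl fun s _ => Finset.sum_congr rfl fun n _ => ?_
      rw [map_mul, conj_expTwoPi, mul_sub, sub_eq_add_neg, expTwoPi_add]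
      ring
    have e2 : ((N * ∑ r, ‖c r‖ ^ 2 : ℝ) : ℂ) =
        ∑ r, ∑ s, if r = s then c r * conj (c s) * N else 0 := by
      push_cast
      rw [Finset.mul_sum]
      refine Finset.sum_congr rfl fun r _ => ?_
      simp only [Finset.sum_ite_eq, Finset.mem_univ, if_true]
      rw [← Complex.mul_conj', mul_comm]
    rw [e1, e2, hH]
    simp only
    rw [← Finset.sum_sub_distrib, Finset.mul_sum, ← Finset.sum_add_distrib]
    refine Finset.sum_congr rfl fun r _ => ?_
    rw [← Finset.sum_sub_distrib, Finset.mul_sum, ← Finset.sum_add_distrib]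
    refine Finset.sum_congr rfl fun s _ => ?_
    by_cases hrs : r = s
    · subst hrs
      simp [expTwoPi_zero]
    · rw [if_neg hrs, sum_expTwoPi_eq (hsin r s hrs)]
      simp only [map_mul, conj_expTwoPi, mul_sub, sub_eq_add_neg (_ * x r), expTwoPi_add]
      ring
  have hn := congrArg (fun z : ℂ => ‖z‖) hid
  simp only [Complex.norm_real, Real.norm_eq_abs] at hn
  rw [abs_of_nonneg (by positivity)] at hn
  rw [hn]
  refine (norm_add_le _ _).trans ?_
  rw [Complex.norm_real, Real.norm_eq_abs, abs_of_nonneg (by positivity), add_mul]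
  refine add_le_add_right ?_ _
  rw [norm_mul, norm_inv, norm_mul, Complex.norm_I, Complex.norm_two, mul_one]
  have := norm_sub_le (H (M + N + 1 / 2)) (H (M + 1 / 2))
  linarith [hHle (M + N + 1 / 2), hHle (M + 1 / 2)]

open ComplexConjugate in
/-- The analytic large sieve inequality for `δ`-separated points modulo `1`. -/
theorem large_sieve_of_separated {ι : Type*} [Fintype ι] (x : ι → ℝ) {δ : ℝ}
    (hδ : 0 < δ) (hx : ∀ r s, r ≠ s → ∀ m : ℤ, δ ≤ |x r - x s - m|) (M : ℤ) (N : ℕ) (a : ℤ → ℂ) :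
    ∑ r, ‖∑ n ∈ Finset.Ioc M (M + N), a n * expTwoPi (n * x r)‖ ^ 2
      ≤ (N + δ⁻¹) * ∑ n ∈ Finset.Ioc M (M + N), ‖a n‖ ^ 2 := by
  set S : ι → ℂ := fun r => ∑ n ∈ Finset.Ioc M (M + N), a n * expTwoPi (n * x r) with hS
  set w : ℤ → ℂ := fun n => ∑ r, conj (S r) * expTwoPi (n * x r) with hw
  set T : ℝ := ∑ r, ‖S r‖ ^ 2 with hT
  have hdual : ∑ n ∈ Finset.Ioc M (M + N), ‖w n‖ ^ 2 ≤ (N + δ⁻¹) * T := by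
    have := dual_large_sieve_of_separated x hδ hx M N (fun r => conj (S r))
    simpa only [Complex.norm_conj] using this
  have hTnn : 0 ≤ T := by positivity
  have hid : (T : ℂ) = ∑ n ∈ Finset.Ioc M (M + N), a n * w n := by
    simp only [hT, hw, Finset.mul_sum]
    push_cast
    rw [Finset.sum_comm]
    refine Finset.sum_congr rfl fun r _ => ?_
    rw [← Complex.conj_mul']
    conv_lhs => rw [hS]
    simp only [Finset.mul_sum]
    refine Finset.sum_congr rfl fun n _ => ?_
    ring
  have hle : T ≤ ∑ n ∈ Finset.Ioc M (M + N), ‖a n‖ * ‖w n‖ := by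
    have hn := congrArg (fun z : ℂ => ‖z‖) hid
    simp only [Complex.norm_real, Real.norm_eq_abs, abs_of_nonneg hTnn] at hn
    rw [hn]
    refine (norm_sum_le _ _).trans_eq ?_
    simp only [norm_mul]
  have hsq : T * T ≤ ((N + δ⁻¹) * ∑ n ∈ Finset.Ioc M (M + N), ‖a n‖ ^ 2) * T := by
    calc T * T = T ^ 2 := (sq T).symm
      _ ≤ (∑ n ∈ Finset.Ioc M (M + N), ‖a n‖ * ‖w n‖) ^ 2 := by gcongr
      _ ≤ _ := Finset.sum_mul_sq_le_sq_mul_sq _ _ _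
      _ ≤ (∑ n ∈ Finset.Ioc M (M + N), ‖a n‖ ^ 2) * ((N + δ⁻¹) * T) := by gcongr
      _ = _ := by ring
  rcases hTnn.eq_or_lt with h0 | hpos
  · rw [← h0]
    positivity
  · exact le_of_mul_le_mul_right hsq hpos

namespace DirichletCharacter

theorem IsPrimitive.natCast_mul_apply_eq {q : ℕ} [NeZero q] {χ : DirichletCharacter ℂ q}
    (hχ : χ.IsPrimitive) (n : ZMod q) :
    (q : ℂ) * χ n = gaussSum χ ZMod.stdAddChar * ∑ k, χ⁻¹ (-k) * ZMod.stdAddChar (k * n) := by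
  have h := congrFun (ZMod.dft_dft (χ : ZMod q → ℂ)) (-n)
  rw [neg_neg, smul_eq_mul, ZMod.dft_apply] at h
  rw [← h, Finset.mul_sum]
  refine Finset.sum_congr rfl fun k _ => ?_
  rw [hχ.fourierTransform_eq_inv_mul_gaussSum, mul_neg, neg_neg, smul_eq_mul]
  ring

open ComplexConjugate in
theorem IsPrimitive.norm_gaussSum_stdAddChar_sq {q : ℕ} [NeZero q] {χ : DirichletCharacter ℂ q}
    (hχ : χ.IsPrimitive) : ‖gaussSum χ ZMod.stdAddChar‖ ^ 2 = q := by
  have h := hχ.natCast_mul_apply_eq 1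
  have hstar : ∑ k, χ⁻¹ (-k) * ZMod.stdAddChar (k * 1) = conj (gaussSum χ ZMod.stdAddChar) := by
    rw [starRingEnd_apply, star_gaussSum_eq, gaussSum, ← Equiv.sum_comp (Equiv.neg _)]
    simp [AddChar.inv_apply]
  rw [hstar, map_one, mul_one, Complex.mul_conj'] at h
  exact_mod_cast h.symm

open ComplexConjugate in
theorem sum_norm_sum_apply_mul_sq {q : ℕ} [NeZero q] (f : ZMod q → ℂ) :
    ∑ χ : DirichletCharacter ℂ q, ‖∑ k, χ k * f k‖ ^ 2 =
      q.totient * ∑ k with IsUnit k, ‖f k‖ ^ 2 := by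
  have key : ((∑ χ : DirichletCharacter ℂ q, ‖∑ k, χ k * f k‖ ^ 2 : ℝ) : ℂ) =
      ((q.totient * ∑ k with IsUnit k, ‖f k‖ ^ 2 : ℝ) : ℂ) := by
    push_cast
    simp_rw [← Complex.conj_mul', map_sum, Finset.sum_mul_sum]
    rw [Finset.sum_comm, Finset.mul_sum, Finset.sum_filter]
    refine Finset.sum_congr rfl fun k _ => ?_
    rw [Finset.sum_comm]
    split_ifs with hk
    · have : ∀ l, ∑ χ : DirichletCharacter ℂ q, conj (χ k * f k) * (χ l * f l) =
          if k = l then (q.totient : ℂ) * (conj (f k) * f l) else 0 := by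
        intro l
        have horth := sum_char_inv_mul_char_eq ℂ hk l
        rw [← ite_zero_mul, ← horth, Finset.sum_mul]
        refine Finset.sum_congr rfl fun χ _ => ?_
        have : conj (χ k) = χ k⁻¹ := by
          rw [starRingEnd_apply, MulChar.star_apply', MulChar.inv_apply, ← hk.unit_spec, Ring.inverse_unit,
            ZMod.inv_coe_unit]
        rw [map_mul, this]
        ring
      simp_rw [this]
      simp
    · refine Finset.sum_eq_zero fun l _ => Finset.sum_eq_zero fun χ _ => ?_
      rw [MulChar.map_nonunit χ hk]
      simp
  exact_mod_cast key

theorem sum_isPrimitive_norm_sq_le {q : ℕ} [NeZero q] (s : Finset ℤ) (a : ℤ → ℂ) :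
    (q : ℝ) / q.totient * ∑ χ : DirichletCharacter ℂ q,
        (if χ.IsPrimitive then ‖∑ n ∈ s, a n * χ (n : ZMod q)‖ ^ 2 else 0) ≤
      ∑ k : ZMod q with IsUnit k, ‖∑ n ∈ s, a n * ZMod.stdAddChar (k * (n : ZMod q))‖ ^ 2 := by
  set f : ZMod q → ℂ := fun k => ∑ n ∈ s, a n * ZMod.stdAddChar (k * (n : ZMod q)) with hf
  have hq : (0 : ℝ) < q := by exact_mod_cast NeZero.pos q
  have hφ : (0 : ℝ) < q.totient := by exact_mod_cast Nat.totient_pos.2 (NeZero.pos q)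
  have hprim : ∀ χ : DirichletCharacter ℂ q, χ.IsPrimitive →
      q * ‖∑ n ∈ s, a n * χ (n : ZMod q)‖ ^ 2 = ‖∑ k, χ⁻¹ k * f k‖ ^ 2 := by
    intro χ hχ
    have h1 : (q : ℂ) * ∑ n ∈ s, a n * χ (n : ZMod q) =
        gaussSum χ ZMod.stdAddChar * (χ⁻¹ (-1) * ∑ k, χ⁻¹ k * f k) := by
      simp only [hf, Finset.mul_sum]
      rw [Finset.sum_comm]
      refine Finset.sum_congr rfl fun n _ => ?_
      rw [mul_left_comm, hχ.natCast_mul_apply_eq, Finset.mul_sum, Finset.mul_sum]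
      refine Finset.sum_congr rfl fun k _ => ?_
      rw [← neg_one_mul k, map_mul]
      ring
    have hone : ‖χ⁻¹ (-1)‖ = 1 := by
      simpa using χ⁻¹.unit_norm_eq_one (-1)
    have h2 := congrArg (fun z : ℂ => ‖z‖ ^ 2) h1
    simp only [norm_mul, mul_pow, hone, hχ.norm_gaussSum_stdAddChar_sq, one_mul,
      Complex.norm_natCast] at h2
    apply mul_left_cancel₀ hq.ne'
    rw [← h2]
    ring
  have hsum : ∑ χ : DirichletCharacter ℂ q,
      q * (if χ.IsPrimitive then ‖∑ n ∈ s, a n * χ (n : ZMod q)‖ ^ 2 else 0) ≤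
      q.totient * ∑ k with IsUnit k, ‖f k‖ ^ 2 := by
    rw [← sum_norm_sum_apply_mul_sq,
      ← Equiv.sum_comp (Equiv.inv (DirichletCharacter ℂ q)) fun χ => ‖∑ k, χ k * f k‖ ^ 2]
    refine Finset.sum_le_sum fun χ _ => ?_
    split_ifs with hχ
    · exact (hprim χ hχ).le
    · rw [mul_zero]
      positivity
  rw [← Finset.mul_sum] at hsum
  rw [div_mul_eq_mul_div, div_le_iff₀ hφ, mul_comm _ (q.totient : ℝ)]
  exact hsum

end DirichletCharacter

theorem sum_isUnit_eq_sum_coprime {q : ℕ} [NeZero q] (g : ZMod q → ℝ) :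
    ∑ k with IsUnit k, g k = ∑ k ∈ (Finset.range q).filter (Nat.Coprime q), g (k : ZMod q) := by
  refine Finset.sum_bij' (fun k _ => k.val) (fun k _ => (k : ZMod q)) ?_ ?_ ?_ ?_ ?_
  · intro k hk
    rw [Finset.mem_filter] at hk ⊢
    refine ⟨Finset.mem_range.2 (ZMod.val_lt k), ?_⟩
    have := hk.2
    rw [← ZMod.natCast_zmod_val k, ZMod.isUnit_iff_coprime] at this
    exact this.symm
  · intro k hk
    rw [Finset.mem_filter] at hk ⊢
    exact ⟨Finset.mem_univ _, (ZMod.isUnit_iff_coprime k q).2 hk.2.symm⟩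
  · intro k _
    exact ZMod.natCast_zmod_val k
  · intro k hk
    exact ZMod.val_cast_of_lt (Finset.mem_range.1 (Finset.mem_filter.1 hk).1)
  · intro k _
    rw [ZMod.natCast_zmod_val]

theorem stdAddChar_natCast_mul_intCast {q : ℕ} [NeZero q] (k : ℕ) (n : ℤ) :
    ZMod.stdAddChar ((k : ZMod q) * (n : ZMod q)) = expTwoPi (n * (k / q)) := by
  have := ZMod.stdAddChar_coe (N := q) (k * n)
  push_cast at this
  rw [this, expTwoPi]
  push_cast
  ring_nf

theorem farey_separated {Q q r a b : ℕ} (hQ : 2 ≤ Q) (hq : q ≤ Q) (hr : r ≤ Q) (ha : a < q)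
    (hb : b < r) (hqa : Nat.Coprime q a) (hrb : Nat.Coprime r b) (hne : ¬ (q = r ∧ a = b)) (m : ℤ) :
    ((Q * (Q - 1) : ℝ))⁻¹ ≤ |(a / q - b / r - m : ℝ)| := by
  have hq0 : (0 : ℝ) < q := by exact_mod_cast (by omega : 0 < q)
  have hr0 : (0 : ℝ) < r := by exact_mod_cast (by omega : 0 < r)
  have hQ2 : (2 : ℝ) ≤ Q := by exact_mod_cast hQ
  have hqQ : (q : ℝ) ≤ Q := by exact_mod_cast hq
  by_cases hqr : q = r
  · subst hqr
    have hk : (a - b - m * q : ℤ) ≠ 0 := by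
      intro h
      apply hne
      refine ⟨rfl, ?_⟩
      have hd : (q : ℤ) ∣ a - b := ⟨m, by linarith⟩
      have := Int.eq_zero_of_abs_lt_dvd hd (by rw [abs_lt]; omega)
      omega
    have hk1 : (1 : ℝ) ≤ |(a - b - m * q : ℝ)| := by exact_mod_cast Int.one_le_abs hk
    have he : (a / q - b / q - m : ℝ) = (a - b - m * q) / q := by field_simp
    rw [he, abs_div, abs_of_pos hq0, inv_eq_one_div]
    apply div_le_div₀ (abs_nonneg _) hk1 hq0
    nlinarith
  · have hk : (a * r - b * q - m * (q * r) : ℤ) ≠ 0 := by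
      intro h
      apply hqr
      apply Nat.dvd_antisymm
      · have : (q : ℤ) ∣ r * a := ⟨b + m * r, by linarith⟩
        exact hqa.dvd_of_dvd_mul_right (by exact_mod_cast this)
      · have : (r : ℤ) ∣ q * b := ⟨a - m * q, by linarith⟩
        exact hrb.dvd_of_dvd_mul_right (by exact_mod_cast this)
    have hk1 : (1 : ℝ) ≤ |(a * r - b * q - m * (q * r) : ℝ)| := by
      exact_mod_cast Int.one_le_abs hk
    have he : (a / q - b / r - m : ℝ) = (a * r - b * q - m * (q * r)) / (q * r) := by field_simp
    rw [he, abs_div, abs_of_pos (mul_pos hq0 hr0), inv_eq_one_div]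
    apply div_le_div₀ (abs_nonneg _) hk1 (by positivity)
    have hrQ : (r : ℝ) ≤ Q := by exact_mod_cast hr
    rcases lt_or_gt_of_ne hqr with h | h
    · have : (q : ℝ) ≤ Q - 1 := by
        have : (q : ℝ) + 1 ≤ r := by exact_mod_cast h
        linarith
      nlinarith
    · have : (r : ℝ) ≤ Q - 1 := by
        have : (r : ℝ) + 1 ≤ q := by exact_mod_cast h
        linarith
      nlinarith

theorem large_sieve_farey {Q : ℕ} (hQ : 2 ≤ Q) (M : ℤ) (N : ℕ) (a : ℤ → ℂ) :
    ∑ q ∈ Finset.Icc 1 Q, ∑ k ∈ (Finset.range q).filter (Nat.Coprime q),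
        ‖∑ n ∈ Finset.Ioc M (M + N), a n * expTwoPi (n * (k / q))‖ ^ 2 ≤
      (N + Q * (Q - 1)) * ∑ n ∈ Finset.Ioc M (M + N), ‖a n‖ ^ 2 := by
  have hQ2 : (2 : ℝ) ≤ Q := by exact_mod_cast hQ
  rw [Finset.sum_sigma', ← Finset.sum_coe_sort]
  have := large_sieve_of_separated
    (ι := ↥((Finset.Icc 1 Q).sigma fun q => (Finset.range q).filter (Nat.Coprime q)))
    (fun p => (p.1.2 : ℝ) / p.1.1) (δ := (Q * (Q - 1) : ℝ)⁻¹)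
    (inv_pos.2 (mul_pos (by linarith) (by linarith))) ?_ M N a
  · rwa [inv_inv] at this
  · rintro ⟨⟨q, k⟩, hp⟩ ⟨⟨r, l⟩, hp'⟩ hne m
    simp only [Finset.mem_sigma, Finset.mem_Icc, Finset.mem_filter, Finset.mem_range] at hp hp'
    refine farey_separated hQ hp.1.2 hp'.1.2 hp.2.1 hp'.2.1 hp.2.2 hp'.2.2 ?_ m
    rintro ⟨rfl, rfl⟩
    exact hne rfl

/-- **The large sieve inequality** with primitive Dirichlet characters. -/
theorem large_sieve (Q N : ℕ) (hQ : 0 < Q) (hN : 0 < N) (M : ℤ) (a : ℤ → ℂ) :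
    ∑ q ∈ Finset.Icc 1 Q, ((q : ℝ) / (Nat.totient q)) *
        ∑ χ : DirichletCharacter ℂ q,
          (if χ.IsPrimitive then ‖∑ n ∈ Finset.Ioc M (M + N), a n * χ (n : ZMod q)‖ ^ 2 else 0)
      ≤ ((Q : ℝ) ^ 2 + N - 1) * ∑ n ∈ Finset.Ioc M (M + N), ‖a n‖ ^ 2 := by
  have hstep : ∀ q ∈ Finset.Icc 1 Q, ((q : ℝ) / (Nat.totient q)) *
        ∑ χ : DirichletCharacter ℂ q,
          (if χ.IsPrimitive then ‖∑ n ∈ Finset.Ioc M (M + N), a n * χ (n : ZMod q)‖ ^ 2 else 0) ≤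
      ∑ k ∈ (Finset.range q).filter (Nat.Coprime q),
        ‖∑ n ∈ Finset.Ioc M (M + N), a n * expTwoPi (n * (k / q))‖ ^ 2 := by
    intro q hq
    have : NeZero q := ⟨by have := (Finset.mem_Icc.1 hq).1; omega⟩
    refine le_of_le_of_eq (DirichletCharacter.sum_isPrimitive_norm_sq_le _ a) ?_
    rw [sum_isUnit_eq_sum_coprime]
    simp only [stdAddChar_natCast_mul_intCast]
  refine (Finset.sum_le_sum hstep).trans ?_
  rcases (by omega : Q = 1 ∨ 2 ≤ Q) with rfl | hQ2
  · have hr : (Finset.range 1).filter (Nat.Coprime 1) = {0} := by decide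
    have h0 : ‖∑ n ∈ Finset.Ioc M (M + N), a n‖ ^ 2 ≤
        N * ∑ n ∈ Finset.Ioc M (M + N), ‖a n‖ ^ 2 := by
      refine (pow_le_pow_left₀ (norm_nonneg _) (norm_sum_le _ _) 2).trans ?_
      simpa using sq_sum_le_card_mul_sum_sq (s := Finset.Ioc M (M + N)) (f := fun n => ‖a n‖)
    simpa [hr, expTwoPi_zero] using h0
  · refine (large_sieve_farey hQ2 M N a).trans ?_
    have : (2 : ℝ) ≤ Q := by exact_mod_cast hQ2
    gcongr
    nlinarith
end

section
/- (Dispersion identity for the type II sums.) Fix ε > 0. Let x ≥ 2, let p be a prime, N ≥ 2 an integer, and let d, e be integers with gcd(d,p) = 1 and e ≡ d mod p. Let K ≥ 1 and 2 ≤ L ≤ x be reals with p^N ≤ L, and let (b_n) be a sequence of complex numbers with |b_n| ≤ τ(n). Then Σ_{K < m ≤ 2K, gcd(m,p)=1} | Σ_{n ≤ L, n ≡ e·m̄ mod p^N} b_n − p^{−(N−1)}·Σ_{n ≤ L, n ≡ d·m̄ mod p} b_n |² = (K/φ(p^{2N}))·Σ_{h=2}^{N} Σ*_{χ mod p^h}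 |Σ_{n ≤ L} b_n·χ(n)|² + O_ε(L²·x^ε/p^N), where m̄ denotes a multiplicative inverse of m modulo p^N and Σ*_{χ mod p^h} denotes summation over primitive Dirichlet characters modulo p^h. -/
open scoped Classical
open Finset

/-- The **divisor bound**: `τ(n) ≪_δ n ^ δ` for every `δ > 0`. -/
lemma exists_card_divisors_le_rpow {δ : ℝ} (hδ : 0 < δ) :
    ∃ C : ℝ, 0 < C ∧ ∀ n : ℕ, n ≠ 0 → (#n.divisors : ℝ) ≤ C * (n : ℝ) ^ δ := by
  have hlog : 0 < Real.log 2 := Real.log_pos one_lt_two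
  set M : ℝ := 1 + 1 / (δ * Real.log 2) with hM
  have hM1 : 1 ≤ M := by rw [hM]; linarith [show 0 < 1 / (δ * Real.log 2) by positivity]
  set B : ℕ := ⌈(2 : ℝ) ^ (1 / δ)⌉₊ with hB
  refine ⟨M ^ B, by positivity, fun n hn ↦ ?_⟩
  have hlocal : ∀ q ∈ n.primeFactors, ((n.factorization q + 1 : ℕ) : ℝ) ≤
      (if q < B then M else 1) * ((q : ℝ) ^ n.factorization q) ^ δ := by
    intro q hq
    have hq2 : (2 : ℝ) ≤ q := mod_cast (Nat.prime_of_mem_primeFactors hq).two_le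
    set a := n.factorization q
    rw [← Real.rpow_pow_comm (by positivity)]
    push_cast
    split_ifs with h
    · have h1 : 1 + a * (δ * Real.log 2) ≤ ((q : ℝ) ^ δ) ^ a := by
        calc 1 + a * (δ * Real.log 2) ≤ Real.exp (a * (δ * Real.log 2)) := by
              linarith [Real.add_one_le_exp (a * (δ * Real.log 2))]
          _ = ((2 : ℝ) ^ δ) ^ a := by
              rw [Real.rpow_def_of_pos two_pos, ← Real.exp_nat_mul, mul_comm δ]
          _ ≤ _ := by gcongr
      calc (a : ℝ) + 1 ≤ M * (1 + a * (δ * Real.log 2)) := by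
            have : M * (1 + a * (δ * Real.log 2)) =
                1 + a + a * (δ * Real.log 2) + 1 / (δ * Real.log 2) := by
              rw [hM]; field_simp; ring
            rw [this]
            have : 0 ≤ a * (δ * Real.log 2) := by positivity
            have : 0 ≤ 1 / (δ * Real.log 2) := by positivity
            linarith
        _ ≤ _ := by gcongr
    · have h1 : (2 : ℝ) ≤ (q : ℝ) ^ δ := by
        have h2 : (2 : ℝ) ^ (1 / δ) ≤ q := (Nat.le_ceil _).trans (mod_cast not_lt.mp h)
        calc (2 : ℝ) = ((2 : ℝ) ^ (1 / δ)) ^ δ := by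
              rw [← Real.rpow_mul two_pos.le, one_div_mul_cancel hδ.ne', Real.rpow_one]
          _ ≤ _ := by gcongr
      calc (a : ℝ) + 1 ≤ 2 ^ a := mod_cast Nat.lt_two_pow_self
        _ ≤ ((q : ℝ) ^ δ) ^ a := by gcongr
        _ = _ := (one_mul _).symm
  rw [Nat.card_divisors hn, Nat.cast_prod]
  refine (prod_le_prod (fun _ _ ↦ by positivity) hlocal).trans ?_
  rw [prod_mul_distrib]
  have hn' : ∏ q ∈ n.primeFactors, ((q : ℝ) ^ n.factorization q) ^ δ = (n : ℝ) ^ δ := by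
    rw [Real.finsetProd_rpow _ _ (fun _ _ ↦ by positivity)]
    congr 1
    conv_rhs => rw [← Nat.prod_factorization_pow_eq_self hn]
    simp [Finsupp.prod]
  rw [hn', prod_ite, prod_const, prod_const_one, mul_one]
  gcongr
  calc #{q ∈ n.primeFactors | q < B} ≤ #(range B) :=
        card_le_card fun q hq ↦ mem_range.mpr (mem_filter.mp hq).2
    _ = B := card_range B

lemma abs_card_Ioc_filter_zmod_sub_le {q : ℕ} (hq : 0 < q) {A B : ℕ} (hAB : A ≤ B) (v : ZMod q) :
    |(#((Ioc A B).filter fun n : ℕ ↦ (n : ZMod q) = v) : ℝ) - ((B : ℝ) - A) / q| ≤ 1 := by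
  have : NeZero q := ⟨hq.ne'⟩
  have h1 : ((Ioc A B).filter fun n : ℕ ↦ (n : ZMod q) = v) = {n ∈ Ioc A B | n ≡ v.val [MOD q]} := by
    refine filter_congr fun n _ ↦ ?_
    rw [← ZMod.natCast_eq_natCast_iff, ZMod.natCast_zmod_val]
  have h2 := Nat.Ioc_filter_modEq_card A B hq v.val
  have hq' : (0 : ℚ) < q := mod_cast hq
  rw [max_eq_left (sub_nonneg.mpr (by gcongr))] at h2
  have h3 : |(#{n ∈ Ioc A B | n ≡ v.val [MOD q]} : ℚ) - ((B : ℚ) - A) / q| ≤ 1 := by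
    have h4 : (#{n ∈ Ioc A B | n ≡ v.val [MOD q]} : ℚ) =
        ((⌊((B : ℚ) - v.val) / q⌋ - ⌊((A : ℚ) - v.val) / q⌋ : ℤ) : ℚ) := by
      rw [← h2]; rfl
    rw [h4]
    push_cast
    have h5 : ((B : ℚ) - A) / q = ((B : ℚ) - v.val) / q - ((A : ℚ) - v.val) / q := by ring
    rw [h5, abs_le]
    constructor <;>
    linarith [Int.floor_le (((B : ℚ) - v.val) / q), Int.floor_le (((A : ℚ) - v.val) / q),
      Int.lt_floor_add_one (((B : ℚ) - v.val) / q), Int.lt_floor_add_one (((A : ℚ) - v.val) / q)]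
  rw [h1]
  have h6 : ((|(#{n ∈ Ioc A B | n ≡ v.val [MOD q]} : ℚ) - ((B : ℚ) - A) / q| : ℚ) : ℝ) ≤ (1 : ℚ) :=
    Rat.cast_le.mpr h3
  push_cast at h6
  exact h6

/-- The total variance of `g` about its averages over the fibers of `π`. -/
lemma sum_norm_sub_fiber_average_sq {G H : Type*} [Fintype G] [Fintype H] [DecidableEq H]
    (π : G → H) {k : ℝ} (hk : k ≠ 0) (hπ : ∀ v, (#{u | π u = v} : ℝ) = k) (g : G → ℂ) :
    ∑ u, ‖g u - (k⁻¹ : ℝ) * ∑ w with π w = π u, g w‖ ^ 2 =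
      ∑ u, ‖g u‖ ^ 2 - k⁻¹ * ∑ v, ‖∑ w with π w = v, g w‖ ^ 2 := by
  rw [← sum_fiberwise univ π, ← sum_fiberwise univ π (fun u ↦ ‖g u‖ ^ 2), mul_sum,
    ← sum_sub_distrib]
  refine sum_congr rfl fun v _ ↦ ?_
  set S := ∑ w with π w = v, g w with hS
  have h1 : ∀ u ∈ univ.filter (fun u ↦ π u = v),
      ‖g u - (k⁻¹ : ℝ) * ∑ w with π w = π u, g w‖ ^ 2 =
        ‖g u‖ ^ 2 - 2 * (k⁻¹ * inner ℝ (g u) S) + k⁻¹ ^ 2 * ‖S‖ ^ 2 := by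
    intro u hu
    rw [(mem_filter.mp hu).2, ← hS, ← Complex.real_smul, norm_sub_sq_real, inner_smul_right,
      norm_smul, mul_pow, Real.norm_eq_abs, sq_abs]
  rw [sum_congr rfl h1, sum_add_distrib, sum_sub_distrib, sum_const, nsmul_eq_mul, hπ, ← mul_sum,
    ← mul_sum, ← sum_inner, ← hS, real_inner_self_eq_norm_sq]
  field_simp
  ring

lemma sum_mul_dirichletCharacter_eq_sum_units {q : ℕ} [NeZero q] (s : Finset ℕ) (b : ℕ → ℂ)
    (χ : DirichletCharacter ℂ q) :
    ∑ n ∈ s, b n * χ n =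
      ∑ u : (ZMod q)ˣ, (∑ n ∈ s.filter (fun n : ℕ ↦ (n : ZMod q) = u), b n) * χ u := by
  simp_rw [sum_filter, sum_mul]
  rw [sum_comm]
  refine sum_congr rfl fun n _ ↦ ?_
  by_cases hn : IsUnit (n : ZMod q)
  · obtain ⟨u, hu⟩ := hn
    rw [sum_eq_single u (fun v _ hv ↦ ?_) (by simp), if_pos hu.symm, hu]
    rw [if_neg, zero_mul]
    rw [← hu]
    exact fun h ↦ hv (Units.ext h).symm
  · rw [χ.map_nonunit hn, mul_zero, sum_eq_zero]
    intro u _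
    rw [if_neg (fun h : (n : ZMod q) = u ↦ hn (h ▸ u.isUnit)), zero_mul]

/-- **Parseval's identity** for Dirichlet characters. -/
lemma sum_norm_sum_mul_dirichletCharacter_sq {q : ℕ} [NeZero q] (s : Finset ℕ) (b : ℕ → ℂ) :
    ∑ χ : DirichletCharacter ℂ q, ‖∑ n ∈ s, b n * χ n‖ ^ 2 =
      q.totient * ∑ u : (ZMod q)ˣ, ‖∑ n ∈ s.filter (fun n : ℕ ↦ (n : ZMod q) = u), b n‖ ^ 2 := by
  simp_rw [sum_mul_dirichletCharacter_eq_sum_units]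
  set g : (ZMod q)ˣ → ℂ := fun u ↦ ∑ n ∈ s.filter (fun n : ℕ ↦ (n : ZMod q) = u), b n
  suffices h : ∑ χ : DirichletCharacter ℂ q, ((‖∑ u, g u * χ u‖ ^ 2 : ℝ) : ℂ) =
      ((q.totient * ∑ u, ‖g u‖ ^ 2 : ℝ) : ℂ) by exact_mod_cast h
  have h1 : ∀ χ : DirichletCharacter ℂ q, ((‖∑ u, g u * χ u‖ ^ 2 : ℝ) : ℂ) =
      ∑ u, ∑ v, g u * (starRingEnd ℂ) (g v) * (χ ((v : ZMod q)⁻¹) * χ u) := by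
    intro χ
    push_cast
    rw [← Complex.mul_conj', map_sum, sum_mul_sum]
    refine sum_congr rfl fun u _ ↦ sum_congr rfl fun v _ ↦ ?_
    have : (starRingEnd ℂ) (χ v) = χ ((v : ZMod q)⁻¹) := by
      have h2 := MulChar.star_apply χ (v : ZMod q)
      rw [MulChar.star_eq_inv, MulChar.inv_apply, Ring.inverse_unit] at h2
      rw [ZMod.inv_coe_unit]
      exact h2.symm
    rw [map_mul, this]
    ring
  simp_rw [h1]
  rw [sum_comm]
  push_cast
  rw [mul_sum]
  refine sum_congr rfl fun u _ ↦ ?_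
  rw [sum_comm, sum_eq_single u]
  · rw [← mul_sum, DirichletCharacter.sum_char_inv_mul_char_eq ℂ u.isUnit, if_pos rfl,
      Complex.mul_conj', mul_comm]
  · intro v _ hv
    rw [← mul_sum, DirichletCharacter.sum_char_inv_mul_char_eq ℂ v.isUnit,
      if_neg (fun h ↦ hv (Units.ext h)), mul_zero]
  · simp

lemma not_isPrimitive_prime_pow_succ_iff {p : ℕ} (hp : p.Prime) (h : ℕ)
    (χ : DirichletCharacter ℂ (p ^ (h + 1))) :
    ¬ χ.IsPrimitive ↔
      ∃ ψ, DirichletCharacter.changeLevel (pow_dvd_pow p h.le_succ) ψ = χ := by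
  have : NeZero (p ^ (h + 1)) := ⟨(pow_pos hp.pos _).ne'⟩
  rw [DirichletCharacter.isPrimitive_def]
  constructor
  · intro hχ
    obtain ⟨j, hj, hj'⟩ := (Nat.dvd_prime_pow hp).mp χ.conductor_dvd_level
    have hjh : j ≤ h := by
      rcases Nat.lt_or_ge h j with h1 | h1
      · exact absurd (by rw [hj', le_antisymm hj h1]) hχ
      · exact h1
    have h2 : χ.FactorsThrough (p ^ h) := DirichletCharacter.FactorsThrough.mono χ
      χ.factorsThrough_conductor (hj' ▸ pow_dvd_pow p hjh) (pow_dvd_pow p h.le_succ)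
    exact ⟨h2.χ₀, h2.eq_changeLevel.symm⟩
  · rintro ⟨ψ, rfl⟩ hc
    have h1 := (DirichletCharacter.conductor_changeLevel ψ (pow_dvd_pow p h.le_succ)) ▸ hc
    have h2 := Nat.le_of_dvd (pow_pos hp.pos _) ψ.conductor_dvd_level
    rw [h1] at h2
    exact absurd h2 (not_le.mpr (Nat.pow_lt_pow_right hp.one_lt h.lt_succ_self))

lemma sum_primitive_prime_pow_succ {p : ℕ} (hp : p.Prime) {h : ℕ} (hh : h ≠ 0) (s : Finset ℕ)
    (b : ℕ → ℂ) :
    ∑ χ : DirichletCharacter ℂ (p ^ (h + 1)),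
        (if χ.IsPrimitive then ‖∑ n ∈ s, b n * χ (n : ZMod (p ^ (h + 1)))‖ ^ 2 else 0) =
      ∑ χ : DirichletCharacter ℂ (p ^ (h + 1)), ‖∑ n ∈ s, b n * χ n‖ ^ 2 -
        ∑ χ : DirichletCharacter ℂ (p ^ h), ‖∑ n ∈ s, b n * χ n‖ ^ 2 := by
  have : NeZero (p ^ (h + 1)) := ⟨(pow_pos hp.pos _).ne'⟩
  rw [eq_sub_iff_add_eq, ← sum_filter, ← sum_filter_add_sum_filter_not univ
    (fun χ : DirichletCharacter ℂ (p ^ (h + 1)) ↦ χ.IsPrimitive)]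
  congr 1
  refine sum_bij (fun ψ _ ↦ DirichletCharacter.changeLevel (pow_dvd_pow p h.le_succ) ψ) ?_ ?_ ?_ ?_
  · intro ψ _
    simpa using (not_isPrimitive_prime_pow_succ_iff hp h _).mpr ⟨ψ, rfl⟩
  · intro ψ _ ψ' _ hψ
    exact DirichletCharacter.changeLevel_injective _ hψ
  · intro χ hχ
    obtain ⟨ψ, hψ⟩ := (not_isPrimitive_prime_pow_succ_iff hp h χ).mp (mem_filter.mp hχ).2
    exact ⟨ψ, mem_univ _, hψ⟩
  · intro ψ _
    congr 2
    refine sum_congr rfl fun n _ ↦ ?_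
    congr 1
    by_cases hn : n.Coprime p
    · have := DirichletCharacter.changeLevel_eq_cast_of_dvd' ψ (pow_dvd_pow p h.le_succ)
        (a := (n : ℤ)) (by rw [Nat.isCoprime_iff_coprime]; exact hn.pow_right _)
      simpa using this.symm
    · rw [MulChar.map_nonunit, MulChar.map_nonunit] <;>
      · rw [ZMod.isUnit_iff_coprime, Nat.coprime_pow_right_iff (by omega)]
        exact hn

lemma sum_primitive_prime_pow_eq_sub {p : ℕ} (hp : p.Prime) {N : ℕ} (hN : 1 ≤ N) (s : Finset ℕ)
    (b : ℕ → ℂ) :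
    ∑ h ∈ Icc 2 N, ∑ χ : DirichletCharacter ℂ (p ^ h),
        (if χ.IsPrimitive then ‖∑ n ∈ s, b n * χ (n : ZMod (p ^ h))‖ ^ 2 else 0) =
      ∑ χ : DirichletCharacter ℂ (p ^ N), ‖∑ n ∈ s, b n * χ n‖ ^ 2 -
        ∑ χ : DirichletCharacter ℂ (p ^ 1), ‖∑ n ∈ s, b n * χ n‖ ^ 2 := by
  induction N, hN using Nat.le_induction with
  | base => simp
  | succ N hN ih =>
    rw [sum_Icc_succ_top (by omega), ih, sum_primitive_prime_pow_succ hp (by omega)]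
    ring

lemma card_fiber_unitsMap {q r : ℕ} [NeZero q] (hrq : r ∣ q) (v : (ZMod r)ˣ) :
    (#{u | ZMod.unitsMap hrq u = v} : ℝ) = q.totient / r.totient := by
  have : NeZero r := ⟨ne_zero_of_dvd_ne_zero (NeZero.ne q) hrq⟩
  have h1 : ∀ w : (ZMod r)ˣ,
      #{u | ZMod.unitsMap hrq u = w} = #{u | ZMod.unitsMap hrq u = v} := by
    intro w
    obtain ⟨a, ha⟩ := ZMod.unitsMap_surjective hrq (v * w⁻¹)
    refine card_bijective _ (Group.mulLeft_bijective a) fun u ↦ ?_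
    simp only [mem_filter, mem_univ, true_and, map_mul, ha]
    rw [mul_assoc, mul_eq_left, inv_mul_eq_one, eq_comm]
  have h2 := card_eq_sum_card_fiberwise (s := (univ : Finset (ZMod q)ˣ))
    (t := (univ : Finset (ZMod r)ˣ)) (f := ZMod.unitsMap hrq) (fun _ _ ↦ mem_univ _)
  rw [sum_congr rfl fun w _ ↦ h1 w, sum_const, card_univ, card_univ, ZMod.card_units_eq_totient,
    ZMod.card_units_eq_totient, smul_eq_mul] at h2
  have h3 : (0 : ℝ) < r.totient := mod_cast Nat.totient_pos.mpr (NeZero.pos r)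
  rw [eq_div_iff h3.ne', mul_comm]
  exact_mod_cast h2.symm

lemma sum_fiber_unitsMap {q r : ℕ} [NeZero q] (hrq : r ∣ q)
    (hcop : ∀ n : ℕ, n.Coprime r → n.Coprime q) (s : Finset ℕ) (b : ℕ → ℂ) (v : (ZMod r)ˣ) :
    ∑ w with ZMod.unitsMap hrq w = v, ∑ n ∈ s.filter (fun n : ℕ ↦ (n : ZMod q) = w), b n =
      ∑ n ∈ s.filter (fun n : ℕ ↦ (n : ZMod r) = v), b n := by
  simp_rw [sum_filter]
  have h0 : ∀ w : (ZMod q)ˣ, (if ZMod.unitsMap hrq w = v then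
      ∑ n ∈ s, (if (n : ZMod q) = w then b n else 0) else 0) =
      ∑ n ∈ s, (if ZMod.unitsMap hrq w = v ∧ (n : ZMod q) = w then b n else 0) := by
    intro w
    split_ifs with h <;> simp [h]
  simp_rw [h0]
  rw [sum_comm]
  refine sum_congr rfl fun n _ ↦ ?_
  have h1 : ∀ w : (ZMod q)ˣ, (n : ZMod q) = w →
      (ZMod.unitsMap hrq w = v ↔ (n : ZMod r) = v) := by
    intro w hw
    rw [Units.ext_iff, ZMod.unitsMap_val, ← hw, ZMod.cast_natCast hrq]
  split_ifs with h
  · have hn : n.Coprime q := hcop n ((ZMod.isUnit_iff_coprime n r).mp (h ▸ v.isUnit))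
    obtain ⟨w, hw⟩ := (ZMod.isUnit_iff_coprime n q).mpr hn
    rw [sum_eq_single w (fun w' _ hw' ↦ if_neg fun h2 ↦ hw' (Units.ext (h2.2.symm.trans hw.symm)))
      (by simp), if_pos ⟨(h1 w hw.symm).mpr h, hw.symm⟩]
  · exact sum_eq_zero fun w _ ↦ if_neg fun h2 ↦ h ((h1 w h2.2).mp h2.1)

lemma sum_units_norm_sub_sq {q r : ℕ} [NeZero q] [NeZero r] (hrq : r ∣ q)
    (hcop : ∀ n : ℕ, n.Coprime r → n.Coprime q) (s : Finset ℕ) (b : ℕ → ℂ) :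
    ∑ u : (ZMod q)ˣ, ‖∑ n ∈ s.filter (fun n : ℕ ↦ (n : ZMod q) = u), b n -
        ((q.totient / r.totient : ℝ)⁻¹ : ℝ) *
          ∑ n ∈ s.filter (fun n : ℕ ↦ (n : ZMod r) = ZMod.unitsMap hrq u), b n‖ ^ 2 =
      (q.totient : ℝ)⁻¹ * (∑ χ : DirichletCharacter ℂ q, ‖∑ n ∈ s, b n * χ n‖ ^ 2 -
        ∑ χ : DirichletCharacter ℂ r, ‖∑ n ∈ s, b n * χ n‖ ^ 2) := by
  have hq : (0 : ℝ) < q.totient := mod_cast Nat.totient_pos.mpr (NeZero.pos q)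
  have hr : (0 : ℝ) < r.totient := mod_cast Nat.totient_pos.mpr (NeZero.pos r)
  have h := sum_norm_sub_fiber_average_sq (ZMod.unitsMap hrq) (div_pos hq hr).ne'
    (card_fiber_unitsMap hrq)
    (fun u : (ZMod q)ˣ ↦ ∑ n ∈ s.filter (fun n : ℕ ↦ (n : ZMod q) = u), b n)
  simp_rw [sum_fiber_unitsMap hrq hcop] at h
  have hdist : ∀ X Y : ℝ, X - (q.totient / r.totient : ℝ)⁻¹ * Y =
      (q.totient : ℝ)⁻¹ * (q.totient * X - r.totient * Y) := by
    intro X Y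
    field_simp
  rw [sum_norm_sum_mul_dirichletCharacter_sq, sum_norm_sum_mul_dirichletCharacter_sq, ← hdist]
  exact h

lemma sum_coprime_eq_sum_units {q : ℕ} [NeZero q] (s : Finset ℕ) (f : ℕ → ℝ) (w : (ZMod q)ˣ → ℝ)
    (hf : ∀ m : ℕ, ∀ u : (ZMod q)ˣ, (m : ZMod q) = u → f m = w u) :
    ∑ m ∈ s.filter (fun m ↦ m.Coprime q), f m =
      ∑ u : (ZMod q)ˣ, (#(s.filter fun m : ℕ ↦ (m : ZMod q) = u) : ℝ) * w u := by
  simp_rw [← nsmul_eq_mul, ← sum_const, sum_filter]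
  rw [sum_comm]
  refine sum_congr rfl fun m _ ↦ ?_
  split_ifs with h
  · obtain ⟨u, hu⟩ := (ZMod.isUnit_iff_coprime m q).mpr h
    rw [sum_eq_single u (fun v _ hv ↦ if_neg fun h2 ↦ hv (Units.ext (h2.symm.trans hu.symm)))
      (by simp), if_pos hu.symm, hf m u hu.symm]
  · exact (sum_eq_zero fun (u : (ZMod q)ˣ) _ ↦ if_neg fun h2 : (m : ZMod q) = (u : ZMod q) ↦
      h ((ZMod.isUnit_iff_coprime m q).mp (h2 ▸ u.isUnit))).symm

lemma norm_sum_filter_zmod_le {q : ℕ} (hq : 0 < q) {X : ℕ} {L D : ℝ} (hX : (X : ℝ) ≤ L)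
    (b : ℕ → ℂ) (hD : 0 ≤ D) (hb : ∀ n ∈ Icc 1 X, ‖b n‖ ≤ D) (v : ZMod q) :
    ‖∑ n ∈ (Icc 1 X).filter (fun n : ℕ ↦ (n : ZMod q) = v), b n‖ ≤ (L / q + 1) * D := by
  have hcard := (abs_le.mp (abs_card_Ioc_filter_zmod_sub_le hq X.zero_le v)).2
  have hI : Ioc 0 X = Icc 1 X := rfl
  have hL : (X : ℝ) / q ≤ L / q := by gcongr
  rw [hI, Nat.cast_zero, sub_zero] at hcard
  calc _ ≤ ∑ n ∈ (Icc 1 X).filter (fun n : ℕ ↦ (n : ZMod q) = v), ‖b n‖ := norm_sum_le _ _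
    _ ≤ #((Icc 1 X).filter (fun n : ℕ ↦ (n : ZMod q) = v)) • D :=
        sum_le_card_nsmul _ _ _ fun n hn ↦ hb n (mem_filter.mp hn).1
    _ ≤ _ := by
        rw [nsmul_eq_mul]
        gcongr
        linarith

lemma abs_card_dyadic_filter_zmod_sub_le {q : ℕ} (hq : 0 < q) {K : ℝ} (hK : 0 ≤ K) (v : ZMod q) :
    |(#((Ioc ⌊K⌋₊ ⌊2 * K⌋₊).filter fun n : ℕ ↦ (n : ZMod q) = v) : ℝ) - K / q| ≤ 2 := by
  have h1 := abs_card_Ioc_filter_zmod_sub_le hq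
    (Nat.floor_mono (by linarith : K ≤ 2 * K)) v
  have hq1 : (1 : ℝ) ≤ q := mod_cast hq
  have h2 : |((⌊2 * K⌋₊ : ℝ) - ⌊K⌋₊) / q - K / q| ≤ 1 := by
    rw [← sub_div, abs_div, abs_of_pos (by linarith : (0 : ℝ) < q), div_le_one (by linarith)]
    refine le_trans (abs_le.mpr ?_) hq1
    constructor <;>
    linarith [Nat.floor_le hK, Nat.floor_le (by linarith : 0 ≤ 2 * K), Nat.lt_floor_add_one K,
      Nat.lt_floor_add_one (2 * K)]
  calc _ ≤ _ + _ := abs_sub_le _ (((⌊2 * K⌋₊ : ℝ) - ⌊K⌋₊) / q) _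
    _ ≤ 2 := by linarith

lemma abs_sum_mul_sub_mul_sum_le {ι : Type*} [Fintype ι] {c w w' : ι → ℝ} {κ δ W : ℝ}
    (hc : ∀ i, |c i - κ| ≤ δ) (hw : ∀ i, 0 ≤ w i) (hW : ∀ i, w i ≤ W)
    (hw' : ∑ i, w i = ∑ i, w' i) :
    |∑ i, c i * w i - κ * ∑ i, w' i| ≤ Fintype.card ι * (δ * W) := by
  rw [← hw', mul_sum, ← sum_sub_distrib]
  calc _ ≤ ∑ i, |c i * w i - κ * w i| := abs_sum_le_sum_abs _ _
    _ ≤ ∑ _i : ι, δ * W := by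
        refine sum_le_sum fun i _ ↦ ?_
        rw [← sub_mul, abs_mul, abs_of_nonneg (hw i)]
        exact mul_le_mul (hc i) (hW i) (hw i) ((abs_nonneg _).trans (hc i))
    _ = _ := by rw [sum_const, card_univ, nsmul_eq_mul]

/-- **Dispersion identity for the type II sums.** For fixed `ε > 0`, with an
implied constant depending only on `ε`: for a prime `p`, `N ≥ 2`,
residues `e ≡ d (mod p)` with `(d, p) = 1`, `K ≥ 1`, `2 ≤ L ≤ x` with `p^N ≤ L`,
and a divisor-bounded sequence `(b_n)`,
`∑_{K < m ≤ 2K, (m,p)=1} |∑_{n ≤ L, n ≡ e m̄ (p^N)} b_n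
    - p^{-(N-1)} ∑_{n ≤ L, n ≡ d m̄ (p)} b_n|²
  = (K/φ(p^{2N})) ∑_{h=2}^{N} ∑*_{χ mod p^h} |∑_{n ≤ L} b_n χ(n)|²
    + O_ε(L² x^ε / p^N)`,
where `∑*` runs over primitive Dirichlet characters mod `p^h`. -/
theorem dispersion_identity_type_II (ε : ℝ) (hε : 0 < ε) :
    ∃ Kc : ℝ, 0 < Kc ∧
      ∀ x : ℝ, 2 ≤ x → ∀ p : ℕ, p.Prime → ∀ N : ℕ, 2 ≤ N →
      ∀ d e : ℤ, Int.gcd d p = 1 → e ≡ d [ZMOD (p : ℤ)] →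
      ∀ K L : ℝ, 1 ≤ K → 2 ≤ L → L ≤ x → ((p : ℝ) ^ N ≤ L) →
      ∀ b : ℕ → ℂ, (∀ n, ‖b n‖ ≤ (n.divisors.card : ℝ)) →
      ∀ mbar : ℕ → ℤ, (∀ m : ℕ, Nat.gcd m p = 1 →
        (m : ℤ) * mbar m ≡ 1 [ZMOD ((p : ℤ) ^ N)]) →
      |(∑ m ∈ (Finset.Icc 1 ⌊2 * K⌋₊).filter (fun m : ℕ => K < (m : ℝ) ∧ Nat.gcd m p = 1),
          ‖(∑ n ∈ (Finset.Icc 1 ⌊L⌋₊).filter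
                (fun n : ℕ => (n : ℤ) ≡ e * mbar m [ZMOD ((p : ℤ) ^ N)]), b n)
            - (((p : ℝ) ^ (N - 1))⁻¹ : ℝ) * ∑ n ∈ (Finset.Icc 1 ⌊L⌋₊).filter
                (fun n : ℕ => (n : ℤ) ≡ d * mbar m [ZMOD (p : ℤ)]), b n‖ ^ 2)
        - (K / (Nat.totient (p ^ (2 * N)))) *
            ∑ h ∈ Finset.Icc 2 N, ∑ χ : DirichletCharacter ℂ (p ^ h),
              (if χ.IsPrimitive then ‖∑ n ∈ Finset.Icc 1 ⌊L⌋₊, b n * χ (n : ZMod (p ^ h))‖ ^ 2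
                else 0)|
        ≤ Kc * L ^ 2 * x ^ ε / (p : ℝ) ^ N := by
  obtain ⟨C, hC, hdiv⟩ := exists_card_divisors_le_rpow (half_pos hε)
  refine ⟨32 * C ^ 2, by positivity, ?_⟩
  intro x hx p hp N hN d e hd hed K L hK hL hLx hpL b hb mbar hmbar
  have hxpos : 0 < x := by linarith
  set q := p ^ N with hq
  set r := p ^ 1 with hr
  have hqpos : 0 < q := pow_pos hp.pos _
  have hrpos : 0 < r := pow_pos hp.pos _
  have : NeZero q := ⟨hqpos.ne'⟩
  have : NeZero r := ⟨hrpos.ne'⟩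
  have hrq : r ∣ q := pow_dvd_pow p (by omega)
  have hcopq : ∀ n : ℕ, n.Coprime q ↔ n.Coprime p := fun n ↦
    Nat.coprime_pow_right_iff (by omega) n p
  have hcop : ∀ n : ℕ, n.Coprime r → n.Coprime q := fun n h ↦
    (hcopq n).mpr (by simpa [hr] using h)
  -- the ratio of totients
  have hp1 : (0 : ℝ) < p := mod_cast hp.pos
  have hpm : (0 : ℝ) < ((p - 1 : ℕ) : ℝ) := mod_cast Nat.sub_pos_of_lt hp.one_lt
  have hφq : (q.totient : ℝ) = p ^ (N - 1) * ((p - 1 : ℕ) : ℝ) := by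
    rw [hq, Nat.totient_prime_pow hp (by omega)]; push_cast; rfl
  have hφr : (r.totient : ℝ) = ((p - 1 : ℕ) : ℝ) := by
    rw [hr, pow_one, Nat.totient_prime hp]
  have hφ : (q.totient / r.totient : ℝ) = p ^ (N - 1) := by
    rw [hφq, hφr]; field_simp
  have hφ2 : ((p ^ (2 * N)).totient : ℝ) = q * q.totient := by
    rw [hφq, Nat.totient_prime_pow hp (by omega), hq]
    push_cast
    rw [← mul_assoc, ← pow_add]
    congr 2
    omega
  -- the residue class of `e`
  have heu : IsUnit (e : ZMod q) := by
    have h1 : IsCoprime d (p : ℤ) := Int.isCoprime_iff_gcd_eq_one.mpr hd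
    have h2 : IsCoprime e (p : ℤ) := by
      obtain ⟨t, ht⟩ := hed.dvd
      have : e = d + p * (-t) := by linarith
      rw [this]
      exact h1.add_mul_left_left _
    have h3 : IsCoprime e (q : ℤ) := by
      rw [hq, Nat.cast_pow]; exact h2.pow_right
    exact (ZMod.coe_int_isUnit_iff_isCoprime _ _).mpr h3.symm
  obtain ⟨E, hE⟩ := heu
  set s := Icc 1 ⌊L⌋₊ with hs
  set F : (ZMod q)ˣ → ℂ := fun u ↦ ∑ n ∈ s.filter (fun n : ℕ ↦ (n : ZMod q) = u), b n -
        ((q.totient / r.totient : ℝ)⁻¹ : ℝ) *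
          ∑ n ∈ s.filter (fun n : ℕ ↦ (n : ZMod r) = ZMod.unitsMap hrq u), b n with hF
  -- the left-hand side as a weighted sum over residue classes
  have hS : ∑ m ∈ (Icc 1 ⌊2 * K⌋₊).filter (fun m : ℕ => K < (m : ℝ) ∧ Nat.gcd m p = 1),
          ‖(∑ n ∈ s.filter (fun n : ℕ => (n : ℤ) ≡ e * mbar m [ZMOD ((p : ℤ) ^ N)]), b n)
            - (((p : ℝ) ^ (N - 1))⁻¹ : ℝ) * ∑ n ∈ s.filter
                (fun n : ℕ => (n : ℤ) ≡ d * mbar m [ZMOD (p : ℤ)]), b n‖ ^ 2 =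
      ∑ u : (ZMod q)ˣ, (#((Ioc ⌊K⌋₊ ⌊2 * K⌋₊).filter fun m : ℕ ↦ (m : ZMod q) = u) : ℝ) *
        ‖F (E * u⁻¹)‖ ^ 2 := by
    rw [← sum_coprime_eq_sum_units (f := fun m ↦
      ‖(∑ n ∈ s.filter (fun n : ℕ => (n : ℤ) ≡ e * mbar m [ZMOD ((p : ℤ) ^ N)]), b n)
            - (((p : ℝ) ^ (N - 1))⁻¹ : ℝ) * ∑ n ∈ s.filter
                (fun n : ℕ => (n : ℤ) ≡ d * mbar m [ZMOD (p : ℤ)]), b n‖ ^ 2)]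
    · refine sum_congr ?_ fun _ _ ↦ rfl
      ext m
      simp only [mem_filter, mem_Icc, mem_Ioc, hcopq, Nat.floor_lt (by linarith : 0 ≤ K)]
      constructor
      · rintro ⟨⟨_, h2⟩, h3, h4⟩
        exact ⟨⟨h3, h2⟩, h4⟩
      · rintro ⟨⟨h3, h2⟩, h4⟩
        refine ⟨⟨?_, h2⟩, h3, h4⟩
        have : (0 : ℝ) < m := by linarith
        exact_mod_cast this
    · intro m u hmu
      have hm : Nat.gcd m p = 1 :=
        (hcopq m).mp ((ZMod.isUnit_iff_coprime m q).mp (hmu ▸ u.isUnit))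
      have hinv : (m : ZMod q) * (mbar m : ZMod q) = 1 := by
        have := (ZMod.intCast_eq_intCast_iff ((m : ℤ) * mbar m) 1 q).mpr (by
          rw [hq, Nat.cast_pow]; exact hmbar m hm)
        exact_mod_cast this
      have hmb : (mbar m : ZMod q) = (u⁻¹ : (ZMod q)ˣ) := by
        rw [hmu] at hinv
        exact (Units.inv_eq_of_mul_eq_one_right hinv).symm
      have hEu : ((e * mbar m : ℤ) : ZMod q) = (E * u⁻¹ : (ZMod q)ˣ) := by
        push_cast
        rw [hmb, hE]
      have hEr : ((d * mbar m : ℤ) : ZMod r) = ZMod.unitsMap hrq (E * u⁻¹) := by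
        rw [ZMod.unitsMap_val, ← hEu, ZMod.cast_intCast hrq, ZMod.intCast_eq_intCast_iff, hr,
          pow_one]
        exact hed.symm.mul_right _
      have h1 : ∀ n : ℕ, (n : ℤ) ≡ e * mbar m [ZMOD ((p : ℤ) ^ N)] ↔
          (n : ZMod q) = (E * u⁻¹ : (ZMod q)ˣ) := by
        intro n
        rw [← hEu, ← Int.cast_natCast (R := ZMod q) n, ZMod.intCast_eq_intCast_iff, hq,
          Nat.cast_pow]
      have h2 : ∀ n : ℕ, (n : ℤ) ≡ d * mbar m [ZMOD (p : ℤ)] ↔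
          (n : ZMod r) = ZMod.unitsMap hrq (E * u⁻¹) := by
        intro n
        rw [← hEr, ← Int.cast_natCast (R := ZMod r) n, ZMod.intCast_eq_intCast_iff, hr, pow_one]
      simp only [hF, hφ, h1, h2]
  -- the main term as a sum over residue classes
  have hM : K / ((p ^ (2 * N)).totient : ℝ) *
            ∑ h ∈ Icc 2 N, ∑ χ : DirichletCharacter ℂ (p ^ h),
              (if χ.IsPrimitive then ‖∑ n ∈ s, b n * χ (n : ZMod (p ^ h))‖ ^ 2 else 0) =
      K / q * ∑ u, ‖F u‖ ^ 2 := by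
    rw [sum_primitive_prime_pow_eq_sub hp (by omega), hF, sum_units_norm_sub_sq hrq hcop, hφ2]
    ring
  -- the pointwise bound
  set D : ℝ := C * x ^ (ε / 2) with hD
  have hDpos : 0 ≤ D := by positivity
  have hLfl : (⌊L⌋₊ : ℝ) ≤ L := Nat.floor_le (by linarith)
  have hbD : ∀ n ∈ Icc 1 ⌊L⌋₊, ‖b n‖ ≤ D := by
    intro n hn
    obtain ⟨hn1, hn2⟩ := mem_Icc.mp hn
    have hnx : (n : ℝ) ≤ x := le_trans (le_trans (mod_cast hn2) hLfl) hLx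
    refine (hb n).trans ((hdiv n (by omega)).trans ?_)
    rw [hD]
    gcongr
  have hqR : (0 : ℝ) < q := mod_cast hqpos
  have hqL : (q : ℝ) ≤ L := by rw [hq]; push_cast; exact hpL
  have hLq : 1 ≤ L / q := (one_le_div hqR).mpr hqL
  have hqp : (q : ℝ) = p ^ (N - 1) * r := by
    rw [hq, hr]; push_cast; rw [← pow_add]; congr 1; omega
  have hFb : ∀ u, ‖F u‖ ^ 2 ≤ (4 * (L / q) * D) ^ 2 := by
    intro u
    have hP : (1 : ℝ) ≤ p ^ (N - 1) := one_le_pow₀ (mod_cast hp.one_le)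
    have hP' : ((p : ℝ) ^ (N - 1))⁻¹ ≤ 1 := inv_le_one_of_one_le₀ hP
    have hrR : (0 : ℝ) < r := mod_cast hrpos
    have h1 := norm_sum_filter_zmod_le hqpos hLfl b hDpos hbD u
    have h2 := norm_sum_filter_zmod_le hrpos hLfl b hDpos hbD (ZMod.unitsMap hrq u)
    gcongr
    calc ‖F u‖ ≤ (L / q + 1) * D + ((p : ℝ) ^ (N - 1))⁻¹ * ((L / r + 1) * D) := by
          refine (norm_sub_le _ _).trans (add_le_add h1 ?_)
          rw [norm_mul, Complex.norm_real, hφ, Real.norm_of_nonneg (by positivity)]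
          gcongr
      _ = (L / q + 1 + (L / q + ((p : ℝ) ^ (N - 1))⁻¹)) * D := by
          rw [hqp]; field_simp
      _ ≤ 4 * (L / q) * D := by
          gcongr
          linarith
  have hreindex : ∑ u, ‖F (E * u⁻¹)‖ ^ 2 = ∑ u, ‖F u‖ ^ 2 :=
    Fintype.sum_equiv ((Equiv.inv _).trans (Equiv.mulLeft E)) _ _ fun _ ↦ rfl
  rw [hS, hM]
  refine (abs_sum_mul_sub_mul_sum_le
    (fun u : (ZMod q)ˣ ↦ abs_card_dyadic_filter_zmod_sub_le hqpos (by linarith : 0 ≤ K) u)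
    (fun u ↦ sq_nonneg _) (fun u ↦ hFb _) hreindex).trans ?_
  have hxε : (x ^ (ε / 2)) ^ 2 = x ^ ε := by
    rw [← Real.rpow_natCast, ← Real.rpow_mul hxpos.le]
    congr 1
    push_cast
    ring
  have hcard : (Fintype.card (ZMod q)ˣ : ℝ) ≤ q := by
    rw [ZMod.card_units_eq_totient]
    exact_mod_cast q.totient_le
  calc _ ≤ (q : ℝ) * (2 * (4 * (L / q) * D) ^ 2) := by gcongr
    _ = 32 * C ^ 2 * L ^ 2 * (x ^ (ε / 2)) ^ 2 / q := by
        rw [hD]; field_simp; ring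
    _ = _ := by rw [hxε, hq, Nat.cast_pow]
end

section
/- (Type II estimate.) Fix C ≥ 6 and ε ∈ (0, 1/20). Let x ≥ 2 and x^ε ≤ Q ≤ x^{1/4}. Let P be a set of primes p ≤ (log x)^C, and for each p ∈ P let N_p ≥ 2 be an integer with p^{N_p} ∈ (Q, 2Q], let 2 ≤ y_p ≤ x, and let d_p, e_p be integers with gcd(d_p, p) = 1 and e_p ≡ d_p mod p. Let (a_m) and (b_n) be sequences of complex numbers with |a_m| ≤ τ(m) and |b_n| ≤ τ(n). For p ∈ P set Σ_p := Σ_{x^{1/4} < m ≤ x^{3/4}, gcd(m,p)=1} a_m·( Σ_{n ≤ y_p/m, n ≡ e_p·m̄ mod p^{N_p}} b_n − p^{−(N_p−1)}·Σ_{n ≤ y_p/m, n ≡ d_p·m̄ mod p} b_n ), where m̄ is a multiplicative inverse of m modulo p^{N_p}. Then Σ_{p∈P} |Σ_p|² ≪_{C,ε} Q^{−2}·x²·(log x)^{10} + x^{3/2}·(log x)^{10} + Q^{−1}·x^{7/4+4ε}. -/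
open scoped Classical
open Finset

theorem sum_inv_le_one_add_log (A : ℕ) {L : ℝ} (hL : 1 + Real.log A ≤ L) :
    ∑ n ∈ Ioc 0 A, (n : ℝ)⁻¹ ≤ L := by
  refine le_trans ?_ hL
  have h := harmonic_le_one_add_log A
  rw [harmonic_eq_sum_Icc] at h
  push_cast at h
  exact h

theorem card_divisorsAntidiagonal (n : ℕ) : #n.divisorsAntidiagonal = #n.divisors := by
  rw [← Nat.map_div_right_divisors, card_map]

theorem sum_card_divisors_le (A : ℕ) {L : ℝ} (hL : 1 + Real.log A ≤ L) :
    ∑ n ∈ Ioc 0 A, (n.divisors.card : ℝ) ≤ A * L := by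
  have h : ∑ n ∈ Ioc 0 A, (n.divisors.card : ℝ) = ∑ n ∈ Ioc 0 A, ((A / n : ℕ) : ℝ) := by
    have h2 := ArithmeticFunction.sum_Ioc_sigma0_eq_sum_div A
    simp only [ArithmeticFunction.sigma_zero_apply] at h2
    exact_mod_cast h2
  rw [h]
  calc ∑ n ∈ Ioc 0 A, ((A / n : ℕ) : ℝ) ≤ ∑ n ∈ Ioc 0 A, (A : ℝ) * (n : ℝ)⁻¹ := by
        refine sum_le_sum fun n _ => ?_
        rw [← div_eq_mul_inv]
        exact Nat.cast_div_le
    _ = A * ∑ n ∈ Ioc 0 A, (n : ℝ)⁻¹ := by rw [mul_sum]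
    _ ≤ A * L := by gcongr; exact sum_inv_le_one_add_log A hL

theorem sum_card_divisors_div_le (A : ℕ) {L : ℝ} (hL : 1 + Real.log A ≤ L) :
    ∑ n ∈ Ioc 0 A, (n.divisors.card : ℝ) * (n : ℝ)⁻¹ ≤ L ^ 2 := by
  let f : ArithmeticFunction ℝ := ⟨fun n => (n : ℝ)⁻¹, by simp⟩
  have hf : ∀ n, f n = (n : ℝ)⁻¹ := fun n => rfl
  have h := ArithmeticFunction.sum_Ioc_mul_eq_sum_sum f f A
  have h1 : ∀ n, (f * f) n = (n.divisors.card : ℝ) * (n : ℝ)⁻¹ := by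
    intro n
    rw [ArithmeticFunction.mul_apply, ← card_divisorsAntidiagonal, ← nsmul_eq_mul, ← sum_const]
    refine sum_congr rfl fun q hq => ?_
    rw [Nat.mem_divisorsAntidiagonal] at hq
    rw [hf, hf, ← hq.1, Nat.cast_mul, mul_inv]
  simp only [h1] at h
  rw [h]
  have h0 : 0 ≤ L := by linarith [Real.log_natCast_nonneg A]
  calc ∑ n ∈ Ioc 0 A, f n * ∑ m ∈ Ioc 0 (A / n), f m
      ≤ ∑ n ∈ Ioc 0 A, f n * L := by
        refine sum_le_sum fun n _ => ?_
        refine mul_le_mul_of_nonneg_left ?_ (by rw [hf]; positivity)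
        refine le_trans ?_ (sum_inv_le_one_add_log A hL)
        refine sum_le_sum_of_subset_of_nonneg (Ioc_subset_Ioc_right (Nat.div_le_self _ _)) ?_
        intro i _ _
        rw [hf]
        positivity
    _ = (∑ n ∈ Ioc 0 A, (n : ℝ)⁻¹) * L := by rw [sum_mul]; rfl
    _ ≤ L * L := by gcongr; exact sum_inv_le_one_add_log A hL
    _ = L ^ 2 := by ring

theorem card_divisors_mul_le (m n : ℕ) :
    (m * n).divisors.card ≤ m.divisors.card * n.divisors.card := by
  rw [Nat.divisors_mul]
  exact card_mul_le

theorem sum_card_divisors_sq_le (A : ℕ) {L : ℝ} (hL : 1 + Real.log A ≤ L) :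
    ∑ n ∈ Ioc 0 A, (n.divisors.card : ℝ) ^ 2 ≤ A * L ^ 3 := by
  let f : ArithmeticFunction ℝ := ⟨fun n => (n.divisors.card : ℝ), by simp⟩
  have hf : ∀ n, f n = (n.divisors.card : ℝ) := fun n => rfl
  have h1 : ∀ n, (n.divisors.card : ℝ) ^ 2 ≤ (f * f) n := by
    intro n
    rw [ArithmeticFunction.mul_apply]
    calc (n.divisors.card : ℝ) ^ 2 = ∑ q ∈ n.divisorsAntidiagonal, (n.divisors.card : ℝ) := by
          rw [sum_const, card_divisorsAntidiagonal, nsmul_eq_mul, sq]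
      _ ≤ _ := by
          refine sum_le_sum fun q hq => ?_
          rw [Nat.mem_divisorsAntidiagonal] at hq
          rw [hf, hf, ← hq.1]
          exact_mod_cast card_divisors_mul_le q.1 q.2
  have h0 : 0 ≤ L := by linarith [Real.log_natCast_nonneg A]
  refine (sum_le_sum fun n _ => h1 n).trans ?_
  rw [ArithmeticFunction.sum_Ioc_mul_eq_sum_sum]
  calc ∑ n ∈ Ioc 0 A, f n * ∑ m ∈ Ioc 0 (A / n), f m
      ≤ ∑ n ∈ Ioc 0 A, f n * ((A : ℝ) * (n : ℝ)⁻¹ * L) := by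
        refine sum_le_sum fun n hn => ?_
        refine mul_le_mul_of_nonneg_left ?_ (by rw [hf]; positivity)
        refine (sum_card_divisors_le (A / n) (L := L) ?_).trans ?_
        · refine le_trans ?_ hL
          rcases Nat.eq_zero_or_pos (A / n) with h | h
          · rw [h]
            have := Real.log_natCast_nonneg A
            simpa using this
          · have : ((A / n : ℕ) : ℝ) ≤ A := by exact_mod_cast Nat.div_le_self _ _
            gcongr
        · gcongr
          rw [← div_eq_mul_inv]
          exact Nat.cast_div_le
    _ = (A * L) * ∑ n ∈ Ioc 0 A, (n.divisors.card : ℝ) * (n : ℝ)⁻¹ := by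
        rw [mul_sum]
        refine sum_congr rfl fun n _ => ?_
        rw [hf]; ring
    _ ≤ (A * L) * L ^ 2 := by gcongr; exact sum_card_divisors_div_le A hL
    _ = A * L ^ 3 := by ring

theorem one_add_log_rpow_le {δ s : ℝ} (hδ : 0 < δ) (hs : 0 < s) :
    ∃ K : ℝ, 0 < K ∧ ∀ x : ℝ, 1 ≤ x → (1 + Real.log x) ^ s ≤ K * x ^ δ := by
  refine ⟨(1 + (δ / s)⁻¹) ^ s, by positivity, fun x hx => ?_⟩
  have h := Real.log_le_rpow_div (x := x) (by linarith) (div_pos hδ hs)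
  have h1 : 1 ≤ x ^ (δ / s) := Real.one_le_rpow hx (by positivity)
  have h2 : 1 + Real.log x ≤ (1 + (δ / s)⁻¹) * x ^ (δ / s) := by
    rw [div_eq_mul_inv] at h
    nlinarith
  have h3 := Real.log_nonneg hx
  calc (1 + Real.log x) ^ s ≤ ((1 + (δ / s)⁻¹) * x ^ (δ / s)) ^ s := by gcongr
    _ = (1 + (δ / s)⁻¹) ^ s * x ^ δ := by
      rw [Real.mul_rpow (by positivity) (by positivity), ← Real.rpow_mul (by linarith),
        div_mul_cancel₀ _ hs.ne']

theorem abs_card_modEq_sub_le (k : ℕ) (hk : 0 < k) (c : ℤ) (R : ℕ) :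
    |(#{u ∈ Ioc 0 R | ((u : ℕ) : ℤ) ≡ c [ZMOD (k : ℤ)]} : ℝ) - R / k| ≤ 1 := by
  have h1 : #{u ∈ Ioc 0 R | ((u : ℕ) : ℤ) ≡ c [ZMOD (k : ℤ)]}
      = #{u ∈ Ioc (0 : ℤ) R | u ≡ c [ZMOD (k : ℤ)]} := by
    rw [← card_map (Nat.castEmbedding : ℕ ↪ ℤ)]
    congr 1
    ext z
    simp only [mem_map, mem_filter, mem_Ioc, Nat.castEmbedding_apply]
    constructor
    · rintro ⟨u, ⟨⟨h, h'⟩, h''⟩, rfl⟩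
      exact ⟨⟨by exact_mod_cast h, by exact_mod_cast h'⟩, h''⟩
    · rintro ⟨⟨h, h'⟩, h''⟩
      lift z to ℕ using h.le
      exact ⟨z, ⟨⟨by exact_mod_cast h, by exact_mod_cast h'⟩, h''⟩, rfl⟩
  have h2 := Int.Ioc_filter_modEq_card 0 R (r := (k : ℤ)) (by exact_mod_cast hk) c
  rw [← h1] at h2
  have hkq : (0 : ℚ) < k := by exact_mod_cast hk
  set s : ℚ := (((R : ℤ) : ℚ) - c) / ((k : ℤ) : ℚ) with hs
  set t : ℚ := (((0 : ℤ) : ℚ) - c) / ((k : ℤ) : ℚ) with ht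
  have hst : s - t = R / k := by rw [hs, ht]; push_cast; ring
  have hst' : t ≤ s := by
    have : (0 : ℚ) ≤ R / k := by positivity
    linarith
  rw [max_eq_left (by have := Int.floor_le_floor hst'; omega)] at h2
  have key : |(#{u ∈ Ioc 0 R | ((u : ℕ) : ℤ) ≡ c [ZMOD (k : ℤ)]} : ℚ) - R / k| ≤ 1 := by
    have h3 : (#{u ∈ Ioc 0 R | ((u : ℕ) : ℤ) ≡ c [ZMOD (k : ℤ)]} : ℚ) = (⌊s⌋ : ℚ) - ⌊t⌋ := by
      exact_mod_cast h2
    rw [h3, ← hst, abs_le]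
    have := Int.floor_le s
    have := Int.floor_le t
    have := Int.lt_floor_add_one s
    have := Int.lt_floor_add_one t
    constructor <;> linarith
  have key' : (((|(#{u ∈ Ioc 0 R | ((u : ℕ) : ℤ) ≡ c [ZMOD (k : ℤ)]} : ℚ) - R / k| : ℚ)) : ℝ)
      ≤ ((1 : ℚ) : ℝ) := by exact_mod_cast key
  push_cast at key'
  exact key'

theorem mul_modEq_iff_of_mul_modEq_one {k : ℕ} {v : ℕ} {w : ℤ}
    (hw : (v : ℤ) * w ≡ 1 [ZMOD (k : ℤ)]) (e : ℤ) (u : ℕ) :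
    ((u * v : ℕ) : ℤ) ≡ e [ZMOD (k : ℤ)] ↔ (u : ℤ) ≡ e * w [ZMOD (k : ℤ)] := by
  refine ⟨fun h => ?_, fun h => ?_⟩
  · refine Int.ModEq.trans ?_ (h.mul_right w)
    push_cast
    have h2 := (hw.mul_left (u : ℤ)).symm
    rwa [mul_one, ← mul_assoc] at h2
  · push_cast
    refine (h.mul_right (v : ℤ)).trans ?_
    have h2 := hw.mul_left e
    rw [mul_one] at h2
    convert h2 using 1
    ring

theorem coprime_of_mul_modEq {k : ℕ} {e : ℤ} (he : Int.gcd e k = 1) {u v : ℕ}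
    (h : ((u * v : ℕ) : ℤ) ≡ e [ZMOD (k : ℤ)]) : Nat.Coprime v k := by
  have h1 : Int.gcd ((u * v : ℕ) : ℤ) k = 1 := by
    rw [← Int.isCoprime_iff_gcd_eq_one] at he ⊢
    obtain ⟨t, ht⟩ := h.symm.dvd
    rw [sub_eq_iff_eq_add'.1 ht]
    exact he.add_mul_left_left t
  rw [Int.gcd_natCast_natCast] at h1
  exact Nat.Coprime.coprime_mul_left h1

theorem card_mul_modEq_le (k : ℕ) (hk : 0 < k) {e : ℤ} (he : Int.gcd e k = 1) (v R : ℕ) :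
    (#{u ∈ Ioc 0 R | ((u * v : ℕ) : ℤ) ≡ e [ZMOD (k : ℤ)]} : ℝ) ≤ R / k + 1 := by
  by_cases hv : Nat.Coprime v k
  · obtain ⟨w, hw⟩ := Int.mod_coprime hv
    simp only [mul_modEq_iff_of_mul_modEq_one hw]
    have := (abs_le.1 (abs_card_modEq_sub_le k hk (e * w) R)).2
    linarith
  · rw [filter_false_of_mem fun u _ h => hv (coprime_of_mul_modEq he h)]
    simp only [card_empty, Nat.cast_zero]
    positivity

theorem sum_sq_sum_modEq_le (k : ℕ) (hk : 0 < k) {e : ℤ} (he : Int.gcd e k = 1) (A B : ℕ)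
    (β : ℕ → ℝ) :
    ∑ u ∈ Ioc 0 A, (∑ v ∈ Ioc 0 B with ((u * v : ℕ) : ℤ) ≡ e [ZMOD (k : ℤ)], β v) ^ 2
      ≤ (A / k + 1) * (B / k + 1) * ∑ v ∈ Ioc 0 B, β v ^ 2 := by
  calc ∑ u ∈ Ioc 0 A, (∑ v ∈ Ioc 0 B with ((u * v : ℕ) : ℤ) ≡ e [ZMOD (k : ℤ)], β v) ^ 2
      ≤ ∑ u ∈ Ioc 0 A, ((B : ℝ) / k + 1) *
          ∑ v ∈ Ioc 0 B with ((u * v : ℕ) : ℤ) ≡ e [ZMOD (k : ℤ)], β v ^ 2 := by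
        refine sum_le_sum fun u _ => sq_sum_le_card_mul_sum_sq.trans ?_
        refine mul_le_mul_of_nonneg_right ?_ (sum_nonneg fun _ _ => sq_nonneg _)
        simp only [mul_comm u]
        exact card_mul_modEq_le k hk he u B
    _ = ((B : ℝ) / k + 1) * ∑ v ∈ Ioc 0 B,
          (#{u ∈ Ioc 0 A | ((u * v : ℕ) : ℤ) ≡ e [ZMOD (k : ℤ)]} : ℝ) * β v ^ 2 := by
        rw [← mul_sum]
        congr 1
        simp only [sum_filter]
        rw [sum_comm]
        refine sum_congr rfl fun v _ => ?_
        rw [← sum_filter, sum_const, nsmul_eq_mul]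
    _ ≤ ((B : ℝ) / k + 1) * ∑ v ∈ Ioc 0 B, ((A : ℝ) / k + 1) * β v ^ 2 := by
        gcongr with v
        exact card_mul_modEq_le k hk he v A
    _ = (A / k + 1) * (B / k + 1) * ∑ v ∈ Ioc 0 B, β v ^ 2 := by
        rw [← mul_sum]; ring

/-- The indicator of `e` modulo `p ^ N` minus its average over the lifts of `e` modulo `p`. -/
noncomputable def residueDiscrepancy (p N : ℕ) (e : ℤ) (k : ℕ) : ℝ :=
  (if (k : ℤ) ≡ e [ZMOD ((p ^ N : ℕ) : ℤ)] then 1 else 0)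
    - ((p : ℝ) ^ (N - 1))⁻¹ * (if (k : ℤ) ≡ e [ZMOD (p : ℤ)] then 1 else 0)

theorem modEq_of_modEq_pow {p N : ℕ} (hN : N ≠ 0) {a b : ℤ}
    (h : a ≡ b [ZMOD ((p ^ N : ℕ) : ℤ)]) : a ≡ b [ZMOD (p : ℤ)] :=
  h.of_dvd (by exact_mod_cast dvd_pow_self p hN)

theorem residueDiscrepancy_eq_zero {p N : ℕ} (hN : N ≠ 0) {e : ℤ} (he : Int.gcd e p = 1)
    (u v : ℕ) (hv : ¬ Nat.Coprime v p) : residueDiscrepancy p N e (u * v) = 0 := by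
  have h : ¬ ((u * v : ℕ) : ℤ) ≡ e [ZMOD (p : ℤ)] := fun h => hv (coprime_of_mul_modEq he h)
  have h' : ¬ ((u * v : ℕ) : ℤ) ≡ e [ZMOD ((p ^ N : ℕ) : ℤ)] := fun h' =>
    h (modEq_of_modEq_pow hN h')
  rw [residueDiscrepancy, if_neg h, if_neg h']
  simp

theorem exists_residueDiscrepancy_mul_eq {p N : ℕ} (hN : N ≠ 0) (e : ℤ)
    (v : ℕ) (hv : Nat.Coprime v p) :
    ∃ a : ℤ, ∀ u, residueDiscrepancy p N e (u * v) = residueDiscrepancy p N a u := by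
  obtain ⟨w, hw⟩ := Int.mod_coprime (hv.pow_right N)
  refine ⟨e * w, fun u => ?_⟩
  simp only [residueDiscrepancy, mul_modEq_iff_of_mul_modEq_one hw,
    mul_modEq_iff_of_mul_modEq_one (modEq_of_modEq_pow hN hw)]

theorem abs_sum_ite_mul_ite_sub_le {k l : ℕ} (hk : 0 < k) (hl : 0 < l) (hkl : Nat.Coprime k l)
    (a b : ℤ) (R : ℕ) :
    |∑ u ∈ Ioc 0 R, (if (u : ℤ) ≡ a [ZMOD (k : ℤ)] then (1 : ℝ) else 0) *
      (if (u : ℤ) ≡ b [ZMOD (l : ℤ)] then (1 : ℝ) else 0) - R / (k * l)| ≤ 1 := by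
  obtain ⟨c, hc⟩ : ∃ c : ℤ, c ≡ a [ZMOD (k : ℤ)] ∧ c ≡ b [ZMOD (l : ℤ)] := by
    obtain ⟨w, hw⟩ := Int.mod_coprime hkl
    refine ⟨a + k * w * (b - a), ?_, ?_⟩
    · rw [Int.modEq_iff_dvd]
      exact ⟨- (w * (b - a)), by ring⟩
    · have := (hw.mul_right (b - a)).add_left a
      convert this using 1
      ring
  have h : ∀ u : ℕ, (if (u : ℤ) ≡ a [ZMOD (k : ℤ)] then (1 : ℝ) else 0) *
      (if (u : ℤ) ≡ b [ZMOD (l : ℤ)] then (1 : ℝ) else 0)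
      = if (u : ℤ) ≡ c [ZMOD ((k * l : ℕ) : ℤ)] then 1 else 0 := by
    intro u
    have : (u : ℤ) ≡ c [ZMOD ((k * l : ℕ) : ℤ)] ↔
        (u : ℤ) ≡ a [ZMOD (k : ℤ)] ∧ (u : ℤ) ≡ b [ZMOD (l : ℤ)] := by
      push_cast
      rw [← Int.modEq_and_modEq_iff_modEq_mul (by simpa using hkl)]
      exact and_congr ⟨fun h => h.trans hc.1, fun h => h.trans hc.1.symm⟩
        ⟨fun h => h.trans hc.2, fun h => h.trans hc.2.symm⟩
    simp only [this, ite_and]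
    split_ifs <;> simp
  simp only [h]
  rw [← sum_filter, sum_const, nsmul_eq_mul, mul_one]
  have := abs_card_modEq_sub_le (k * l) (Nat.mul_pos hk hl) c R
  push_cast at this ⊢
  exact this

theorem abs_sum_residueDiscrepancy_mul_le {p p' N N' : ℕ} (hp : p.Prime) (hp' : p'.Prime)
    (hne : p ≠ p') (hN : N ≠ 0) (hN' : N' ≠ 0) {e e' : ℤ} (he : Int.gcd e p = 1)
    (he' : Int.gcd e' p' = 1) (v v' R : ℕ) :
    |∑ u ∈ Ioc 0 R, residueDiscrepancy p N e (u * v) * residueDiscrepancy p' N' e' (u * v')|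
      ≤ 4 := by
  by_cases hv : Nat.Coprime v p
  swap
  · simp [residueDiscrepancy_eq_zero hN he _ v hv]
  by_cases hv' : Nat.Coprime v' p'
  swap
  · simp [residueDiscrepancy_eq_zero hN' he' _ v' hv']
  obtain ⟨a, ha⟩ := exists_residueDiscrepancy_mul_eq hN e v hv
  obtain ⟨b, hb⟩ := exists_residueDiscrepancy_mul_eq hN' e' v' hv'
  simp only [ha, hb]
  have hc : Nat.Coprime p p' := (Nat.coprime_primes hp hp').2 hne
  have hq : 0 < p ^ N := pow_pos hp.pos N
  have hq' : 0 < p' ^ N' := pow_pos hp'.pos N'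
  have h1 := abs_sum_ite_mul_ite_sub_le hq hq' (hc.pow N N') a b R
  have h2 := abs_sum_ite_mul_ite_sub_le hq hp'.pos (hc.pow_left N) a b R
  have h3 := abs_sum_ite_mul_ite_sub_le hp.pos hq' (hc.pow_right N') a b R
  have h4 := abs_sum_ite_mul_ite_sub_le hp.pos hp'.pos hc a b R
  have hpR : (0 : ℝ) < p := by exact_mod_cast hp.pos
  have hpR' : (0 : ℝ) < p' := by exact_mod_cast hp'.pos
  have hs : ∀ (p N : ℕ), p.Prime → 0 ≤ ((p : ℝ) ^ (N - 1))⁻¹ ∧ ((p : ℝ) ^ (N - 1))⁻¹ ≤ 1 := by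
    intro p N hp
    have : (1 : ℝ) ≤ p := by exact_mod_cast hp.one_lt.le
    exact ⟨by positivity, inv_le_one_of_one_le₀ (one_le_pow₀ this)⟩
  have hpow : ∀ (p N : ℕ), p.Prime → N ≠ 0 →
      (((p ^ N : ℕ) : ℝ))⁻¹ = ((p : ℝ) ^ (N - 1))⁻¹ * (p : ℝ)⁻¹ := by
    intro p N _ hN
    rw [← mul_inv, ← pow_succ, Nat.sub_add_cancel (Nat.pos_of_ne_zero hN)]
    push_cast; rfl
  obtain ⟨s0, s1⟩ := hs p N hp
  obtain ⟨t0, t1⟩ := hs p' N' hp'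
  have e1 := hpow p N hp hN
  have e2 := hpow p' N' hp' hN'
  rw [div_eq_mul_inv, mul_inv] at h1 h2 h3 h4
  rw [e1, e2] at h1
  rw [e1] at h2
  rw [e2] at h3
  simp only [residueDiscrepancy]
  set s := ((p : ℝ) ^ (N - 1))⁻¹
  set t := ((p' : ℝ) ^ (N' - 1))⁻¹
  set S1 := ∑ u ∈ Ioc 0 R, (if (u : ℤ) ≡ a [ZMOD ((p ^ N : ℕ) : ℤ)] then (1 : ℝ) else 0) *
      (if (u : ℤ) ≡ b [ZMOD ((p' ^ N' : ℕ) : ℤ)] then (1 : ℝ) else 0)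
  set S2 := ∑ u ∈ Ioc 0 R, (if (u : ℤ) ≡ a [ZMOD ((p ^ N : ℕ) : ℤ)] then (1 : ℝ) else 0) *
      (if (u : ℤ) ≡ b [ZMOD (p' : ℤ)] then (1 : ℝ) else 0)
  set S3 := ∑ u ∈ Ioc 0 R, (if (u : ℤ) ≡ a [ZMOD (p : ℤ)] then (1 : ℝ) else 0) *
      (if (u : ℤ) ≡ b [ZMOD ((p' ^ N' : ℕ) : ℤ)] then (1 : ℝ) else 0)
  set S4 := ∑ u ∈ Ioc 0 R, (if (u : ℤ) ≡ a [ZMOD (p : ℤ)] then (1 : ℝ) else 0) *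
      (if (u : ℤ) ≡ b [ZMOD (p' : ℤ)] then (1 : ℝ) else 0)
  have hS : ∀ F G F' G' : ℕ → ℝ, ∑ u ∈ Ioc 0 R, (F u - s * G u) * (F' u - t * G' u)
      = ∑ u ∈ Ioc 0 R, F u * F' u - t * ∑ u ∈ Ioc 0 R, F u * G' u
        - s * ∑ u ∈ Ioc 0 R, G u * F' u + s * t * ∑ u ∈ Ioc 0 R, G u * G' u := by
    intro F G F' G'
    simp only [mul_sum, ← sum_sub_distrib, ← sum_add_distrib]
    exact sum_congr rfl fun u _ => by ring
  rw [hS]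
  have h2' : |t * (S2 - R * (s * (p : ℝ)⁻¹ * (p' : ℝ)⁻¹))| ≤ 1 := by
    rw [abs_mul, abs_of_nonneg t0]
    exact mul_le_one₀ t1 (abs_nonneg _) h2
  have h3' : |s * (S3 - R * ((p : ℝ)⁻¹ * (t * (p' : ℝ)⁻¹)))| ≤ 1 := by
    rw [abs_mul, abs_of_nonneg s0]
    exact mul_le_one₀ s1 (abs_nonneg _) h3
  have h4' : |s * t * (S4 - R * ((p : ℝ)⁻¹ * (p' : ℝ)⁻¹))| ≤ 1 := by
    rw [abs_mul, abs_of_nonneg (mul_nonneg s0 t0)]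
    exact mul_le_one₀ (mul_le_one₀ s1 t0 t1) (abs_nonneg _) h4
  rw [abs_le] at *
  constructor <;> linarith

theorem sum_norm_sq_sum_mul_le {ι κ : Type*} (P : Finset ι) (U : Finset κ) (α : κ → ℂ)
    (T : ι → κ → ℂ) (D g : ℝ) (hD0 : 0 ≤ D) (hg0 : 0 ≤ g) (hD : ∀ p ∈ P, ∑ u ∈ U, ‖T p u‖ ^ 2 ≤ D)
    (hg : ∀ p ∈ P, ∀ p' ∈ P, p ≠ p' → ‖∑ u ∈ U, T p u * (starRingEnd ℂ) (T p' u)‖ ≤ g) :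
    ∑ p ∈ P, ‖∑ u ∈ U, α u * T p u‖ ^ 2 ≤ (∑ u ∈ U, ‖α u‖ ^ 2) * (D + #P * g) := by
  set S : ι → ℂ := fun p => ∑ u ∈ U, α u * T p u with hS
  set X : ℝ := ∑ p ∈ P, ‖S p‖ ^ 2 with hX
  set W : κ → ℂ := fun u => ∑ p ∈ P, (starRingEnd ℂ) (S p) * T p u with hW
  change X ≤ _
  have hX0 : 0 ≤ X := sum_nonneg fun _ _ => sq_nonneg _
  have h1 : (X : ℂ) = ∑ u ∈ U, α u * W u := by
    calc (X : ℂ) = ∑ p ∈ P, (starRingEnd ℂ) (S p) * S p := by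
          rw [hX]; push_cast
          exact sum_congr rfl fun p _ => (Complex.conj_mul' (S p)).symm
      _ = ∑ p ∈ P, ∑ u ∈ U, α u * ((starRingEnd ℂ) (S p) * T p u) := by
          refine sum_congr rfl fun p _ => ?_
          conv_lhs => rw [hS]
          rw [mul_sum]
          exact sum_congr rfl fun u _ => by ring
      _ = ∑ u ∈ U, α u * W u := by
          rw [sum_comm]
          exact sum_congr rfl fun u _ => by rw [hW, mul_sum]
  have h2 : X ^ 2 ≤ (∑ u ∈ U, ‖α u‖ ^ 2) * ∑ u ∈ U, ‖W u‖ ^ 2 := by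
    have h3 : X ≤ ∑ u ∈ U, ‖α u‖ * ‖W u‖ := by
      calc X = ‖(X : ℂ)‖ := by rw [Complex.norm_real, Real.norm_of_nonneg hX0]
        _ ≤ ∑ u ∈ U, ‖α u * W u‖ := by rw [h1]; exact norm_sum_le _ _
        _ = _ := by simp only [norm_mul]
    exact (pow_le_pow_left₀ hX0 h3 2).trans (sum_mul_sq_le_sq_mul_sq _ _ _)
  have h4 : ((∑ u ∈ U, ‖W u‖ ^ 2 : ℝ) : ℂ) = ∑ p ∈ P, ∑ p' ∈ P,
      ((starRingEnd ℂ) (S p) * S p') * ∑ u ∈ U, T p u * (starRingEnd ℂ) (T p' u) := by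
    calc ((∑ u ∈ U, ‖W u‖ ^ 2 : ℝ) : ℂ) = ∑ u ∈ U, W u * (starRingEnd ℂ) (W u) := by
          push_cast
          exact sum_congr rfl fun u _ => (Complex.mul_conj' (W u)).symm
      _ = ∑ u ∈ U, ∑ p ∈ P, ∑ p' ∈ P,
          ((starRingEnd ℂ) (S p) * S p') * (T p u * (starRingEnd ℂ) (T p' u)) := by
          refine sum_congr rfl fun u _ => ?_
          simp only [hW, map_sum, map_mul, Complex.conj_conj]
          rw [sum_mul_sum]
          exact sum_congr rfl fun p _ => sum_congr rfl fun p' _ => by ring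
      _ = _ := by
          rw [sum_comm]
          refine sum_congr rfl fun p _ => ?_
          rw [sum_comm]
          exact sum_congr rfl fun p' _ => (mul_sum _ _ _).symm
  have h5 : ∑ u ∈ U, ‖W u‖ ^ 2 ≤ X * (D + #P * g) := by
    calc ∑ u ∈ U, ‖W u‖ ^ 2 = ‖((∑ u ∈ U, ‖W u‖ ^ 2 : ℝ) : ℂ)‖ := by
          rw [Complex.norm_real, Real.norm_of_nonneg (sum_nonneg fun _ _ => sq_nonneg _)]
      _ ≤ ∑ p ∈ P, ∑ p' ∈ P, ‖((starRingEnd ℂ) (S p) * S p') *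
            ∑ u ∈ U, T p u * (starRingEnd ℂ) (T p' u)‖ := by
          rw [h4]
          exact (norm_sum_le _ _).trans (sum_le_sum fun p _ => norm_sum_le _ _)
      _ ≤ ∑ p ∈ P, ∑ p' ∈ P, ((if p = p' then ‖S p‖ ^ 2 * D else 0) +
            (‖S p‖ ^ 2 + ‖S p'‖ ^ 2) / 2 * g) := by
          refine sum_le_sum fun p hp => sum_le_sum fun p' hp' => ?_
          rw [norm_mul, norm_mul, Complex.norm_conj]
          split_ifs with h
          · subst h
            have h6 : ‖∑ u ∈ U, T p u * (starRingEnd ℂ) (T p u)‖ ≤ D := by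
              refine le_trans (norm_sum_le _ _) (le_trans (le_of_eq ?_) (hD p hp))
              refine sum_congr rfl fun u _ => ?_
              rw [norm_mul, Complex.norm_conj, sq]
            have h7 : 0 ≤ (‖S p‖ ^ 2 + ‖S p‖ ^ 2) / 2 * g := by positivity
            have := mul_le_mul_of_nonneg_left h6 (sq_nonneg ‖S p‖)
            nlinarith
          · rw [zero_add]
            refine mul_le_mul ?_ (hg p hp p' hp' h) (norm_nonneg _) (by positivity)
            nlinarith [sq_nonneg (‖S p‖ - ‖S p'‖)]
      _ = X * (D + #P * g) := by
          simp only [sum_add_distrib, sum_ite_eq, ← sum_mul, ← sum_div, sum_const, nsmul_eq_mul,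
            ← mul_sum]
          rw [← sum_filter, filter_true_of_mem fun _ h => h, ← sum_mul, ← hX]
          ring
  have hA : 0 ≤ ∑ u ∈ U, ‖α u‖ ^ 2 := sum_nonneg fun _ _ => sq_nonneg _
  rcases hX0.eq_or_lt with h | h
  · rw [← h]
    positivity
  · have h8 := h2.trans (mul_le_mul_of_nonneg_left h5 hA)
    refine le_of_mul_le_mul_left ?_ h
    linarith

theorem exists_filter_mul_le_eq_Ioc (A v v' : ℕ) (hv : 0 < v) (hv' : 0 < v') {y y' : ℝ}
    (hy : 0 ≤ y) (hy' : 0 ≤ y') :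
    ∃ R : ℕ, (Ioc 0 A).filter (fun u : ℕ => (u : ℝ) * v ≤ y ∧ (u : ℝ) * v' ≤ y') = Ioc 0 R := by
  refine ⟨min A (min ⌊y / v⌋₊ ⌊y' / v'⌋₊), ?_⟩
  ext u
  have h1 : (0 : ℝ) < v := by exact_mod_cast hv
  have h2 : (0 : ℝ) < v' := by exact_mod_cast hv'
  simp only [mem_filter, mem_Ioc, le_min_iff, Nat.le_floor_iff (div_nonneg hy h1.le),
    Nat.le_floor_iff (div_nonneg hy' h2.le), le_div_iff₀ h1, le_div_iff₀ h2]
  tauto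

theorem sum_norm_sq_sum_residueDiscrepancy_le {p N : ℕ} (hp : p.Prime) (hN : N ≠ 0) {e : ℤ}
    (he : Int.gcd e p = 1) {Q : ℝ} (hQ : 0 < Q) (hpQ : Q ≤ (p : ℝ) ^ N) (y : ℝ) (A B : ℕ)
    (β : ℕ → ℂ) :
    ∑ u ∈ Ioc 0 A, ‖∑ v ∈ Ioc 0 B, if (u : ℝ) * v ≤ y then
        β v * (residueDiscrepancy p N e (u * v) : ℂ) else 0‖ ^ 2
      ≤ 4 * (A / Q + 1) * (B / Q + 1) * ∑ v ∈ Ioc 0 B, ‖β v‖ ^ 2 := by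
  have hp1 : (1 : ℝ) ≤ p := by exact_mod_cast hp.one_lt.le
  set s : ℝ := ((p : ℝ) ^ (N - 1))⁻¹ with hs
  have s0 : 0 ≤ s := by positivity
  have s1 : s ≤ 1 := inv_le_one_of_one_le₀ (one_le_pow₀ hp1)
  set q : ℝ := (p : ℝ) ^ N with hq
  have hq0 : 0 < q := by positivity
  have hqc : ((p ^ N : ℕ) : ℝ) = q := by rw [hq]; push_cast; rfl
  have hsq : s / p = 1 / q := by
    rw [hs, hq]
    obtain ⟨k, rfl⟩ := Nat.exists_eq_succ_of_ne_zero hN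
    simp only [Nat.succ_sub_one, Nat.succ_eq_add_one, pow_succ]
    field_simp
  set V1 : ℕ → ℝ := fun u =>
    ∑ v ∈ Ioc 0 B with ((u * v : ℕ) : ℤ) ≡ e [ZMOD ((p ^ N : ℕ) : ℤ)], ‖β v‖ with hV1
  set V2 : ℕ → ℝ := fun u =>
    ∑ v ∈ Ioc 0 B with ((u * v : ℕ) : ℤ) ≡ e [ZMOD (p : ℤ)], ‖β v‖ with hV2
  have hgN : Int.gcd e ((p ^ N : ℕ) : ℤ) = 1 := by
    rw [← Int.isCoprime_iff_gcd_eq_one] at he ⊢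
    push_cast
    exact he.pow_right
  have hm1 := sum_sq_sum_modEq_le (p ^ N) (pow_pos hp.pos N) hgN A B (fun v => ‖β v‖)
  have hm2 := sum_sq_sum_modEq_le p hp.pos he A B (fun v => ‖β v‖)
  set Z := ∑ v ∈ Ioc 0 B, ‖β v‖ ^ 2 with hZ
  have hZ0 : 0 ≤ Z := sum_nonneg fun _ _ => sq_nonneg _
  have hpt : ∀ u : ℕ, ‖∑ v ∈ Ioc 0 B, if (u : ℝ) * v ≤ y then
        β v * (residueDiscrepancy p N e (u * v) : ℂ) else 0‖ ^ 2
        ≤ 2 * V1 u ^ 2 + 2 * s ^ 2 * V2 u ^ 2 := by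
    intro u
    have h1 : ‖∑ v ∈ Ioc 0 B, if (u : ℝ) * v ≤ y then
        β v * (residueDiscrepancy p N e (u * v) : ℂ) else 0‖ ≤ V1 u + s * V2 u := by
      calc _ ≤ ∑ v ∈ Ioc 0 B, ‖β v‖ * |residueDiscrepancy p N e (u * v)| := by
            refine (norm_sum_le _ _).trans (sum_le_sum fun v _ => ?_)
            split_ifs
            · rw [norm_mul, Complex.norm_real, Real.norm_eq_abs]
            · rw [norm_zero]; positivity
        _ ≤ ∑ v ∈ Ioc 0 B,
              ((if ((u * v : ℕ) : ℤ) ≡ e [ZMOD ((p ^ N : ℕ) : ℤ)] then ‖β v‖ else 0)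
              + s * (if ((u * v : ℕ) : ℤ) ≡ e [ZMOD (p : ℤ)] then ‖β v‖ else 0)) := by
            refine sum_le_sum fun v _ => ?_
            have h2 : |residueDiscrepancy p N e (u * v)| ≤
                (if ((u * v : ℕ) : ℤ) ≡ e [ZMOD ((p ^ N : ℕ) : ℤ)] then 1 else 0)
                + s * (if ((u * v : ℕ) : ℤ) ≡ e [ZMOD (p : ℤ)] then 1 else 0) := by
              rw [residueDiscrepancy, ← hs, abs_le]
              split_ifs <;> constructor <;> linarith
            refine (mul_le_mul_of_nonneg_left h2 (norm_nonneg _)).trans (le_of_eq ?_)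
            split_ifs <;> ring
        _ = _ := by
            rw [sum_add_distrib, ← mul_sum, hV1, hV2]
            simp only [sum_filter]
    have h3 := pow_le_pow_left₀ (norm_nonneg _) h1 2
    nlinarith [sq_nonneg (V1 u - s * V2 u)]
  calc _ ≤ ∑ u ∈ Ioc 0 A, (2 * V1 u ^ 2 + 2 * s ^ 2 * V2 u ^ 2) := sum_le_sum fun u _ => hpt u
    _ = 2 * ∑ u ∈ Ioc 0 A, V1 u ^ 2 + 2 * s ^ 2 * ∑ u ∈ Ioc 0 A, V2 u ^ 2 := by
        rw [sum_add_distrib, mul_sum, mul_sum]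
    _ ≤ 2 * ((A / q + 1) * (B / q + 1) * Z)
          + 2 * s ^ 2 * ((A / p + 1) * (B / p + 1) * Z) := by
        rw [hqc] at hm1
        gcongr
    _ = 2 * ((A / q + 1) * (B / q + 1) * Z)
          + 2 * ((A * (s / p) + s) * (B * (s / p) + s) * Z) := by ring
    _ ≤ 2 * ((A / q + 1) * (B / q + 1) * Z)
          + 2 * ((A * (s / p) + 1) * (B * (s / p) + 1) * Z) := by
        gcongr
    _ = 4 * (A / q + 1) * (B / q + 1) * Z := by rw [hsq]; ring
    _ ≤ 4 * (A / Q + 1) * (B / Q + 1) * Z := by gcongr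

theorem sum_norm_sq_bilinear_le (P : Finset ℕ) (N : ℕ → ℕ) (e : ℕ → ℤ) (y : ℕ → ℝ) {Q : ℝ}
    (hQ : 0 < Q)
    (hP : ∀ p ∈ P, p.Prime ∧ N p ≠ 0 ∧ Int.gcd (e p) p = 1 ∧ Q ≤ (p : ℝ) ^ N p ∧ 0 ≤ y p)
    (A B : ℕ) (α β : ℕ → ℂ) :
    ∑ p ∈ P, ‖∑ u ∈ Ioc 0 A, ∑ v ∈ Ioc 0 B, if (u : ℝ) * v ≤ y p then
        α u * β v * (residueDiscrepancy p (N p) (e p) (u * v) : ℂ) else 0‖ ^ 2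
      ≤ (∑ u ∈ Ioc 0 A, ‖α u‖ ^ 2) * (4 * (A / Q + 1) * (B / Q + 1) * ∑ v ∈ Ioc 0 B, ‖β v‖ ^ 2
          + #P * (4 * (∑ v ∈ Ioc 0 B, ‖β v‖) ^ 2)) := by
  have key := sum_norm_sq_sum_mul_le P (Ioc 0 A) α
    (fun p u => ∑ v ∈ Ioc 0 B, if (u : ℝ) * v ≤ y p then
        β v * (residueDiscrepancy p (N p) (e p) (u * v) : ℂ) else 0)
    (4 * (A / Q + 1) * (B / Q + 1) * ∑ v ∈ Ioc 0 B, ‖β v‖ ^ 2)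
    (4 * (∑ v ∈ Ioc 0 B, ‖β v‖) ^ 2) (by positivity) (by positivity) ?_ ?_
  · refine le_trans (le_of_eq ?_) key
    refine sum_congr rfl fun p _ => ?_
    congr 2
    refine sum_congr rfl fun u _ => ?_
    rw [mul_sum]
    refine sum_congr rfl fun v _ => ?_
    split_ifs <;> ring
  · intro p hp
    obtain ⟨h1, h2, h3, h4, h5⟩ := hP p hp
    exact sum_norm_sq_sum_residueDiscrepancy_le h1 h2 h3 hQ h4 (y p) A B β
  · intro p hp p' hp' hne
    obtain ⟨h1, h2, h3, h4, h5⟩ := hP p hp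
    obtain ⟨h1', h2', h3', h4', h5'⟩ := hP p' hp'
    have h6 : ∑ u ∈ Ioc 0 A, (∑ v ∈ Ioc 0 B, if (u : ℝ) * v ≤ y p then
          β v * (residueDiscrepancy p (N p) (e p) (u * v) : ℂ) else 0) *
        (starRingEnd ℂ) (∑ v ∈ Ioc 0 B, if (u : ℝ) * v ≤ y p' then
          β v * (residueDiscrepancy p' (N p') (e p') (u * v) : ℂ) else 0)
        = ∑ v ∈ Ioc 0 B, ∑ v' ∈ Ioc 0 B, β v * (starRingEnd ℂ) (β v') *
          ((∑ u ∈ (Ioc 0 A).filter (fun u : ℕ => (u : ℝ) * v ≤ y p ∧ (u : ℝ) * v' ≤ y p'),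
            residueDiscrepancy p (N p) (e p) (u * v) *
              residueDiscrepancy p' (N p') (e p') (u * v') : ℝ) : ℂ) := by
      simp only [map_sum, sum_mul_sum]
      rw [sum_comm]
      refine sum_congr rfl fun v _ => ?_
      rw [sum_comm]
      refine sum_congr rfl fun v' _ => ?_
      rw [sum_filter]
      push_cast
      rw [mul_sum]
      refine sum_congr rfl fun u _ => ?_
      simp only [ite_and, apply_ite (starRingEnd ℂ), apply_ite Complex.ofReal, map_mul, map_zero,
        Complex.conj_ofReal, Complex.ofReal_mul, Complex.ofReal_zero]
      split_ifs <;> ring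
    rw [h6]
    calc _ ≤ ∑ v ∈ Ioc 0 B, ∑ v' ∈ Ioc 0 B, ‖β v‖ * ‖β v'‖ * 4 := by
          refine (norm_sum_le _ _).trans (sum_le_sum fun v hv => ?_)
          refine (norm_sum_le _ _).trans (sum_le_sum fun v' hv' => ?_)
          rw [norm_mul, norm_mul, Complex.norm_conj, Complex.norm_real, Real.norm_eq_abs]
          obtain ⟨R, hR⟩ := exists_filter_mul_le_eq_Ioc A v v' (mem_Ioc.1 hv).1 (mem_Ioc.1 hv').1
            h5 h5'
          rw [hR]
          gcongr
          exact abs_sum_residueDiscrepancy_mul_le h1 h1' hne h2 h2' h3 h3' v v' R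
      _ = 4 * (∑ v ∈ Ioc 0 B, ‖β v‖) ^ 2 := by
          rw [sq, sum_mul_sum, mul_sum]
          refine sum_congr rfl fun v _ => ?_
          rw [mul_sum]
          exact sum_congr rfl fun v' _ => by ring

theorem sum_norm_sq_bilinear_le_of_le (P : Finset ℕ) (N : ℕ → ℕ) (e : ℕ → ℤ) (y : ℕ → ℝ)
    {Q x W : ℝ} (hQ : 0 < Q) (hx : 1 ≤ x) (hW : W ≤ x) (hQW : Q * √x ≤ W)
    (hP : ∀ p ∈ P, p.Prime ∧ N p ≠ 0 ∧ Int.gcd (e p) p = 1 ∧ Q ≤ (p : ℝ) ^ N p ∧ 0 ≤ y p)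
    {A B : ℕ} {α β : ℕ → ℂ} (hα : ∀ n, ‖α n‖ ≤ (n.divisors.card : ℝ))
    (hβ : ∀ n, ‖β n‖ ≤ (n.divisors.card : ℝ)) (hA : (A : ℝ) ≤ W) (hBA : B ≤ A)
    (hAB : (A : ℝ) * B ≤ 2 * x) :
    ∑ p ∈ P, ‖∑ u ∈ Ioc 0 A, ∑ v ∈ Ioc 0 B, if (u : ℝ) * v ≤ y p then
        α u * β v * (residueDiscrepancy p (N p) (e p) (u * v) : ℂ) else 0‖ ^ 2
      ≤ 16 * (1 + Real.log x) ^ 6 * (Q⁻¹ ^ 2 * x ^ 2)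
        + (24 * (1 + Real.log x) ^ 6 + 16 * #P * (1 + Real.log x) ^ 5) * (Q⁻¹ * (x * W)) := by
  refine (sum_norm_sq_bilinear_le P N e y hQ hP A B α β).trans ?_
  set L := 1 + Real.log x with hLdef
  have hL0 : 0 ≤ L := by have := Real.log_nonneg hx; positivity
  have hBA' : (B : ℝ) ≤ A := by exact_mod_cast hBA
  have hlog : ∀ n : ℕ, (n : ℝ) ≤ x → 1 + Real.log n ≤ L := by
    intro n hn
    rcases Nat.eq_zero_or_pos n with rfl | h
    · simpa [hLdef] using Real.log_nonneg hx
    · have : (0 : ℝ) < n := by exact_mod_cast h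
      rw [hLdef]
      gcongr
  have hLA := hlog A (hA.trans hW)
  have hLB := hlog B (hBA'.trans (hA.trans hW))
  have h1 : ∑ u ∈ Ioc 0 A, ‖α u‖ ^ 2 ≤ A * L ^ 3 :=
    (sum_le_sum fun u _ => pow_le_pow_left₀ (norm_nonneg _) (hα u) 2).trans
      (sum_card_divisors_sq_le A hLA)
  have h2 : ∑ v ∈ Ioc 0 B, ‖β v‖ ^ 2 ≤ B * L ^ 3 :=
    (sum_le_sum fun u _ => pow_le_pow_left₀ (norm_nonneg _) (hβ u) 2).trans
      (sum_card_divisors_sq_le B hLB)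
  have h3 : ∑ v ∈ Ioc 0 B, ‖β v‖ ≤ B * L :=
    (sum_le_sum fun u _ => hβ u).trans (sum_card_divisors_le B hLB)
  have hs : √x ^ 2 = x := Real.sq_sqrt (by linarith)
  have hs1 : 1 ≤ √x := Real.one_le_sqrt.2 hx
  have hB : (B : ℝ) ≤ 2 * √x := by
    refine le_of_sq_le_sq ?_ (by positivity)
    nlinarith
  have hsW : √x ≤ Q⁻¹ * W := by
    rw [inv_mul_eq_div, le_div_iff₀ hQ, mul_comm]
    exact hQW
  have hxW : x ≤ Q⁻¹ * (x * W) := by nlinarith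
  calc (∑ u ∈ Ioc 0 A, ‖α u‖ ^ 2) * (4 * (A / Q + 1) * (B / Q + 1) * ∑ v ∈ Ioc 0 B, ‖β v‖ ^ 2
          + #P * (4 * (∑ v ∈ Ioc 0 B, ‖β v‖) ^ 2))
      ≤ (A * L ^ 3) * (4 * (A / Q + 1) * (B / Q + 1) * (B * L ^ 3)
          + #P * (4 * (B * L) ^ 2)) := by gcongr
    _ = 4 * L ^ 6 * (Q⁻¹ ^ 2 * (A * B) ^ 2 + Q⁻¹ * ((A * B) * (A + B)) + A * B)
          + 4 * #P * L ^ 5 * ((A * B) * B) := by ring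
    _ ≤ 4 * L ^ 6 * (Q⁻¹ ^ 2 * (2 * x) ^ 2 + Q⁻¹ * ((2 * x) * (W + W)) + 2 * (Q⁻¹ * (x * W)))
          + 4 * #P * L ^ 5 * ((2 * x) * (2 * (Q⁻¹ * W))) := by
        have hBW : (B : ℝ) ≤ W := hBA'.trans hA
        have hB2 : (B : ℝ) ≤ 2 * (Q⁻¹ * W) := by linarith
        have hAB2 : (A : ℝ) * B ≤ 2 * (Q⁻¹ * (x * W)) := by linarith
        have hAB0 : 0 ≤ (A : ℝ) * B := by positivity
        generalize (A : ℝ) * B = M at *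
        generalize 2 * (Q⁻¹ * (x * W)) = M' at *
        generalize 2 * (Q⁻¹ * W) = M'' at *
        gcongr
    _ = _ := by ring

theorem sum_norm_sq_bilinear_le_symm (P : Finset ℕ) (N : ℕ → ℕ) (e : ℕ → ℤ) (y : ℕ → ℝ)
    {Q x W : ℝ} (hQ : 0 < Q) (hx : 1 ≤ x) (hW : W ≤ x) (hQW : Q * √x ≤ W)
    (hP : ∀ p ∈ P, p.Prime ∧ N p ≠ 0 ∧ Int.gcd (e p) p = 1 ∧ Q ≤ (p : ℝ) ^ N p ∧ 0 ≤ y p)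
    {A B : ℕ} {α β : ℕ → ℂ} (hα : ∀ n, ‖α n‖ ≤ (n.divisors.card : ℝ))
    (hβ : ∀ n, ‖β n‖ ≤ (n.divisors.card : ℝ)) (hA : (A : ℝ) ≤ W) (hB : (B : ℝ) ≤ W)
    (hAB : (A : ℝ) * B ≤ 2 * x) :
    ∑ p ∈ P, ‖∑ u ∈ Ioc 0 A, ∑ v ∈ Ioc 0 B, if (u : ℝ) * v ≤ y p then
        α u * β v * (residueDiscrepancy p (N p) (e p) (u * v) : ℂ) else 0‖ ^ 2
      ≤ 16 * (1 + Real.log x) ^ 6 * (Q⁻¹ ^ 2 * x ^ 2)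
        + (24 * (1 + Real.log x) ^ 6 + 16 * #P * (1 + Real.log x) ^ 5) * (Q⁻¹ * (x * W)) := by
  rcases le_total B A with h | h
  · exact sum_norm_sq_bilinear_le_of_le P N e y hQ hx hW hQW hP hα hβ hA h hAB
  · refine le_trans (le_of_eq ?_) (sum_norm_sq_bilinear_le_of_le P N e y hQ hx hW hQW hP hβ hα
      hB h (by rw [mul_comm]; exact hAB))
    refine sum_congr rfl fun p _ => ?_
    rw [sum_comm]
    congr 2
    refine sum_congr rfl fun v _ => sum_congr rfl fun u _ => ?_
    rw [mul_comm (u : ℝ), mul_comm u v, mul_comm (α u)]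

/-- The part of `a` supported on the dyadic block `[2 ^ j, 2 ^ (j + 1))` above `z`. -/
noncomputable def dyadicPart (a : ℕ → ℂ) (z : ℝ) (j m : ℕ) : ℂ :=
  if Nat.log 2 m = j ∧ z < m then a m else 0

theorem sum_bilinear_eq_sum_dyadic (X : ℕ) {x y : ℝ} (hyx : y ≤ x) (a b : ℕ → ℂ) (z : ℝ)
    (f : ℕ → ℂ) :
    ∑ m ∈ Ioc 0 X with z < (m : ℕ), ∑ n ∈ Ioc 0 X,
        (if ((m : ℕ) : ℝ) * n ≤ y then a m * b n * f (m * n) else 0)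
      = ∑ j ∈ range (Nat.log 2 X + 1), ∑ u ∈ Ioc 0 (min (2 ^ (j + 1)) X),
          ∑ v ∈ Ioc 0 (min ⌊x / 2 ^ j⌋₊ X),
            if (u : ℝ) * v ≤ y then dyadicPart a z j u * b v * f (u * v) else 0 := by
  have h1 : ∀ j, ∑ u ∈ Ioc 0 (min (2 ^ (j + 1)) X), ∑ v ∈ Ioc 0 (min ⌊x / 2 ^ j⌋₊ X),
        (if (u : ℝ) * v ≤ y then dyadicPart a z j u * b v * f (u * v) else 0)
      = ∑ u ∈ Ioc 0 X, ∑ v ∈ Ioc 0 X,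
        if (u : ℝ) * v ≤ y then dyadicPart a z j u * b v * f (u * v) else 0 := by
    intro j
    have h2 : ∀ u ∈ Ioc 0 X, ∑ v ∈ Ioc 0 (min ⌊x / 2 ^ j⌋₊ X),
          (if (u : ℝ) * v ≤ y then dyadicPart a z j u * b v * f (u * v) else 0)
        = ∑ v ∈ Ioc 0 X,
          if (u : ℝ) * v ≤ y then dyadicPart a z j u * b v * f (u * v) else 0 := by
      intro u hu
      refine sum_subset (Ioc_subset_Ioc_right (min_le_right _ _)) fun v hv hv' => ?_
      split_ifs with h
      swap
      · rfl
      by_cases hj : Nat.log 2 u = j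
      swap
      · simp [dyadicPart, hj]
      exfalso
      refine hv' ?_
      rw [mem_Ioc] at hu hv ⊢
      refine ⟨hv.1, le_min (Nat.le_floor ?_) hv.2⟩
      rw [le_div_iff₀ (by positivity)]
      have h3 : ((2 ^ j : ℕ) : ℝ) ≤ u := by
        exact_mod_cast hj ▸ Nat.pow_log_le_self 2 hu.1.ne'
      push_cast at h3
      calc (v : ℝ) * 2 ^ j ≤ v * u := by gcongr
        _ ≤ x := by rw [mul_comm]; exact h.trans hyx
    rw [← sum_congr rfl h2]
    refine sum_subset (Ioc_subset_Ioc_right (min_le_right _ _)) fun u hu hu' => ?_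
    refine sum_eq_zero fun v _ => ?_
    have hj : Nat.log 2 u ≠ j := by
      rintro rfl
      refine hu' ?_
      rw [mem_Ioc] at hu ⊢
      exact ⟨hu.1, le_min (Nat.lt_pow_succ_log_self one_lt_two u).le hu.2⟩
    simp [dyadicPart, hj]
  simp only [h1]
  rw [sum_filter, sum_comm (s := range _)]
  refine sum_congr rfl fun u hu => ?_
  rw [sum_comm]
  have h4 : Nat.log 2 u < Nat.log 2 X + 1 :=
    Nat.lt_succ_of_le (Nat.log_mono_right (mem_Ioc.1 hu).2)
  have h5 : ∑ j ∈ range (Nat.log 2 X + 1), dyadicPart a z j u = if z < u then a u else 0 := by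
    simp only [dyadicPart, ite_and]
    rw [sum_ite_eq, if_pos (mem_range.2 h4)]
  have h6 : ∀ v : ℕ, ∑ j ∈ range (Nat.log 2 X + 1),
      (if (u : ℝ) * v ≤ y then dyadicPart a z j u * b v * f (u * v) else 0)
      = if (u : ℝ) * v ≤ y then (if z < u then a u else 0) * b v * f (u * v) else 0 := by
    intro v
    split_ifs <;> simp_all [← sum_mul]
  simp only [h6]
  split_ifs with h
  · rfl
  · simp

theorem natLog_add_one_le {x : ℝ} (hx : 1 ≤ x) {X : ℕ} (hX : (X : ℝ) ≤ x) :
    ((Nat.log 2 X + 1 : ℕ) : ℝ) ≤ 2 * (1 + Real.log x) := by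
  have hlx := Real.log_nonneg hx
  rcases Nat.eq_zero_or_pos X with rfl | h
  · simp only [Nat.log_zero_right]
    push_cast
    linarith
  have h1 : ((2 ^ Nat.log 2 X : ℕ) : ℝ) ≤ x :=
    le_trans (by exact_mod_cast Nat.pow_log_le_self 2 h.ne') hX
  push_cast at h1
  have h2 := Real.log_le_log (by positivity) h1
  rw [Real.log_pow] at h2
  have := Real.log_two_gt_d9
  have h3 : (0 : ℝ) ≤ Nat.log 2 X := by positivity
  push_cast
  nlinarith

theorem sum_eq_sum_residueDiscrepancy {p N : ℕ} (hN : N ≠ 0) {d e : ℤ}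
    (hd : Int.gcd d p = 1) (hed : e ≡ d [ZMOD (p : ℤ)]) {y z : ℝ} {X : ℕ} (hy : 0 ≤ y)
    (hX : ∀ m : ℕ, z < m → ⌊y / (m : ℝ)⌋₊ ≤ X) (a b : ℕ → ℂ) (mbar : ℕ → ℤ)
    (hm : ∀ m : ℕ, Nat.gcd m p = 1 → (m : ℤ) * mbar m ≡ 1 [ZMOD ((p : ℤ) ^ N)]) :
    ∑ m ∈ (Finset.Icc 1 X).filter (fun m : ℕ => z < (m : ℝ) ∧ Nat.gcd m p = 1),
        a m * ((∑ n ∈ (Finset.Icc 1 ⌊y / (m : ℝ)⌋₊).filter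
              (fun n : ℕ => (n : ℤ) ≡ e * mbar m [ZMOD ((p : ℤ) ^ N)]), b n)
          - ((((p : ℝ) ^ (N - 1))⁻¹ : ℝ) : ℂ) *
              ∑ n ∈ (Finset.Icc 1 ⌊y / (m : ℝ)⌋₊).filter
                (fun n : ℕ => (n : ℤ) ≡ d * mbar m [ZMOD (p : ℤ)]), b n)
      = ∑ m ∈ Ioc 0 X with z < (m : ℕ), ∑ n ∈ Ioc 0 X,
        (if ((m : ℕ) : ℝ) * n ≤ y then
          a m * b n * (residueDiscrepancy p N e (m * n) : ℂ) else 0) := by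
  have he : Int.gcd e p = 1 := by
    rw [← Int.isCoprime_iff_gcd_eq_one] at hd ⊢
    obtain ⟨t, ht⟩ := hed.dvd
    rw [sub_eq_iff_eq_add'.1 ht] at hd
    exact IsCoprime.of_add_mul_left_left hd
  have hIcc : ∀ n : ℕ, Icc 1 n = Ioc 0 n := fun n => rfl
  rw [hIcc, ← filter_filter, sum_filter (p := fun m => Nat.gcd m p = 1)]
  refine sum_congr rfl fun m hmem => ?_
  rw [mem_filter, mem_Ioc] at hmem
  obtain ⟨⟨hm0, hmX⟩, hzm⟩ := hmem
  have hm0' : (0 : ℝ) < m := by exact_mod_cast hm0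
  split_ifs with hg
  swap
  · refine (sum_eq_zero fun n _ => ?_).symm
    rw [mul_comm m n, residueDiscrepancy_eq_zero hN he n m hg]
    simp
  have h1 : (Ioc 0 X).filter (fun n : ℕ => (m : ℝ) * n ≤ y) = Ioc 0 ⌊y / (m : ℝ)⌋₊ := by
    ext n
    simp only [mem_filter, mem_Ioc, Nat.le_floor_iff (div_nonneg hy hm0'.le), le_div_iff₀ hm0']
    rw [mul_comm (m : ℝ)]
    refine ⟨fun h => ⟨h.1.1, h.2⟩, fun h => ⟨⟨h.1, le_trans ?_ (hX m hzm)⟩, h.2⟩⟩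
    rw [Nat.le_floor_iff (div_nonneg hy hm0'.le), le_div_iff₀ hm0']
    exact h.2
  rw [← sum_filter, h1, hIcc]
  have hw : (m : ℤ) * mbar m ≡ 1 [ZMOD ((p ^ N : ℕ) : ℤ)] := by
    push_cast
    exact hm m hg
  have h2 : ∀ n : ℕ, ((m * n : ℕ) : ℤ) ≡ e [ZMOD ((p ^ N : ℕ) : ℤ)] ↔
      (n : ℤ) ≡ e * mbar m [ZMOD ((p : ℤ) ^ N)] := by
    intro n
    rw [mul_comm m n, mul_modEq_iff_of_mul_modEq_one hw]
    push_cast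
    rfl
  have h3 : ∀ n : ℕ, ((m * n : ℕ) : ℤ) ≡ e [ZMOD (p : ℤ)] ↔
      (n : ℤ) ≡ d * mbar m [ZMOD (p : ℤ)] := by
    intro n
    rw [mul_comm m n, mul_modEq_iff_of_mul_modEq_one (modEq_of_modEq_pow hN hw)]
    have h4 := hed.mul_right (mbar m)
    exact ⟨fun h => h.trans h4, fun h => h.trans h4.symm⟩
  simp only [residueDiscrepancy, h2, h3]
  rw [sum_filter, sum_filter, mul_sum, ← sum_sub_distrib, mul_sum]
  refine sum_congr rfl fun n _ => ?_
  split_ifs <;> push_cast <;> ring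

theorem sum_norm_sq_sum_le {ι κ : Type*} (P : Finset ι) (J : Finset κ) (S : ι → κ → ℂ) {E : ℝ}
    (h : ∀ j ∈ J, ∑ p ∈ P, ‖S p j‖ ^ 2 ≤ E) :
    ∑ p ∈ P, ‖∑ j ∈ J, S p j‖ ^ 2 ≤ (#J : ℝ) ^ 2 * E := by
  calc ∑ p ∈ P, ‖∑ j ∈ J, S p j‖ ^ 2 ≤ ∑ p ∈ P, (#J : ℝ) * ∑ j ∈ J, ‖S p j‖ ^ 2 := by
        refine sum_le_sum fun p _ => ?_
        exact (pow_le_pow_left₀ (norm_nonneg _) (norm_sum_le _ _) 2).trans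
          sq_sum_le_card_mul_sum_sq
    _ = (#J : ℝ) * ∑ j ∈ J, ∑ p ∈ P, ‖S p j‖ ^ 2 := by rw [← mul_sum, sum_comm]
    _ ≤ (#J : ℝ) * (#J * E) := by
        gcongr
        refine (sum_le_sum h).trans ?_
        rw [sum_const, nsmul_eq_mul]
    _ = (#J : ℝ) ^ 2 * E := by ring

/-- **Type II estimate.** Fix `C ≥ 6` and `ε ∈ (0, 1/20)`. With an implied
constant depending only on `C` and `ε`: for `x^ε ≤ Q ≤ x^(1/4)`, a set `P` of
primes `p ≤ (log x)^C` with data `N_p ≥ 2`, `p^(N_p) ∈ (Q, 2Q]`, `2 ≤ y_p ≤ x`,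
`(d_p, p) = 1`, `e_p ≡ d_p (mod p)`, and divisor-bounded sequences `(a_m)`,
`(b_n)`, the type II sums `Σ_p` satisfy
`∑_{p∈P} |Σ_p|² ≪ Q⁻² x² (log x)^10 + x^(3/2) (log x)^10 + Q⁻¹ x^(7/4+4ε)`. -/
theorem type_II_estimate (C : ℝ) (hC : 6 ≤ C) (ε : ℝ) (hε : 0 < ε) (hε' : ε < 1 / 20) :
    ∃ K : ℝ, 0 < K ∧
      ∀ x : ℝ, 2 ≤ x → ∀ Q : ℝ, x ^ ε ≤ Q → Q ≤ x ^ ((1 : ℝ) / 4) →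
      ∀ P : Finset ℕ, (∀ p ∈ P, p.Prime ∧ (p : ℝ) ≤ Real.log x ^ C) →
      ∀ Nf : ℕ → ℕ, (∀ p ∈ P, 2 ≤ Nf p ∧ Q < (p : ℝ) ^ Nf p ∧ (p : ℝ) ^ Nf p ≤ 2 * Q) →
      ∀ yf : ℕ → ℝ, (∀ p ∈ P, 2 ≤ yf p ∧ yf p ≤ x) →
      ∀ df ef : ℕ → ℤ, (∀ p ∈ P, Int.gcd (df p) p = 1 ∧ ef p ≡ df p [ZMOD (p : ℤ)]) →
      ∀ a b : ℕ → ℂ, (∀ m, ‖a m‖ ≤ (m.divisors.card : ℝ)) →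
        (∀ n, ‖b n‖ ≤ (n.divisors.card : ℝ)) →
      ∀ mbar : ℕ → ℕ → ℤ, (∀ p ∈ P, ∀ m : ℕ, Nat.gcd m p = 1 →
        (m : ℤ) * mbar p m ≡ 1 [ZMOD ((p : ℤ) ^ Nf p)]) →
      (∑ p ∈ P,
        ‖∑ m ∈ (Finset.Icc 1 ⌊x ^ ((3 : ℝ) / 4)⌋₊).filter
              (fun m : ℕ => x ^ ((1 : ℝ) / 4) < (m : ℝ) ∧ Nat.gcd m p = 1),
            a m * ((∑ n ∈ (Finset.Icc 1 ⌊yf p / (m : ℝ)⌋₊).filter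
                  (fun n : ℕ => (n : ℤ) ≡ ef p * mbar p m [ZMOD ((p : ℤ) ^ Nf p)]), b n)
              - ((((p : ℝ) ^ (Nf p - 1))⁻¹ : ℝ) : ℂ) *
                  ∑ n ∈ (Finset.Icc 1 ⌊yf p / (m : ℝ)⌋₊).filter
                    (fun n : ℕ => (n : ℤ) ≡ df p * mbar p m [ZMOD (p : ℤ)]), b n)‖ ^ 2)
        ≤ K * (Q⁻¹ ^ 2 * x ^ 2 * Real.log x ^ 10 + x ^ ((3 : ℝ) / 2) * Real.log x ^ 10
            + Q⁻¹ * x ^ ((7 : ℝ) / 4 + 4 * ε)) := by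

  obtain ⟨K₁, hK₁, hlogK⟩ := one_add_log_rpow_le (δ := 4 * ε) (s := C + 8) (by linarith)
    (by linarith)
  refine ⟨1679616 + 160 * K₁, by positivity, ?_⟩
  intro x hx Q hQ1 hQ2 P hP Nf hN yf hy df ef hde a b ha hb mbar hmbar
  have hx0 : 0 < x := by linarith
  have hx1 : 1 ≤ x := by linarith
  have hQ : 0 < Q := (Real.rpow_pos_of_pos hx0 ε).trans_le hQ1
  set z := x ^ ((1 : ℝ) / 4) with hz
  set W := x ^ ((3 : ℝ) / 4) with hW
  have hz0 : 0 < z := Real.rpow_pos_of_pos hx0 _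
  have hW0 : 0 < W := Real.rpow_pos_of_pos hx0 _
  have hzW : z * W = x := by
    rw [hz, hW, ← Real.rpow_add hx0]
    norm_num
  have hWx : W ≤ x := by
    calc W ≤ x ^ (1 : ℝ) := Real.rpow_le_rpow_of_exponent_le hx1 (by norm_num)
      _ = x := Real.rpow_one x
  have hQW : Q * √x ≤ W := by
    calc Q * √x ≤ z * √x := by gcongr
      _ = W := by
        rw [Real.sqrt_eq_rpow, hz, hW, ← Real.rpow_add hx0]
        norm_num
  set X := ⌊W⌋₊ with hX
  have hXW : (X : ℝ) ≤ W := Nat.floor_le hW0.le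
  have hdata : ∀ p ∈ P, p.Prime ∧ Nf p ≠ 0 ∧ Int.gcd (ef p) p = 1 ∧ Q ≤ (p : ℝ) ^ Nf p ∧
      0 ≤ yf p := by
    intro p hp
    refine ⟨(hP p hp).1, by have := (hN p hp).1; omega, ?_, (hN p hp).2.1.le,
      by linarith [(hy p hp).1]⟩
    have hd := (hde p hp).1
    rw [← Int.isCoprime_iff_gcd_eq_one] at hd ⊢
    obtain ⟨t, ht⟩ := (hde p hp).2.dvd
    rw [sub_eq_iff_eq_add'.1 ht] at hd
    exact IsCoprime.of_add_mul_left_left hd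
  have hfloor : ∀ p ∈ P, ∀ m : ℕ, z < m → ⌊yf p / (m : ℝ)⌋₊ ≤ X := by
    intro p hp m hm
    refine Nat.floor_le_floor ?_
    rw [div_le_iff₀ (hz0.trans hm)]
    calc yf p ≤ x := (hy p hp).2
      _ = W * z := by rw [mul_comm, hzW]
      _ ≤ W * m := by gcongr
  have hα : ∀ j n, ‖dyadicPart a z j n‖ ≤ (n.divisors.card : ℝ) := by
    intro j n
    rw [dyadicPart]
    split_ifs
    · exact ha n
    · rw [norm_zero]; positivity
  have hmain := sum_norm_sq_sum_le P (range (Nat.log 2 X + 1))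
    (fun p j => ∑ u ∈ Ioc 0 (min (2 ^ (j + 1)) X), ∑ v ∈ Ioc 0 (min ⌊x / 2 ^ j⌋₊ X),
      if (u : ℝ) * v ≤ yf p then
        dyadicPart a z j u * b v * (residueDiscrepancy p (Nf p) (ef p) (u * v) : ℂ) else 0)
    (E := 16 * (1 + Real.log x) ^ 6 * (Q⁻¹ ^ 2 * x ^ 2)
        + (24 * (1 + Real.log x) ^ 6 + 16 * #P * (1 + Real.log x) ^ 5) * (Q⁻¹ * (x * W))) ?_
  swap
  · intro j _
    refine sum_norm_sq_bilinear_le_symm P Nf ef yf hQ hx1 hWx hQW hdata (hα j) hb ?_ ?_ ?_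
    · exact le_trans (by exact_mod_cast min_le_right _ _) hXW
    · exact le_trans (by exact_mod_cast min_le_right _ _) hXW
    · have h1 : ((min (2 ^ (j + 1)) X : ℕ) : ℝ) ≤ 2 ^ (j + 1) := by
        exact_mod_cast min_le_left _ _
      have h2 : ((min ⌊x / 2 ^ j⌋₊ X : ℕ) : ℝ) ≤ x / 2 ^ j :=
        le_trans (by exact_mod_cast min_le_left _ _) (Nat.floor_le (by positivity))
      calc _ ≤ (2 : ℝ) ^ (j + 1) * (x / 2 ^ j) := by gcongr
        _ = 2 * x := by rw [pow_succ]; field_simp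
  refine le_trans (le_of_eq (sum_congr rfl fun p hp => ?_)) (hmain.trans ?_)
  · rw [sum_eq_sum_residueDiscrepancy (hdata p hp).2.1 (hde p hp).1 (hde p hp).2
      (hdata p hp).2.2.2.2 (hfloor p hp) a b (mbar p) (hmbar p hp),
      sum_bilinear_eq_sum_dyadic X (hy p hp).2 a b z
        (fun k => (residueDiscrepancy p (Nf p) (ef p) k : ℂ))]
  have hJ := natLog_add_one_le hx1 (hXW.trans hWx)
  rw [card_range]
  set l := Real.log x with hl
  have hl2 : 1 / 2 ≤ l := by
    have h1 := Real.log_le_log two_pos hx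
    have h2 := Real.log_two_gt_d9
    linarith
  have hl0 : 0 ≤ l := by linarith
  have hcard : (#P : ℝ) ≤ (1 + l) ^ C := by
    have h1 : P ⊆ Ioc 0 ⌊l ^ C⌋₊ := fun p hp =>
      mem_Ioc.2 ⟨(hP p hp).1.pos, Nat.le_floor (hP p hp).2⟩
    have h2 : (#P : ℝ) ≤ ⌊l ^ C⌋₊ := by
      have := card_le_card h1
      rw [Nat.card_Ioc, Nat.sub_zero] at this
      exact_mod_cast this
    calc (#P : ℝ) ≤ l ^ C := h2.trans (Nat.floor_le (by positivity))
      _ ≤ (1 + l) ^ C := by gcongr; linarith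
  have hlogs : (4 * (1 + l) ^ 2) * (24 * (1 + l) ^ 6 + 16 * #P * (1 + l) ^ 5)
      ≤ 160 * K₁ * x ^ (4 * ε) := by
    have h1 : (1 + l) ^ C * (1 + l) ^ 8 = (1 + l) ^ (C + 8) := by
      rw [Real.rpow_add (by linarith)]
      norm_cast
    have h2 : 1 ≤ (1 + l) ^ C := Real.one_le_rpow (by linarith) (by linarith)
    calc (4 * (1 + l) ^ 2) * (24 * (1 + l) ^ 6 + 16 * #P * (1 + l) ^ 5)
        = 96 * (1 * (1 + l) ^ 8) + 64 * (#P * (1 + l) ^ 7) := by ring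
      _ ≤ 96 * ((1 + l) ^ C * (1 + l) ^ 8) + 64 * ((1 + l) ^ C * (1 + l) ^ 8) := by
          gcongr
          · linarith
          · norm_num
      _ = 160 * (1 + l) ^ (C + 8) := by rw [h1]; ring
      _ ≤ 160 * (K₁ * x ^ (4 * ε)) := by gcongr; exact hlogK x hx1
      _ = 160 * K₁ * x ^ (4 * ε) := by ring
  have hmainlog : 64 * (1 + l) ^ 8 ≤ 1679616 * l ^ 10 := by
    have h1 : 1 + l ≤ 3 * l := by linarith
    have h2 : 1 ≤ 4 * l ^ 2 := by nlinarith
    calc 64 * (1 + l) ^ 8 ≤ 64 * (3 * l) ^ 8 * 1 := by rw [mul_one]; gcongr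
      _ ≤ 64 * (3 * l) ^ 8 * (4 * l ^ 2) := by gcongr
      _ = 1679616 * l ^ 10 := by ring
  have hxW : x ^ (4 * ε) * (x * W) = x ^ ((7 : ℝ) / 4 + 4 * ε) := by
    rw [hW, ← Real.rpow_one_add' hx0.le (by norm_num), ← Real.rpow_add hx0]
    congr 1
    ring
  have hQi : 0 < Q⁻¹ := inv_pos.2 hQ
  set V := x ^ ((7 : ℝ) / 4 + 4 * ε) with hV
  have hV0 : 0 ≤ V := by positivity
  calc ((Nat.log 2 X + 1 : ℕ) : ℝ) ^ 2 * (16 * (1 + l) ^ 6 * (Q⁻¹ ^ 2 * x ^ 2)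
        + (24 * (1 + l) ^ 6 + 16 * #P * (1 + l) ^ 5) * (Q⁻¹ * (x * W)))
      ≤ (2 * (1 + l)) ^ 2 * (16 * (1 + l) ^ 6 * (Q⁻¹ ^ 2 * x ^ 2)
        + (24 * (1 + l) ^ 6 + 16 * #P * (1 + l) ^ 5) * (Q⁻¹ * (x * W))) := by gcongr
    _ = 64 * (1 + l) ^ 8 * (Q⁻¹ ^ 2 * x ^ 2)
        + (4 * (1 + l) ^ 2) * (24 * (1 + l) ^ 6 + 16 * #P * (1 + l) ^ 5)
          * (Q⁻¹ * (x * W)) := by ring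
    _ ≤ 1679616 * l ^ 10 * (Q⁻¹ ^ 2 * x ^ 2)
        + 160 * K₁ * x ^ (4 * ε) * (Q⁻¹ * (x * W)) := by gcongr
    _ = 1679616 * (Q⁻¹ ^ 2 * x ^ 2 * l ^ 10) + 160 * K₁ * (Q⁻¹ * V) := by
        rw [← hxW]; ring
    _ ≤ (1679616 + 160 * K₁) * (Q⁻¹ ^ 2 * x ^ 2 * l ^ 10 + x ^ ((3 : ℝ) / 2) * l ^ 10
          + Q⁻¹ * V) := by
        have h1 : 0 ≤ Q⁻¹ ^ 2 * x ^ 2 * l ^ 10 := by positivity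
        have h2 : 0 ≤ x ^ ((3 : ℝ) / 2) * l ^ 10 := by positivity
        have h3 : 0 ≤ Q⁻¹ * V := by positivity
        nlinarith [mul_nonneg hK₁.le h1, mul_nonneg hK₁.le h2]
end
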